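/- arXiv:1112.2411 — 2 statements merged into one kernel-verified Lean document; each statement's English description precedes it below -/
import Mathlib

section
/- There exist an infinite-dimensional Banach space X with a Schauder basis and constants 0 < c, C < ∞ such that every block subspace of X contains seminormalized block sequences (u_n) and (v_n) with u₁ < v₁ < u₂ < v₂ < … satisfying, for every l ∈ ℕ and all natural numbers l ≤ n₁ < n₂ < … < n_l: ‖Σ_{s=1}^l (u_{n_s} + v_{n_s})‖ ≥ c·l/√(f(l)) and ‖Σ_{s=1}^l (u_{n_s} − v_{n_s})‖ ≤ C·l/f(l). -/
/-- `f(x) = log₂(x+1)`; note `flog 0 = 0`. -/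
noncomputable def flog (x : ℝ) : ℝ := Real.logb 2 (x + 1)

section BanachDefs

variable {X : Type*} [NormedAddCommGroup X] [NormedSpace ℝ X]

/-- A sequence is seminormalized if its norms are bounded away from `0` and `∞`. -/
def Seminormalized (x : ℕ → X) : Prop :=
  ∃ c C : ℝ, 0 < c ∧ ∀ n, c ≤ ‖x n‖ ∧ ‖x n‖ ≤ C

/-- A sequence of nonzero vectors is basic if partial sums of expansions are uniformly
dominated by longer ones. -/
def IsBasicSeq (x : ℕ → X) : Prop :=
  (∀ n, x n ≠ 0) ∧ ∃ K : ℝ, 1 ≤ K ∧ ∀ (a : ℕ → ℝ) (m n : ℕ), m ≤ n →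
    ‖∑ i ∈ Finset.range m, a i • x i‖ ≤ K * ‖∑ i ∈ Finset.range n, a i • x i‖

/-- `(e_n)` is a Schauder basis of `X`: nonzero vectors with dense linear span and uniformly
bounded basis projections. -/
def IsSchauderBasis (e : ℕ → X) : Prop :=
  (∀ n, e n ≠ 0) ∧ Dense (↑(Submodule.span ℝ (Set.range e)) : Set X) ∧
  ∃ K : ℝ, 1 ≤ K ∧ ∀ (a : ℕ → ℝ) (m n : ℕ), m ≤ n →
    ‖∑ i ∈ Finset.range m, a i • e i‖ ≤ K * ‖∑ i ∈ Finset.range n, a i • e i‖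

/-- `(y_n)` is a block sequence of `(e_n)`: nonzero finite linear combinations of the `e_i`
with successive supports `supp y₀ < supp y₁ < …`. -/
def IsBlockSeq (e y : ℕ → X) : Prop :=
  (∀ n, y n ≠ 0) ∧ ∃ (I : ℕ → Finset ℕ) (a : ℕ → ℕ → ℝ),
    (∀ n, y n = ∑ i ∈ I n, a n i • e i) ∧
    (∀ n m, n < m → ∀ i ∈ I n, ∀ j ∈ I m, i < j)

/-- Two sequences are equivalent: the map `u_n ↦ v_n` extends to an isomorphism between the
closed linear spans. -/
def SeqEquiv (u v : ℕ → X) : Prop :=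
  ∃ c C : ℝ, 0 < c ∧ ∀ (a : ℕ → ℝ) (s : Finset ℕ),
    c * ‖∑ n ∈ s, a n • u n‖ ≤ ‖∑ n ∈ s, a n • v n‖ ∧
    ‖∑ n ∈ s, a n • v n‖ ≤ C * ‖∑ n ∈ s, a n • u n‖

/-- The closed linear span of a set. -/
def closedSpan (s : Set X) : Submodule ℝ X :=
  (Submodule.span ℝ s).topologicalClosure

/-- A sequence is weakly null if it tends to `0` in the weak topology. -/
def WeaklyNull (x : ℕ → X) : Prop :=
  ∀ φ : X →L[ℝ] ℝ, Filter.Tendsto (fun n => φ (x n)) Filter.atTop (nhds 0)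

end BanachDefs

/-- `Y` embeds into `Z`: there is a bounded linear injection which is an isomorphism onto its
range (bounded below). -/
def Embeds (Y Z : Type*) [NormedAddCommGroup Y] [NormedSpace ℝ Y]
    [NormedAddCommGroup Z] [NormedSpace ℝ Z] : Prop :=
  ∃ T : Y →L[ℝ] Z, ∃ c : ℝ, 0 < c ∧ ∀ y, c * ‖y‖ ≤ ‖T y‖

namespace IntSp

/-! ### Parameters -/

def bb (j : ℕ) : ℕ := 2 ^ ((j + 8) ^ 2)
def NN (j : ℕ) : ℕ := 2 ^ (bb j)
def al (j : ℕ) : ℕ := 2 * (j + 8) ^ 2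
def mm (j : ℕ) : ℕ := 2 ^ (al j)
def ps (j : ℕ) : ℕ := 2 ^ (j + 12)
def Lam (j : ℕ) : ℕ := 2 ^ (al (j + 1) + 3)

def pp : ℕ → ℕ
  | 0 => 0
  | k + 1 => pp k + al (pp k + 1) + 2 * k + 20

lemma sq_le_two_pow (x : ℕ) : x ^ 2 ≤ 2 ^ (x + 1) := by
  induction x with
  | zero => norm_num
  | succ n ih =>
    rcases n with _ | _ | _ | n
    · norm_num
    · norm_num
    · norm_num
    · rw [pow_succ 2 (n + 1 + 1 + 1 + 1)]
      generalize 2 ^ (n + 1 + 1 + 1 + 1) = y at *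
      have : (n + 1 + 1 + 1 + 1) ^ 2 ≤ 2 * (n + 1 + 1 + 1) ^ 2 := by ring_nf; omega
      omega

lemma NN_eq (j : ℕ) : NN j = 2 ^ (bb j) := rfl

lemma bb_succ (j : ℕ) : bb (j + 1) = bb j * 2 ^ (2 * j + 17) := by
  unfold bb
  rw [← pow_add]
  congr 1
  ring

lemma al_succ_le (j : ℕ) : al (j + 1) + 4 ≤ 2 ^ (j + 12) := by
  unfold al
  have h := sq_le_two_pow (j + 1 + 8)
  have e : (2:ℕ) ^ (j + 12) = 2 ^ (j + 1 + 8 + 1) * 4 := by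
    rw [show j + 12 = (j + 1 + 8 + 1) + 2 by ring, pow_add]; norm_num
  have : 2 ^ 2 ≤ (j + 1 + 8) ^ 2 := Nat.pow_le_pow_left (by omega) 2
  rw [e]; omega

lemma NN_pow_le (j : ℕ) : NN j ^ (al (j + 1) + 3) ≤ NN (j + 1) := by
  unfold NN
  rw [← pow_mul, bb_succ]
  apply Nat.pow_le_pow_right (by norm_num)
  apply Nat.mul_le_mul_left
  calc al (j + 1) + 3 ≤ 2 ^ (j + 12) := by have := al_succ_le j; omega
    _ ≤ 2 ^ (2 * j + 17) := Nat.pow_le_pow_right (by norm_num) (by omega)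

lemma Lam_eq (j : ℕ) : Lam j = 8 * mm (j + 1) := by
  unfold Lam mm
  rw [pow_add]; ring

lemma ps_sq_le (j : ℕ) : (ps (j + 1)) ^ 2 ≤ bb j := by
  unfold ps bb
  rw [← pow_mul]
  apply Nat.pow_le_pow_right (by norm_num)
  nlinarith

lemma ps_mono : Monotone ps := fun a b h => Nat.pow_le_pow_right (by norm_num) (by omega)
lemma al_mono : Monotone al := fun a b h => by
  unfold al
  have : (a + 8) ^ 2 ≤ (b + 8) ^ 2 := Nat.pow_le_pow_left (by omega) 2
  omega
lemma mm_mono : Monotone mm := fun a b h => Nat.pow_le_pow_right (by norm_num) (al_mono h)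
lemma Lam_mono : Monotone Lam := fun a b h => Nat.pow_le_pow_right (by norm_num)
  (by have := al_mono (show a + 1 ≤ b + 1 by omega); omega)
lemma bb_mono : Monotone bb := fun a b h => Nat.pow_le_pow_right (by norm_num)
  (Nat.pow_le_pow_left (by omega) 2)
lemma NN_mono : Monotone NN := fun a b h => Nat.pow_le_pow_right (by norm_num) (bb_mono h)

lemma four_al_le (J k : ℕ) (h : J ≤ k) : 4 * al J ≤ ps k := by
  refine le_trans ?_ (ps_mono h)
  unfold al ps
  have h := sq_le_two_pow (J + 8)
  have e : (2:ℕ) ^ (J + 12) = 2 ^ (J + 8 + 1) * 8 := by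
    rw [show J + 12 = (J + 8 + 1) + 3 by ring, pow_add]; norm_num
  rw [e]; omega

lemma ps_ge (j : ℕ) : 4096 ≤ ps j := by
  have : ps 0 ≤ ps j := ps_mono (Nat.zero_le _)
  have h : ps 0 = 4096 := by unfold ps; norm_num
  omega

lemma le_ps (j : ℕ) : j ≤ ps j := by
  unfold ps
  have := (Nat.lt_two_pow_self (n := j + 12)); omega

lemma ps_le_mm (j : ℕ) : ps j ≤ mm j := by
  unfold ps mm al
  exact Nat.pow_le_pow_right (by norm_num) (by nlinarith)

lemma le_bb (j : ℕ) : 20 + j ≤ bb j := by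
  unfold bb
  have : (j + 8) ^ 2 < 2 ^ ((j + 8) ^ 2) := Nat.lt_two_pow_self
  nlinarith

lemma le_NN (j : ℕ) : j ≤ NN j := by
  have := le_bb j
  have h : bb j < 2 ^ bb j := Nat.lt_two_pow_self
  unfold NN
  omega

lemma NN_ge (j : ℕ) : 8 * 2 ^ j ≤ NN j := by
  have := le_bb j
  unfold NN
  rw [show 8 * 2 ^ j = 2 ^ (3 + j) by rw [pow_add]; norm_num]
  exact Nat.pow_le_pow_right (by norm_num) (by omega)

lemma big_le (J : ℕ) : (3 * NN J) ^ (al (J + 1)) * mm (J + 1) ≤ 2 ^ (mm J) := by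
  have h1 : 3 * NN J ≤ 2 ^ (bb J + 2) := by
    unfold NN; rw [pow_add]; omega
  have h2 : (3 * NN J) ^ (al (J + 1)) ≤ 2 ^ ((bb J + 2) * al (J + 1)) := by
    rw [pow_mul]; exact Nat.pow_le_pow_left h1 _
  calc (3 * NN J) ^ (al (J + 1)) * mm (J + 1)
      ≤ 2 ^ ((bb J + 2) * al (J + 1)) * 2 ^ (al (J + 1)) := Nat.mul_le_mul_right _ h2
    _ = 2 ^ ((bb J + 2) * al (J + 1) + al (J + 1)) := by rw [pow_add]
    _ ≤ 2 ^ (mm J) := by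
      apply Nat.pow_le_pow_right (by norm_num)
      have h3 := al_succ_le J
      have h4 := le_bb J
      have h5 : (bb J + 2) * al (J + 1) + al (J + 1) ≤ (2 * bb J) * 2 ^ (J + 12) := by
        nlinarith
      refine h5.trans ?_
      unfold bb mm al
      rw [show 2 * 2 ^ ((J + 8) ^ 2) * 2 ^ (J + 12) = 2 ^ (1 + (J + 8) ^ 2 + (J + 12)) by
        rw [pow_add 2 (1 + (J + 8) ^ 2) (J + 12), pow_add 2 1, pow_one]]
      apply Nat.pow_le_pow_right (by norm_num)
      nlinarith

lemma pp_succ (k : ℕ) : pp (k + 1) = pp k + al (pp k + 1) + 2 * k + 20 := rfl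
lemma pp_zero : pp 0 = 0 := rfl
lemma pp_strictMono : StrictMono pp := strictMono_nat_of_lt_succ (fun k => by rw [pp_succ]; omega)

lemma two_mul_le_pp (k : ℕ) : 2 * k ≤ pp k := by
  induction k with
  | zero => simp
  | succ k ih => rw [pp_succ]; omega

lemma NN_pp (k κ : ℕ) (h : κ < pp k) : 8 * NN κ * 2 ^ k ≤ NN (pp k) := by
  obtain ⟨q, hq⟩ : ∃ q, pp k = q + 1 := ⟨pp k - 1, by omega⟩
  have h1 : NN κ ≤ NN q := NN_mono (by omega)
  have h2 : k ≤ q := by have := two_mul_le_pp k; omega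
  have h3 := NN_pow_le q
  rw [hq]
  have h4 : NN q * NN q ≤ NN (q + 1) := by
    refine le_trans ?_ h3
    rw [← sq]
    exact Nat.pow_le_pow_right (by unfold NN; positivity) (by omega)
  have h5 := NN_ge q
  have h6 : (2:ℕ) ^ k ≤ 2 ^ q := Nat.pow_le_pow_right (by norm_num) h2
  calc 8 * NN κ * 2 ^ k = NN κ * (8 * 2 ^ k) := by ring
    _ ≤ NN q * NN q := Nat.mul_le_mul h1 (by omega)
    _ ≤ _ := h4

lemma NN_pp' (k : ℕ) : 8 * 2 ^ k ≤ NN (pp k) := by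
  refine le_trans ?_ (NN_ge (pp k))
  have := two_mul_le_pp k
  apply Nat.mul_le_mul_left
  exact Nat.pow_le_pow_right (by norm_num) (by omega)

lemma Lam_pp (k κ : ℕ) (h : k < κ) : 6 * Lam (pp k) * 2 ^ (κ + k) ≤ ps (pp κ) := by
  obtain ⟨q, rfl⟩ : ∃ q, κ = q + 1 := ⟨κ - 1, by omega⟩
  have h1 : Lam (pp k) ≤ Lam (pp q) := Lam_mono (pp_strictMono.monotone (by omega))
  calc 6 * Lam (pp k) * 2 ^ (q + 1 + k) ≤ 2 ^ 3 * Lam (pp q) * 2 ^ (q + 1 + k) := by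
        apply Nat.mul_le_mul_right
        apply Nat.mul_le_mul _ h1
        norm_num
    _ = 2 ^ (3 + (al (pp q + 1) + 3) + (q + 1 + k)) := by
        unfold Lam; rw [← pow_add, ← pow_add]
    _ ≤ _ := by
        unfold ps
        apply Nat.pow_le_pow_right (by norm_num)
        rw [pp_succ]; omega

lemma small_class (κ J : ℕ) (h : ps (pp κ) < mm J * 2 ^ κ) : κ < al J := by
  unfold ps mm at h
  rw [← pow_add] at h
  have h1 := (Nat.pow_lt_pow_iff_right (by norm_num : 1 < 2)).1 h
  have := two_mul_le_pp κ
  omega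

lemma exists_class (κ : ℕ) : ∃ c, pp c ≤ κ ∧ κ < pp (c + 1) := by
  have hex : ∃ c, κ < pp (c + 1) := ⟨κ, by have := two_mul_le_pp (κ + 1); omega⟩
  classical
  refine ⟨Nat.find hex, ?_, Nat.find_spec hex⟩
  rcases h : Nat.find hex with _ | c
  · simp [pp_zero]
  · have := Nat.find_min hex (m := c) (by omega)
    omega

lemma two_pow_al (j : ℕ) : 2 ^ (al j) = mm j := rfl

attribute [irreducible] bb NN al mm ps Lam pp

/-! ### Functionals, vectors and the norming set -/

abbrev F := ℕ →₀ ℚ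
abbrev V := ℕ →₀ ℝ

noncomputable def ev (f : F) : V →ₗ[ℝ] ℝ := Finsupp.linearCombination ℝ (fun n => (f n : ℝ))

lemma ev_apply (f : F) (x : V) : ev f x = ∑ n ∈ x.support, x n * (f n : ℝ) := by
  simp [ev, Finsupp.linearCombination_apply, Finsupp.sum]

lemma ev_single (f : F) (n : ℕ) (c : ℝ) : ev f (Finsupp.single n c) = c * f n := by
  simp [ev]

lemma ev_add (f g : F) (x : V) : ev (f + g) x = ev f x + ev g x := by
  simp [ev_apply, mul_add, Finset.sum_add_distrib]

lemma ev_zero (x : V) : ev 0 x = 0 := by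
  simp [ev_apply]

lemma ev_smul (c : ℚ) (f : F) (x : V) : ev (c • f) x = (c : ℝ) * ev f x := by
  simp only [ev_apply, Finsupp.smul_apply, smul_eq_mul, Rat.cast_mul, Finset.mul_sum]
  exact Finset.sum_congr rfl fun n _ => by ring

lemma ev_sum {ι : Type*} (S : Finset ι) (g : ι → F) (x : V) :
    ev (∑ b ∈ S, g b) x = ∑ b ∈ S, ev (g b) x := by
  classical
  induction S using Finset.induction_on with
  | empty => simp [ev_zero]
  | insert a s ha ih => rw [Finset.sum_insert ha, Finset.sum_insert ha, ev_add, ih]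

noncomputable def rs {R : Type*} [Zero R] (a b : ℕ) (f : ℕ →₀ R) : ℕ →₀ R :=
  f.filter (fun n => a ≤ n ∧ n < b)

lemma rs_apply {R : Type*} [Zero R] (a b : ℕ) (f : ℕ →₀ R) (n : ℕ) :
    rs a b f n = if a ≤ n ∧ n < b then f n else 0 := by
  simp [rs, Finsupp.filter_apply]

lemma rs_rs {R : Type*} [Zero R] (a b a' b' : ℕ) (f : ℕ →₀ R) :
    rs a' b' (rs a b f) = rs (max a a') (min b b') f := by
  ext n
  simp only [rs_apply]
  split_ifs <;> first | rfl | (exfalso; omega)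

lemma rs_add {R : Type*} [AddZeroClass R] (a b : ℕ) (f g : ℕ →₀ R) :
    rs a b (f + g) = rs a b f + rs a b g := by
  ext n
  simp only [rs_apply, Finsupp.add_apply]
  split_ifs <;> simp

lemma rs_smul (a b : ℕ) (c : ℚ) (f : F) : rs a b (c • f) = c • rs a b f := by
  ext n
  simp only [rs_apply, Finsupp.smul_apply]
  split_ifs <;> simp

lemma rs_sum {R : Type*} [AddCommMonoid R] {ι : Type*} (a b : ℕ) (S : Finset ι) (g : ι → ℕ →₀ R) :
    rs a b (∑ i ∈ S, g i) = ∑ i ∈ S, rs a b (g i) := by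
  ext n
  simp only [rs_apply, Finsupp.finsetSum_apply]
  split_ifs <;> simp

lemma rs_zero {R : Type*} [Zero R] (a b : ℕ) : rs a b (0 : ℕ →₀ R) = 0 := by
  ext n; simp [rs_apply]

lemma ev_eq_sum_of_subset (f : F) (x : V) (S : Finset ℕ) (h : x.support ⊆ S) :
    ev f x = ∑ n ∈ S, x n * (f n : ℝ) := by
  rw [ev_apply]
  apply Finset.sum_subset h
  intro n _ hn
  simp [Finsupp.notMem_support_iff.1 hn]

lemma ev_rs (a b : ℕ) (f : F) (x : V) : ev (rs a b f) x = ev f (rs a b x) := by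
  rw [ev_apply, ev_eq_sum_of_subset f (rs a b x) x.support]
  · refine Finset.sum_congr rfl fun n _ => ?_
    simp only [rs_apply]
    split_ifs <;> simp
  · intro n hn
    simp only [Finsupp.mem_support_iff, rs_apply] at hn ⊢
    split_ifs at hn <;> simp_all

/-- successive supports -/
def Scc {R : Type*} [Zero R] (g : ℕ → ℕ →₀ R) : Prop :=
  ∀ i j, i < j → ∀ m n, g i m ≠ 0 → g j n ≠ 0 → m < n

lemma Scc.rs {R : Type*} [Zero R] {g : ℕ → ℕ →₀ R} (h : Scc g) (a b : ℕ) :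
    Scc (fun i => rs a b (g i)) := by
  intro i j hij m n hm hn
  simp only [rs_apply] at hm hn
  apply h i j hij m n
  · intro h0; simp [h0] at hm
  · intro h0; simp [h0] at hn

noncomputable instance encF : Encodable F := Encodable.ofCountable F

noncomputable def sg (l : List F) : ℕ := Encodable.encode l

lemma sg_inj {l l' : List F} (h : sg l = sg l') : l = l' := Encodable.encode_injective h

lemma sg_cons (a : F) (l : List F) : sg l < sg (a :: l) := by
  unfold sg
  rw [Encodable.encode_list_cons]
  exact Nat.lt_succ_of_le (Nat.right_le_pair _ _)

def hist (h : ℕ → F) : ℕ → List F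
  | 0 => []
  | i + 1 => h i :: hist h i

lemma hist_length (h : ℕ → F) (i : ℕ) : (hist h i).length = i := by
  induction i with
  | zero => rfl
  | succ i ih => simp [hist, ih]

lemma hist_congr (h h' : ℕ → F) (i : ℕ) (H : ∀ j < i, h j = h' j) : hist h i = hist h' i := by
  induction i with
  | zero => rfl
  | succ i ih => simp only [hist]; rw [H i (by omega), ih (fun j hj => H j (by omega))]

lemma hist_eq (h h' : ℕ → F) (i : ℕ) (H : hist h i = hist h' i) : ∀ j < i, h j = h' j := by
  induction i with
  | zero => intro j hj; omega
  | succ i ih =>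
    simp only [hist, List.cons.injEq] at H
    intro j hj
    rcases Nat.lt_succ_iff_lt_or_eq.1 hj with hj | rfl
    · exact ih H.2 j hj
    · exact H.1

/-- class of the i-th term -/
noncomputable def cl (h : ℕ → F) (i : ℕ) : ℕ := sg (hist h i)

lemma cl_strictMono (h : ℕ → F) : StrictMono (cl h) :=
  strictMono_nat_of_lt_succ fun i => sg_cons (h i) (hist h i)

lemma le_cl (h : ℕ → F) (i : ℕ) : i ≤ cl h i := (cl_strictMono h).le_apply

lemma cl_eq {h h' : ℕ → F} {i j : ℕ} (H : cl h i = cl h' j) :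
    i = j ∧ ∀ k < i, h k = h' k := by
  have h1 := sg_inj H
  have h2 : i = j := by
    have := congrArg List.length h1
    simpa [hist_length] using this
  subst h2
  exact ⟨rfl, hist_eq h h' i h1⟩

lemma cl_congr {h h' : ℕ → F} {i : ℕ} (H : ∀ j < i, h j = h' j) : cl h i = cl h' i := by
  unfold cl; rw [hist_congr h h' i H]

lemma split_branch (h f : ℕ → F) (B : ℕ) :
    ∃ i0, (∀ i < i0, h i = f i) ∧ ∀ i, i0 ≤ i → i < B → ∀ j, j ≠ i0 → cl h i ≠ cl f j := by
  classical
  by_cases H : ∃ i, h i ≠ f i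
  · refine ⟨Nat.find H, fun i hi => not_not.1 (Nat.find_min H hi), ?_⟩
    intro i hi _ j hj he
    obtain ⟨rfl, h2⟩ := cl_eq he
    exact Nat.find_spec H (h2 _ (by omega))
  · push Not at H
    exact ⟨B, fun i _ => H i, fun i hi hB => by omega⟩

inductive W : Option ℕ → F → Prop
  | zero : W none 0
  | basis (n : ℕ) : W none (Finsupp.single n 1)
  | unc (κ : ℕ) (g : ℕ → F) (o : ℕ → Option ℕ) (S : Finset ℕ)
      (hg : ∀ b, W (o b) (g b)) (hs : Scc g) (hc : S.card ≤ NN κ) :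
      W (some κ) ((1 / (mm κ : ℚ)) • ∑ b ∈ S, g b)
  | spec (κ : ℕ) (h : ℕ → F) (ix : ℕ → ℕ) (S : Finset ℕ) (a b : ℕ)
      (hh : ∀ i, W (some (ix i)) (h i))
      (hix : ∀ i, pp (cl h i) ≤ ix i ∧ ix i < pp (cl h i + 1))
      (hs : Scc h) (hc : S.card ≤ NN κ) :
      W (some κ) ((1 / (ps κ : ℚ)) • ∑ s ∈ S, rs a b (h (2 * s) + h (2 * s + 1)))

lemma W.rs {o : Option ℕ} {f : F} (h : W o f) (a b : ℕ) : W o (rs a b f) := by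
  induction h with
  | zero => rw [rs_zero]; exact W.zero
  | basis n =>
    by_cases hn : a ≤ n ∧ n < b
    · have : IntSp.rs a b (Finsupp.single n (1:ℚ)) = Finsupp.single n 1 := by
        unfold IntSp.rs; exact Finsupp.filter_single_of_pos _ hn
      rw [this]; exact W.basis n
    · have : IntSp.rs a b (Finsupp.single n (1:ℚ)) = 0 := by
        unfold IntSp.rs; exact Finsupp.filter_single_of_neg _ hn
      rw [this]; exact W.zero
  | unc κ g o S hg hs hc ih =>
    rw [rs_smul, rs_sum]
    exact W.unc κ _ o S ih (hs.rs a b) hc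
  | spec κ h ix S a' b' hh hix hs hc ih =>
    rw [rs_smul, rs_sum]
    simp only [rs_rs]
    exact W.spec κ h ix S _ _ hh hix hs hc

def InW (f : F) : Prop := ∃ o, W o f

lemma InW.rs {f : F} (h : InW f) (a b : ℕ) : InW (rs a b f) := by
  obtain ⟨o, ho⟩ := h; exact ⟨o, ho.rs a b⟩

/-- weighted functionals -/
def Wt (κ w : ℕ) (h : F) : Prop := ps κ ≤ w ∧ InW h ∧ ∃ (g : ℕ → F) (S : Finset ℕ),
  (∀ b, InW (g b)) ∧ Scc g ∧ S.card ≤ 2 * NN κ ∧ h = (1 / (w : ℚ)) • ∑ b ∈ S, g b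

def pairs (S : Finset ℕ) : Finset ℕ := S.image (fun s => 2 * s) ∪ S.image (fun s => 2 * s + 1)

lemma pairs_card (S : Finset ℕ) : (pairs S).card ≤ 2 * S.card := by
  refine (Finset.card_union_le _ _).trans ?_
  have h1 := Finset.card_image_le (s := S) (f := fun s => 2 * s)
  have h2 := Finset.card_image_le (s := S) (f := fun s => 2 * s + 1)
  omega

lemma mem_pairs (S : Finset ℕ) (i : ℕ) : i ∈ pairs S ↔ i / 2 ∈ S := by
  simp only [pairs, Finset.mem_union, Finset.mem_image]
  constructor
  · rintro (⟨s, hs, rfl⟩ | ⟨s, hs, rfl⟩)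
    · rwa [show 2 * s / 2 = s by omega]
    · rwa [show (2 * s + 1) / 2 = s by omega]
  · intro h
    rcases Nat.even_or_odd' i with ⟨c, rfl | rfl⟩
    · left; exact ⟨c, by rwa [show 2 * c / 2 = c by omega] at h, rfl⟩
    · right; exact ⟨c, by rwa [show (2 * c + 1) / 2 = c by omega] at h, rfl⟩

lemma sum_pairs {M : Type*} [AddCommMonoid M] (S : Finset ℕ) (g : ℕ → M) :
    ∑ i ∈ pairs S, g i = ∑ s ∈ S, (g (2 * s) + g (2 * s + 1)) := by
  unfold pairs
  rw [Finset.sum_union, Finset.sum_image, Finset.sum_image, Finset.sum_add_distrib]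
  · intro x _ y _ h; simpa using h
  · intro x _ y _ h; simpa using h
  · rw [Finset.disjoint_left]
    intro i hi hj
    simp only [Finset.mem_image] at hi hj
    obtain ⟨s, _, rfl⟩ := hi
    obtain ⟨t, _, ht⟩ := hj
    omega

lemma W_cases {κ : ℕ} {f : F} (hf : W (some κ) f) : Wt κ (mm κ) f ∨
    (Wt κ (ps κ) f ∧ ∃ (h : ℕ → F) (ix : ℕ → ℕ) (S : Finset ℕ) (a b : ℕ),
      (∀ i, W (some (ix i)) (h i)) ∧
      (∀ i, pp (cl h i) ≤ ix i ∧ ix i < pp (cl h i + 1)) ∧ Scc h ∧ S.card ≤ NN κ ∧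
      f = (1 / (ps κ : ℚ)) • ∑ s ∈ S, rs a b (h (2 * s) + h (2 * s + 1))) := by
  have hIn : InW f := ⟨_, hf⟩
  cases hf with
  | unc κ g o S hg hs hc =>
    left
    exact ⟨ps_le_mm κ, hIn, g, S, fun b => ⟨_, hg b⟩, hs, by omega, rfl⟩
  | spec κ h ix S a b hh hix hs hc =>
    right
    refine ⟨⟨le_rfl, hIn, fun i => rs a b (h i), pairs S, fun i => ⟨_, (hh i).rs a b⟩, hs.rs a b, ?_, ?_⟩,
      h, ix, S, a, b, hh, hix, hs, hc, rfl⟩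
    · have := pairs_card S; omega
    · rw [sum_pairs]; simp only [rs_add]

lemma W_exists_wt {κ : ℕ} {f : F} (hf : W (some κ) f) : ∃ w, Wt κ w f := by
  rcases W_cases hf with h | h
  · exact ⟨_, h⟩
  · exact ⟨_, h.1⟩

lemma W_none {f : F} (hf : W none f) : f = 0 ∨ ∃ n, f = Finsupp.single n 1 := by
  cases hf with
  | zero => left; rfl
  | basis n => right; exact ⟨n, rfl⟩

lemma scc_sum_le {g : ℕ → F} (hs : Scc g) (S : Finset ℕ) (n : ℕ) (h : ∀ b, |g b n| ≤ 1) :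
    |(∑ b ∈ S, g b) n| ≤ 1 := by
  rw [Finsupp.finsetSum_apply]
  by_cases H : ∃ b ∈ S, g b n ≠ 0
  · obtain ⟨b, hb, hbn⟩ := H
    rw [Finset.sum_eq_single_of_mem b hb]
    · exact h b
    · intro c _ hc
      by_contra hcn
      rcases lt_or_gt_of_ne hc with hlt | hlt
      · exact lt_irrefl _ (hs c b hlt n n hcn hbn)
      · exact lt_irrefl _ (hs b c hlt n n hbn hcn)
  · push Not at H
    rw [Finset.sum_eq_zero H]; simp

lemma abs_smul_le {w : ℕ} (hw : 1 ≤ w) {q : ℚ} (hq : |q| ≤ 1) : |1 / (w : ℚ) * q| ≤ 1 := by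
  rw [abs_mul]
  have h1 : |1 / (w:ℚ)| ≤ 1 := by
    rw [abs_of_nonneg (by positivity)]
    apply div_le_one_of_le₀ _ (by positivity)
    exact_mod_cast hw
  exact mul_le_one₀ h1 (abs_nonneg _) hq

lemma W.coef {o : Option ℕ} {f : F} (h : W o f) (n : ℕ) : |f n| ≤ 1 := by
  induction h with
  | zero => simp
  | basis m =>
    rw [Finsupp.single_apply]; split_ifs <;> simp
  | unc κ g o S hg hs hc ih =>
    rw [Finsupp.smul_apply, smul_eq_mul]
    exact abs_smul_le (by have := ps_ge κ; have := ps_le_mm κ; omega) (scc_sum_le hs S n ih)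
  | spec κ h ix S a b hh hix hs hc ih =>
    rw [Finsupp.smul_apply, smul_eq_mul]
    refine abs_smul_le (by have := ps_ge κ; omega) ?_
    have h2 := scc_sum_le (hs.rs a b) (pairs S) n (fun i => ?_)
    · rw [sum_pairs] at h2; simpa only [rs_add] using h2
    · rw [rs_apply]; split_ifs
      · exact ih i
      · simp

lemma InW.coef {f : F} (h : InW f) (n : ℕ) : |f n| ≤ 1 := by
  obtain ⟨o, ho⟩ := h; exact ho.coef n

noncomputable def l1 (x : V) : ℝ := ∑ n ∈ x.support, |x n|

lemma l1_nonneg (x : V) : 0 ≤ l1 x := Finset.sum_nonneg fun _ _ => abs_nonneg _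

lemma ev_le_of_coef {f : F} (h : ∀ n, |f n| ≤ 1) (x : V) : |ev f x| ≤ l1 x := by
  rw [ev_apply]
  refine (Finset.abs_sum_le_sum_abs _ _).trans (Finset.sum_le_sum fun n _ => ?_)
  rw [abs_mul]
  have : |(f n : ℝ)| ≤ 1 := by exact_mod_cast h n
  exact mul_le_of_le_one_right (abs_nonneg _) this

lemma InW.le_l1 {f : F} (h : InW f) (x : V) : |ev f x| ≤ l1 x := ev_le_of_coef h.coef x

lemma Wt.le_l1 {κ w : ℕ} {f : F} (h : Wt κ w f) (x : V) : |ev f x| ≤ l1 x / w := by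
  obtain ⟨hw, _, g, S, hg, hs, hc, rfl⟩ := h
  rw [ev_smul, abs_mul]
  have h1 := ev_le_of_coef (fun n => scc_sum_le hs S n (fun b => (hg b).coef n)) x
  push_cast
  rw [abs_of_nonneg (by positivity), one_div, inv_mul_eq_div]
  gcongr

lemma Wt.pos {κ w : ℕ} {f : F} (h : Wt κ w f) : (0:ℝ) < w := by
  have := h.1; have := ps_ge κ
  exact_mod_cast (by omega : 0 < w)

lemma inc (R : ℕ → ℕ → Prop) (hR : ∀ i i' b b', R i b → R i' b' → i < i' → b ≤ b')
    (A S : Finset ℕ) [DecidablePred fun q : ℕ × ℕ => R q.1 q.2] :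
    ((A ×ˢ S).filter (fun q => R q.1 q.2)).card ≤ A.card + S.card := by
  classical
  set P := (A ×ˢ S).filter (fun q => R q.1 q.2) with hP
  rw [← Finset.card_filter_add_card_filter_not (s := P) (fun q => ∃ b' ∈ S, b' < q.2 ∧ R q.1 b')]
  rw [add_comm]
  apply Nat.add_le_add
  · refine Finset.card_le_card_of_injOn Prod.fst ?_ ?_
    · intro q hq
      simp only [hP, Finset.coe_filter, Finset.mem_filter, Finset.mem_product, Set.mem_ofPred_eq] at hq
      exact hq.1.1.1
    · intro q hq q' hq' he
      simp only [hP, Finset.coe_filter, Finset.mem_filter, Finset.mem_product, Set.mem_ofPred_eq,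
        not_exists, not_and] at hq hq'
      obtain ⟨i, b⟩ := q
      obtain ⟨i', b'⟩ := q'
      simp only at he hq hq'
      subst he
      have h1 : b = b' := by
        rcases lt_trichotomy b b' with h | h | h
        · exact absurd hq.1.2 (hq'.2 b hq.1.1.2 h)
        · exact h
        · exact absurd hq'.1.2 (hq.2 b' hq'.1.1.2 h)
      rw [h1]
  · refine Finset.card_le_card_of_injOn Prod.snd ?_ ?_
    · intro q hq
      simp only [hP, Finset.coe_filter, Finset.mem_filter, Finset.mem_product, Set.mem_ofPred_eq] at hq
      exact hq.1.1.2
    · intro q hq q' hq' he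
      simp only [hP, Finset.coe_filter, Finset.mem_filter, Finset.mem_product, Set.mem_ofPred_eq] at hq hq'
      obtain ⟨i, b⟩ := q
      obtain ⟨i', b'⟩ := q'
      simp only at he hq hq'
      subst he
      obtain ⟨c, _, hc1, hc2⟩ := hq.2
      obtain ⟨c', _, hc1', hc2'⟩ := hq'.2
      have h1 : i = i' := by
        rcases lt_trichotomy i i' with h | h | h
        · have := hR i i' b c' hq.1.2 hc2' h; omega
        · exact h
        · have := hR i' i b c hq'.1.2 hc2 h; omega
      rw [h1]

/-- common point of supports -/
def hit (f : F) (x : V) : Prop := ∃ n, f n ≠ 0 ∧ x n ≠ 0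

lemma hit_of_ev {f : F} {x : V} (h : ev f x ≠ 0) : hit f x := by
  by_contra H
  apply h
  rw [ev_apply]
  apply Finset.sum_eq_zero
  intro n hn
  have : f n = 0 := by
    by_contra h0
    exact H ⟨n, h0, Finsupp.mem_support_iff.1 hn⟩
  simp [this]

open Classical in
lemma hit_card {x : ℕ → V} {g : ℕ → F} (hx : Scc x) (hg : Scc g) (A S : Finset ℕ) :
    ∑ b ∈ S, (A.filter (fun i => hit (g b) (x i))).card ≤ A.card + S.card := by
  have h := inc (fun i b => hit (g b) (x i)) (by
    rintro i i' b b' ⟨n, h1, h2⟩ ⟨n', h1', h2'⟩ hi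
    by_contra hb
    push Not at hb
    have h3 := hx i i' hi n n' h2 h2'
    have h4 := hg b' b hb n' n h1' h1
    omega) A S
  refine le_trans (le_of_eq ?_) h
  rw [Finset.card_filter, Finset.sum_product_right]
  refine Finset.sum_congr rfl fun b _ => ?_
  rw [Finset.card_filter]

/-! ### The space -/

def WS : Type := {f : F // InW f}

abbrev LW := lp (fun _ : WS => ℝ) ⊤

lemma memlp_ev (x : V) : Memℓp (fun f : WS => ev f.1 x) ⊤ := by
  apply memℓp_infty
  refine ⟨l1 x, ?_⟩
  rintro _ ⟨f, rfl⟩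
  exact f.2.le_l1 x

noncomputable def TT : V →ₗ[ℝ] LW where
  toFun x := ⟨fun f : WS => ev f.1 x, memlp_ev x⟩
  map_add' x y := by
    apply Subtype.ext
    funext f
    exact map_add (ev f.1) x y
  map_smul' c x := by
    apply Subtype.ext
    funext f
    exact map_smul (ev f.1) c x

lemma TT_apply (x : V) (f : WS) : (TT x : ∀ _ : WS, ℝ) f = ev f.1 x := rfl

noncomputable def nrm (x : V) : ℝ := ‖TT x‖

lemma nrm_nonneg (x : V) : 0 ≤ nrm x := norm_nonneg _

lemma ev_le_nrm {f : F} (hf : InW f) (x : V) : |ev f x| ≤ nrm x :=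
  lp.norm_apply_le_norm (by simp) (TT x) ⟨f, hf⟩

lemma nrm_le {x : V} {C : ℝ} (hC : 0 ≤ C) (h : ∀ f, InW f → |ev f x| ≤ C) : nrm x ≤ C :=
  lp.norm_le_of_forall_le hC (fun f => h f.1 f.2)

lemma exists_of_lt_nrm {x : V} {C : ℝ} (hC : 0 ≤ C) (h : C < nrm x) :
    ∃ f, InW f ∧ C < |ev f x| := by
  by_contra H
  push Not at H
  exact absurd (nrm_le hC H) (not_le.2 h)

lemma nrm_smul (c : ℝ) (x : V) : nrm (c • x) = |c| * nrm x := by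
  unfold nrm; rw [map_smul, norm_smul, Real.norm_eq_abs]

lemma nrm_sum_le {ι : Type*} (S : Finset ι) (x : ι → V) : nrm (∑ i ∈ S, x i) ≤ ∑ i ∈ S, nrm (x i) := by
  unfold nrm; rw [map_sum]; exact norm_sum_le _ _

lemma InW_basis (n : ℕ) : InW (Finsupp.single n 1) := ⟨_, W.basis n⟩

lemma ev_basis (n : ℕ) (x : V) : ev (Finsupp.single n 1) x = x n := by
  rw [ev_eq_sum_of_subset _ _ (insert n x.support) (Finset.subset_insert _ _)]
  rw [Finset.sum_eq_single_of_mem n (Finset.mem_insert_self _ _)]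
  · simp
  · intro b _ hb; simp [Finsupp.single_apply, hb.symm]

lemma coord_le_nrm (x : V) (n : ℕ) : |x n| ≤ nrm x := by
  rw [← ev_basis]; exact ev_le_nrm (InW_basis n) x

lemma nrm_pos {x : V} (hx : x ≠ 0) : 0 < nrm x := by
  obtain ⟨n, hn⟩ := Finsupp.ne_iff.1 hx
  exact lt_of_lt_of_le (abs_pos.2 hn) (coord_le_nrm x n)

lemma nrm_rs_le (a b : ℕ) (x : V) : nrm (rs a b x) ≤ nrm x :=
  nrm_le (nrm_nonneg x) fun f hf => by
    rw [← ev_rs]; exact ev_le_nrm (hf.rs a b) x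

noncomputable def XS : Submodule ℝ LW := (LinearMap.range TT).topologicalClosure

noncomputable def TX : V →ₗ[ℝ] XS :=
  LinearMap.codRestrict XS TT (fun x => Submodule.le_topologicalClosure _ ⟨x, rfl⟩)

lemma TX_norm (x : V) : ‖TX x‖ = nrm x := rfl

noncomputable def ee (n : ℕ) : XS := TX (Finsupp.single n 1)

lemma XS_complete : CompleteSpace XS := by
  unfold XS; infer_instance

lemma TX_eq (s : Finset ℕ) (a : ℕ → ℝ) :
    ∑ i ∈ s, a i • ee i = TX (∑ i ∈ s, Finsupp.single i (a i)) := by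
  rw [map_sum]
  refine Finset.sum_congr rfl fun i _ => ?_
  rw [ee, ← map_smul]; simp

lemma TX_eq' (x : V) : TX x = ∑ i ∈ x.support, x i • ee i := by
  rw [TX_eq]
  congr 1
  exact (Finsupp.sum_single x).symm

lemma TX_injective : Function.Injective TX := by
  rw [← LinearMap.ker_eq_bot, LinearMap.ker_eq_bot']
  intro x hx
  by_contra h
  have := nrm_pos h
  rw [← TX_norm, hx, norm_zero] at this
  exact lt_irrefl _ this

lemma XS_infinite : ¬ FiniteDimensional ℝ XS := by
  intro h
  have h2 : FiniteDimensional ℝ V := FiniteDimensional.of_injective TX TX_injective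
  have h3 : Finite ℕ := (Module.Finite.finite_basis (Finsupp.basisSingleOne (R := ℝ) (ι := ℕ)))
  exact not_finite ℕ

lemma ee_basis : (∀ n, ee n ≠ 0) ∧ Dense (↑(Submodule.span ℝ (Set.range ee)) : Set XS) ∧
    ∃ K : ℝ, 1 ≤ K ∧ ∀ (a : ℕ → ℝ) (m n : ℕ), m ≤ n →
    ‖∑ i ∈ Finset.range m, a i • ee i‖ ≤ K * ‖∑ i ∈ Finset.range n, a i • ee i‖ := by
  refine ⟨?_, ?_, 1, le_rfl, ?_⟩
  · intro n h
    have : (Finsupp.single n 1 : V) = 0 := TX_injective (by rw [map_zero]; exact h)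
    simp at this
  · intro x
    have hx : (x : LW) ∈ closure (LinearMap.range TT : Set LW) := x.2
    rw [Metric.mem_closure_iff] at hx ⊢
    intro ε hε
    obtain ⟨y, ⟨v, rfl⟩, hy⟩ := hx ε hε
    refine ⟨TX v, ?_, hy⟩
    rw [TX_eq']
    exact Submodule.sum_mem _ fun i _ =>
      Submodule.smul_mem _ _ (Submodule.subset_span ⟨i, rfl⟩)
  · intro a m n hmn
    rw [TX_eq, TX_eq, TX_norm, TX_norm, one_mul]
    refine le_trans (le_of_eq ?_) (nrm_rs_le 0 m _)
    congr 1
    rw [rs_sum, ← Finset.sum_subset (Finset.range_subset_range.2 hmn)]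
    · refine Finset.sum_congr rfl fun i hi => ?_
      ext k
      rw [rs_apply]
      split_ifs with h
      · rfl
      · rw [Finsupp.single_apply, if_neg]
        rintro rfl
        simp at hi; omega
    · intro i _ hi
      ext k
      rw [rs_apply]
      split_ifs with h
      · rw [Finsupp.single_apply, if_neg]
        · rfl
        · rintro rfl
          simp at hi; omega
      · rfl

/-! ### Averages -/

def Blk (A : ℕ → ℕ) (y : ℕ → V) : Prop :=
  StrictMono A ∧ ∀ a n, y a n ≠ 0 → A a ≤ n ∧ n < A (a + 1)

lemma Blk.scc {A : ℕ → ℕ} {y : ℕ → V} (h : Blk A y) : Scc y := by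
  intro i j hij m n hm hn
  have h1 := (h.2 i m hm).2
  have h2 := (h.2 j n hn).1
  have h3 : A (i + 1) ≤ A j := h.1.monotone hij
  omega

lemma rs_self {R : Type*} [Zero R] {a b : ℕ} {x : ℕ →₀ R} (h : ∀ n, x n ≠ 0 → a ≤ n ∧ n < b) :
    rs a b x = x := by
  ext n
  rw [rs_apply]
  split_ifs with h1
  · rfl
  · by_contra h2; exact h1 (h n (Ne.symm h2))

lemma rs_disj {R : Type*} [Zero R] {a b : ℕ} {x : ℕ →₀ R} (h : ∀ n, x n ≠ 0 → n < a ∨ b ≤ n) :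
    rs a b x = 0 := by
  ext n
  rw [rs_apply]
  split_ifs with h1
  · by_contra h2
    have := h n h2
    omega
  · rfl

lemma Blk.ev_ne {A : ℕ → ℕ} {y : ℕ → V} (h : Blk A y) (f : F) {a a' : ℕ} (hne : a ≠ a') :
    ev (rs (A a) (A (a + 1)) f) (y a') = 0 := by
  rw [ev_rs, rs_disj, map_zero]
  intro n hn
  have h1 := h.2 a' n hn
  rcases lt_or_gt_of_ne hne with h2 | h2
  · right; have : A (a + 1) ≤ A a' := h.1.monotone h2
    omega
  · left; have : A (a' + 1) ≤ A a := h.1.monotone h2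
    omega

lemma Blk.ev_self {A : ℕ → ℕ} {y : ℕ → V} (h : Blk A y) (f : F) (a : ℕ) :
    ev (rs (A a) (A (a + 1)) f) (y a) = ev f (y a) := by
  rw [ev_rs, rs_self (h.2 a)]

lemma Blk.scc_rs {A : ℕ → ℕ} {y : ℕ → V} (h : Blk A y) (g : ℕ → F) :
    Scc (fun a => rs (A a) (A (a + 1)) (g a)) := by
  intro i j hij m n hm hn
  simp only [rs_apply] at hm hn
  have h3 : A (i + 1) ≤ A j := h.1.monotone hij
  by_cases h1 : A i ≤ m ∧ m < A (i + 1)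
  · by_cases h2 : A j ≤ n ∧ n < A (j + 1)
    · omega
    · simp [h2] at hn
  · simp [h1] at hm

def Avg (n : ℕ) (x : V) : Prop := ∃ X : ℕ → V, Scc X ∧ (∀ i, nrm (X i) ≤ 1) ∧
  x = (1 / (n : ℝ)) • ∑ i ∈ Finset.range n, X i

lemma Avg.nrm_le {n : ℕ} {x : V} (h : Avg n x) : nrm x ≤ 1 := by
  obtain ⟨X, _, hX, rfl⟩ := h
  rw [nrm_smul, abs_of_nonneg (by positivity)]
  have h1 : nrm (∑ i ∈ Finset.range n, X i) ≤ n := by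
    refine (nrm_sum_le _ _).trans ((Finset.sum_le_sum fun i _ => hX i).trans ?_)
    simp
  rcases Nat.eq_zero_or_pos n with rfl | hn
  · simp
  · have : (0:ℝ) < n := by exact_mod_cast hn
    rw [one_div, inv_mul_le_iff₀ this]; linarith

lemma Avg.coord {n : ℕ} {x : V} (h : Avg n x) (m : ℕ) : |x m| ≤ 1 / n := by
  obtain ⟨X, hs, hX, rfl⟩ := h
  rw [Finsupp.smul_apply, smul_eq_mul, abs_mul, abs_of_nonneg (by positivity),
    Finsupp.finsetSum_apply]
  apply mul_le_of_le_one_right (by positivity)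
  by_cases H : ∃ b ∈ Finset.range n, X b m ≠ 0
  · obtain ⟨b, hb, hbn⟩ := H
    rw [Finset.sum_eq_single_of_mem b hb]
    · exact (coord_le_nrm _ _).trans (hX b)
    · intro c _ hc
      by_contra hcn
      rcases lt_or_gt_of_ne hc with hlt | hlt
      · exact lt_irrefl _ (hs c b hlt m m hcn hbn)
      · exact lt_irrefl _ (hs b c hlt m m hbn hcn)
  · push Not at H
    rw [Finset.sum_eq_zero H]; simp

open Classical in
lemma sum_hit_le (A : Finset ℕ) (X : ℕ → V) (g : F) (hg : InW g) (hX : ∀ i, nrm (X i) ≤ 1) :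
    |ev g (∑ i ∈ A, X i)| ≤ ((A.filter (fun i => hit g (X i))).card : ℝ) := by
  rw [map_sum]
  refine (Finset.abs_sum_le_sum_abs _ _).trans ?_
  rw [Finset.card_filter]
  push_cast
  refine Finset.sum_le_sum fun i _ => ?_
  split_ifs with h
  · exact (ev_le_nrm hg _).trans (hX i)
  · have : ev g (X i) = 0 := by
      by_contra h0; exact h (hit_of_ev h0)
    simp [this]

/-- L2 -/
lemma Avg.wt {n : ℕ} {x : V} (h : Avg n x) {κ w : ℕ} {f : F} (hf : Wt κ w f) (hn : NN κ ≤ n) :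
    |ev f x| ≤ 3 / w := by
  classical
  have hw := hf.pos
  obtain ⟨X, hs, hX, rfl⟩ := h
  obtain ⟨_, _, g, S, hg, hgs, hc, rfl⟩ := hf
  rw [map_smul, ev_smul, smul_eq_mul, abs_mul, abs_mul, ev_sum]
  have h1 : |∑ b ∈ S, ev (g b) (∑ i ∈ Finset.range n, X i)| ≤ 3 * n := by
    refine (Finset.abs_sum_le_sum_abs _ _).trans ?_
    refine (Finset.sum_le_sum fun b _ => sum_hit_le (Finset.range n) X (g b) (hg b) hX).trans ?_
    have h2 := hit_card hs hgs (Finset.range n) S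
    rw [Finset.card_range] at h2
    exact_mod_cast (by omega : _ ≤ 3 * n)
  have hn1 : (0:ℝ) < n := by
    have h8 := NN_ge κ
    have : 0 < 2 ^ κ := by positivity
    exact_mod_cast (by omega : 0 < n)
  push_cast
  rw [abs_of_nonneg (by positivity), abs_of_nonneg (by positivity)]
  calc 1 / (n:ℝ) * (1 / w * |∑ b ∈ S, ev (g b) (∑ i ∈ Finset.range n, X i)|)
      ≤ 1 / (n:ℝ) * (1 / w * (3 * n)) := by gcongr
    _ = 3 / w := by field_simp

noncomputable def SS (y : ℕ → V) (n M d i : ℕ) : V :=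
  (2 / (n:ℝ)) ^ d • ∑ a ∈ Finset.Ico (M + i * n ^ d) (M + (i + 1) * n ^ d), y a

lemma sum_Ico_blocks (y : ℕ → V) (q M k n : ℕ) :
    ∑ a ∈ Finset.Ico (M + k * q) (M + (k + n) * q), y a =
      ∑ i ∈ Finset.range n, ∑ a ∈ Finset.Ico (M + (k + i) * q) (M + (k + i + 1) * q), y a := by
  induction n with
  | zero => simp
  | succ n ih =>
    rw [Finset.sum_range_succ, ← ih, Finset.sum_Ico_consecutive]
    · rfl
    · exact Nat.add_le_add_left (Nat.mul_le_mul_right _ (by omega)) _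
    · exact Nat.add_le_add_left (Nat.mul_le_mul_right _ (by omega)) _

lemma SS_succ (y : ℕ → V) (n M d i : ℕ) :
    SS y n M (d + 1) i = (2 / (n:ℝ)) • ∑ k ∈ Finset.range n, SS y n M d (i * n + k) := by
  unfold SS
  rw [← Finset.smul_sum, smul_smul, ← pow_succ']
  congr 1
  rw [← sum_Ico_blocks y (n ^ d) M (i * n) n]
  congr 2 <;> ring

lemma SS_scc {A : ℕ → ℕ} {y : ℕ → V} (h : Blk A y) (n M d : ℕ) : Scc (SS y n M d) := by
  intro i j hij p q hp hq
  unfold SS at hp hq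
  rw [Finsupp.smul_apply, Finsupp.finsetSum_apply] at hp hq
  obtain ⟨a, ha, hap⟩ := Finset.exists_ne_zero_of_sum_ne_zero (right_ne_zero_of_mul hp)
  obtain ⟨b, hb, hbq⟩ := Finset.exists_ne_zero_of_sum_ne_zero (right_ne_zero_of_mul hq)
  rw [Finset.mem_Ico] at ha hb
  have : (i + 1) * n ^ d ≤ j * n ^ d := Nat.mul_le_mul_right _ hij
  exact h.scc a b (by omega) p q hap hbq

/-- L1 -/
lemma exists_avg {A : ℕ → ℕ} {y : ℕ → V} (hB : Blk A y) (hn : ∀ a, nrm (y a) ≤ 1)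
    (hg : ∀ a, ∃ f, InW f ∧ 1 / 4 ≤ ev f (y a)) (j M : ℕ) :
    ∃ (x : V) (s c : ℕ) (μ : ℝ), M ≤ s ∧ 0 < c ∧ 0 < μ ∧ μ ≤ 1 / NN j ∧ μ * c ≤ Lam j ∧
      x = μ • ∑ a ∈ Finset.Ico s (s + c), y a ∧ 1 / 2 < nrm x ∧ Avg (NN j) x := by
  classical
  set n := NN j with hndef
  have hn8 : 8 ≤ n := by
    have h8 := NN_ge j
    have : 0 < 2 ^ j := by positivity
    omega
  have hn0 : (0:ℝ) < n := by exact_mod_cast (by omega : 0 < n)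
  set D := al (j + 1) + 3 with hD
  have hLam : (2:ℝ) ^ D = 8 * mm (j + 1) := by
    have h1 := Lam_eq j
    have h2 : Lam j = 2 ^ D := by rw [hD, pow_add, two_pow_al, h1]; ring
    exact_mod_cast h2.symm.trans h1
  have hmm : (0:ℝ) < mm (j + 1) := by
    have := ps_ge (j + 1); have := ps_le_mm (j + 1)
    exact_mod_cast (by omega : 0 < mm (j + 1))
  choose g hgW hgy using hg
  have hex : ∃ d, d ≤ D ∧ ∃ i, 1 < nrm (SS y n M d i) := by
    refine ⟨D, le_rfl, 0, ?_⟩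
    have hW : InW ((1 / (mm (j + 1) : ℚ)) • ∑ b ∈ Finset.Ico (M + 0 * n ^ D) (M + (0 + 1) * n ^ D),
        rs (A b) (A (b + 1)) (g b)) := by
      refine ⟨some (j + 1), ?_⟩
      have h1 : ∀ b, InW (rs (A b) (A (b + 1)) (g b)) := fun b => (hgW b).rs _ _
      choose o ho using h1
      refine W.unc (j + 1) _ o _ ho (hB.scc_rs g) ?_
      rw [Nat.card_Ico]
      have := NN_pow_le j
      rw [← hndef, ← hD] at this
      omega
    refine lt_of_lt_of_le ?_ ((le_abs_self _).trans (ev_le_nrm hW _))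
    rw [ev_smul, ev_sum, SS]
    have h2 : ∀ b ∈ Finset.Ico (M + 0 * n ^ D) (M + (0 + 1) * n ^ D),
        (2 / (n:ℝ)) ^ D * (1 / 4) ≤ ev (rs (A b) (A (b + 1)) (g b))
        ((2 / (n:ℝ)) ^ D • ∑ a ∈ Finset.Ico (M + 0 * n ^ D) (M + (0 + 1) * n ^ D), y a) := by
      intro b hb
      rw [map_smul, smul_eq_mul, map_sum, Finset.sum_eq_single_of_mem b hb, hB.ev_self]
      · have := hgy b; gcongr
      · intro a _ hab
        exact hB.ev_ne (g b) hab.symm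
    have h3 := Finset.sum_le_sum h2
    rw [Finset.sum_const, Nat.card_Ico, nsmul_eq_mul] at h3
    have h4 : ((M + (0 + 1) * n ^ D - (M + 0 * n ^ D) : ℕ) : ℝ) * ((2 / (n:ℝ)) ^ D * (1 / 4))
        = 2 * mm (j + 1) := by
      rw [show M + (0 + 1) * n ^ D - (M + 0 * n ^ D) = n ^ D by omega]
      push_cast
      rw [div_pow, hLam]
      field_simp; norm_num
    rw [h4] at h3
    push_cast
    calc (1:ℝ) < 2 := by norm_num
      _ = 1 / (mm (j + 1) : ℝ) * (2 * mm (j + 1)) := by field_simp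
      _ ≤ _ := by gcongr
  obtain ⟨hdD, i, hi⟩ := Nat.find_spec hex
  have hmin := fun m => Nat.find_min hex (m := m)
  generalize Nat.find hex = d at hdD hi hmin
  rcases d with _ | e
  · exfalso
    have : SS y n M 0 i = y (M + i) := by
      unfold SS
      simp [show M + (i + 1) = M + i + 1 by ring]
    rw [this] at hi
    exact absurd (hn _) (not_le.2 hi)
  · have hle : ∀ k, nrm (SS y n M e k) ≤ 1 := by
      intro k
      by_contra hk
      exact hmin e (by omega) ⟨by omega, k, not_le.1 hk⟩
    refine ⟨(1 / 2 : ℝ) • SS y n M (e + 1) i, M + i * n ^ (e + 1), n ^ (e + 1),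
      (1 / 2) * (2 / (n:ℝ)) ^ (e + 1), by omega, by positivity, by positivity, ?_, ?_, ?_, ?_, ?_⟩
    · rw [pow_succ]
      have h1 : (2 / (n:ℝ)) ^ e ≤ 1 := by
        apply pow_le_one₀ (by positivity)
        rw [div_le_one hn0]
        exact_mod_cast (by omega : 2 ≤ n)
      calc 1 / 2 * ((2 / (n:ℝ)) ^ e * (2 / n)) ≤ 1 / 2 * (1 * (2 / n)) := by gcongr
        _ = 1 / n := by ring
    · push_cast
      rw [div_pow]
      have h1 : (1 / 2 : ℝ) * (2 ^ (e + 1) / (n:ℝ) ^ (e + 1)) * (n:ℝ) ^ (e + 1) = 2 ^ e := by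
        field_simp; ring
      rw [h1]
      have h2 : Lam j = 2 ^ D := by rw [Lam_eq, hD, pow_add, two_pow_al]; ring
      rw [h2]; push_cast
      exact pow_le_pow_right₀ (by norm_num) (by omega)
    · unfold SS
      rw [smul_smul]
      congr 3
      ring
    · rw [nrm_smul, abs_of_pos (by norm_num)]; linarith
    · refine ⟨fun k => SS y n M e (i * n + k), ?_, fun k => hle _, ?_⟩
      · intro a b hab
        exact SS_scc hB n M e _ _ (by omega)
      · rw [SS_succ, smul_smul]
        congr 1
        ring

/-! ### Rapidly increasing sequences, good averages, the branch -/

structure Raw (z : ℕ → V) (A : ℕ → ℕ) (y : ℕ → V) (J : ℕ → ℕ) : Prop where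
  blk : Blk A y
  mem : ∀ a, y a ∈ Submodule.span ℝ (Set.range z)
  nle : ∀ a, nrm (y a) ≤ 1
  nrmg : ∀ a, ∃ f, InW f ∧ 1 / 4 ≤ ev f (y a)
  avg : ∀ a, Avg (NN (J a)) (y a)
  mono : StrictMono J
  l1le : ∀ a, ∑ b ∈ Finset.range (a + 1), l1 (y b) ≤ ps (J (a + 1))

lemma Avg.neg {n : ℕ} {x : V} (h : Avg n x) : Avg n (-x) := by
  obtain ⟨X, hs, hX, rfl⟩ := h
  refine ⟨fun i => - X i, ?_, ?_, ?_⟩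
  · intro i j hij p q hp hq
    exact hs i j hij p q (by simpa using hp) (by simpa using hq)
  · intro i
    have := nrm_smul (-1) (X i)
    rw [neg_one_smul] at this
    rw [this]; simpa using hX i
  · rw [Finset.sum_neg_distrib, smul_neg]

lemma raw_step {A : ℕ → ℕ} {z : ℕ → V} (hB : Blk A z) (hn : ∀ a, nrm (z a) ≤ 1)
    (hg : ∀ a, ∃ f, InW f ∧ 1 / 4 ≤ ev f (z a)) (j M : ℕ) :
    ∃ (y : V) (M' : ℕ), M < M' ∧ (∀ n, y n ≠ 0 → M ≤ n ∧ n < M') ∧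
      y ∈ Submodule.span ℝ (Set.range z) ∧ (∃ f, InW f ∧ 1 / 4 ≤ ev f y) ∧ Avg (NN j) y := by
  obtain ⟨x, s, c, μ, hs, hc, _, _, _, hx, hnx, hav⟩ := exists_avg hB hn hg j M
  have hAs : s ≤ A s := hB.1.le_apply
  have hAc : A s < A (s + c) := hB.1 (by omega)
  have hsupp : ∀ n, x n ≠ 0 → M ≤ n ∧ n < A (s + c) := by
    intro n hxn
    rw [hx, Finsupp.smul_apply, Finsupp.finsetSum_apply] at hxn
    obtain ⟨a, ha, han⟩ := Finset.exists_ne_zero_of_sum_ne_zero (right_ne_zero_of_mul hxn)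
    rw [Finset.mem_Ico] at ha
    have h1 := hB.2 a n han
    have h2 : A s ≤ A a := hB.1.monotone ha.1
    have h3 : A (a + 1) ≤ A (s + c) := hB.1.monotone (by omega)
    omega
  have hmem : x ∈ Submodule.span ℝ (Set.range z) := by
    rw [hx]
    exact Submodule.smul_mem _ _ (Submodule.sum_mem _ fun a _ => Submodule.subset_span ⟨a, rfl⟩)
  obtain ⟨f, hf, hfx⟩ := exists_of_lt_nrm (by norm_num) hnx
  rcases le_total 0 (ev f x) with h0 | h0
  · rw [abs_of_nonneg h0] at hfx
    exact ⟨x, A (s + c), by omega, hsupp, hmem, ⟨f, hf, by linarith⟩, hav⟩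
  · rw [abs_of_nonpos h0] at hfx
    refine ⟨-x, A (s + c), by omega, fun n hn => hsupp n (by simpa using hn),
      Submodule.neg_mem _ hmem, ⟨f, hf, ?_⟩, hav.neg⟩
    rw [map_neg]; linarith

lemma exists_raw {A : ℕ → ℕ} {z : ℕ → V} (hB : Blk A z) (hn : ∀ a, nrm (z a) ≤ 1)
    (hg : ∀ a, ∃ f, InW f ∧ 1 / 4 ≤ ev f (z a)) : ∃ A' y J, Raw z A' y J := by
  choose Y E hE hsupp hmem hnorm havg using raw_step hB hn hg
  let st : ℕ → ℕ × ℕ × ℝ := fun a => Nat.rec (0, 0, 0) (fun _ s =>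
    (max (s.1 + 1) ⌈s.2.2 + l1 (Y s.1 s.2.1)⌉₊, E s.1 s.2.1, s.2.2 + l1 (Y s.1 s.2.1))) a
  have hst : ∀ a, st (a + 1) = (max ((st a).1 + 1) ⌈(st a).2.2 + l1 (Y (st a).1 (st a).2.1)⌉₊,
    E (st a).1 (st a).2.1, (st a).2.2 + l1 (Y (st a).1 (st a).2.1)) := fun a => rfl
  have hst0 : (st 0).2.2 = 0 := rfl
  clear_value st
  have hsum : ∀ a, (st a).2.2 = ∑ b ∈ Finset.range a, l1 (Y (st b).1 (st b).2.1) := by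
    intro a
    induction a with
    | zero => simpa using hst0
    | succ a ih => rw [hst, Finset.sum_range_succ, ← ih]
  refine ⟨fun a => (st a).2.1, fun a => Y (st a).1 (st a).2.1, fun a => (st a).1,
    ⟨?_, ?_⟩, fun a => hmem _ _, fun a => (havg _ _).nrm_le, fun a => hnorm _ _,
    fun a => havg _ _, ?_, ?_⟩
  · apply strictMono_nat_of_lt_succ
    intro a
    rw [hst]; exact hE _ _
  · intro a n hn
    have := hsupp _ _ n hn
    simp only [hst]; exact this
  · apply strictMono_nat_of_lt_succ
    intro a
    rw [hst]
    exact lt_of_lt_of_le (Nat.lt_succ_self _) (le_max_left _ _)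
  · intro a
    rw [Finset.sum_range_succ, ← hsum, hst]
    have h1 := Nat.le_ceil ((st a).2.2 + l1 (Y (st a).1 (st a).2.1))
    refine h1.trans ?_
    have h2 := le_ps (max ((st a).1 + 1) ⌈(st a).2.2 + l1 (Y (st a).1 (st a).2.1)⌉₊)
    have h3 := le_max_right ((st a).1 + 1) ⌈(st a).2.2 + l1 (Y (st a).1 (st a).2.1)⌉₊
    exact_mod_cast h3.trans h2

lemma raw_est {z : ℕ → V} {A : ℕ → ℕ} {y : ℕ → V} {J : ℕ → ℕ} (hR : Raw z A y J)
    {κ w : ℕ} {h : F} (hh : Wt κ w h) (s c : ℕ) :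
    ∑ a ∈ Finset.Ico s (s + c), |ev h (y a)| ≤ 3 / w * c + 2 := by
  classical
  have hw := hh.pos
  set P2 := fun a => J (a + 1) ≤ κ
  have hsplit : ∀ a ∈ Finset.Ico s (s + c), |ev h (y a)| ≤
      3 / w + (if P2 a then l1 (y a) / w else 0) +
        (if (J a < κ ∧ κ < J (a + 1)) then |ev h (y a)| else 0) := by
    intro a _
    by_cases h1 : κ ≤ J a
    · have := (hR.avg a).wt hh (NN_mono h1)
      have h2 : 0 ≤ (if P2 a then l1 (y a) / w else 0) := by
        split_ifs
        · exact div_nonneg (l1_nonneg _) hw.le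
        · exact le_rfl
      have h3 : 0 ≤ (if (J a < κ ∧ κ < J (a + 1)) then |ev h (y a)| else 0) := by
        split_ifs
        · exact abs_nonneg _
        · exact le_rfl
      linarith
    · have h3w : 0 ≤ 3 / (w:ℝ) := by positivity
      by_cases h2 : J (a + 1) ≤ κ
      · have h3 := hh.le_l1 (y a)
        have h4 : P2 a := h2
        have h5 : ¬ (J a < κ ∧ κ < J (a + 1)) := by omega
        rw [if_pos h4, if_neg h5]; linarith
      · have h4 : ¬ P2 a := h2
        have h5 : (J a < κ ∧ κ < J (a + 1)) := by omega
        rw [if_neg h4, if_pos h5]; linarith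
  refine (Finset.sum_le_sum hsplit).trans ?_
  rw [Finset.sum_add_distrib, Finset.sum_add_distrib, Finset.sum_const, Nat.card_Ico,
    nsmul_eq_mul]
  have e1 : ∑ a ∈ Finset.Ico s (s + c), (if P2 a then l1 (y a) / w else 0) ≤ 1 := by
    rw [← Finset.sum_filter, ← Finset.sum_div]
    rw [div_le_one hw]
    rcases ((Finset.Ico s (s + c)).filter P2).eq_empty_or_nonempty with he | hne
    · rw [he]; simp [hw.le]
    · set m := ((Finset.Ico s (s + c)).filter P2).max' hne with hm
      have hmem := Finset.max'_mem _ hne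
      rw [← hm, Finset.mem_filter] at hmem
      have h1 : ∑ a ∈ (Finset.Ico s (s + c)).filter P2, l1 (y a)
          ≤ ∑ a ∈ Finset.range (m + 1), l1 (y a) := by
        apply Finset.sum_le_sum_of_subset_of_nonneg
        · intro a ha
          have := Finset.le_max' _ a ha
          rw [Finset.mem_range]; omega
        · intro a _ _; exact l1_nonneg _
      refine h1.trans ((hR.l1le m).trans ?_)
      exact_mod_cast (ps_mono hmem.2).trans hh.1
  have e2 : ∑ a ∈ Finset.Ico s (s + c), (if (J a < κ ∧ κ < J (a + 1)) then |ev h (y a)| else 0)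
      ≤ 1 := by
    rw [← Finset.sum_filter]
    by_cases H : ∃ a ∈ Finset.Ico s (s + c), (J a < κ ∧ κ < J (a + 1))
    · obtain ⟨a, ha, hb⟩ := H
      have : (Finset.Ico s (s + c)).filter (fun a => J a < κ ∧ κ < J (a + 1)) ⊆ {a} := by
        intro a' ha'
        rw [Finset.mem_filter] at ha'
        rw [Finset.mem_singleton]
        by_contra hne
        rcases lt_or_gt_of_ne hne with h | h
        · have : J (a' + 1) ≤ J a := hR.mono.monotone h
          omega
        · have : J (a + 1) ≤ J a' := hR.mono.monotone h
          omega
      refine (Finset.sum_le_sum_of_subset_of_nonneg this (fun _ _ _ => abs_nonneg _)).trans ?_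
      rw [Finset.sum_singleton]
      exact (ev_le_nrm hh.2.1 _).trans (hR.nle a)
    · rw [Finset.filter_false_of_mem]
      · simp
      · intro a ha hb; exact H ⟨a, ha, hb⟩
  have h5 : ((s + c - s : ℕ) : ℝ) = c := by congr 1; omega
  rw [h5]
  linarith

structure Good (z : ℕ → V) (k M M' : ℕ) (t : V) (φ : F) (κ : ℕ) : Prop where
  lt : M < M'
  supp_t : ∀ n, t n ≠ 0 → M ≤ n ∧ n < M'
  supp_f : ∀ n, φ n ≠ 0 → M ≤ n ∧ n < M'
  mem : t ∈ Submodule.span ℝ (Set.range z)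
  nle : nrm t ≤ 2
  inW : W (some κ) φ
  ix : pp k ≤ κ ∧ κ < pp (k + 1)
  one : ev φ t = 1
  e1 : ∀ κ' w h, Wt κ' w h → κ' < pp k → |ev h t| ≤ 6 / w
  e2 : ∀ κ' w h, Wt κ' w h → |ev h t| ≤ 6 * Lam (pp k) / w + 4 / NN (pp k)

lemma exists_good {z : ℕ → V} {A : ℕ → ℕ} {y : ℕ → V} {J : ℕ → ℕ} (hR : Raw z A y J)
    (k M : ℕ) : ∃ M' t φ κ, Good z k M M' t φ κ := by
  obtain ⟨x, s, c, μ, hs, hc, hμ, hμn, hμc, hx, hnx, hav⟩ :=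
    exists_avg hR.blk hR.nle hR.nrmg (pp k) M
  have hB := hR.blk
  have hAs : s ≤ A s := hB.1.le_apply
  have hAc : A s < A (s + c) := hB.1 (by omega)
  have hsupp : ∀ n, x n ≠ 0 → M ≤ n ∧ n < A (s + c) := by
    intro n hxn
    rw [hx, Finsupp.smul_apply, Finsupp.finsetSum_apply] at hxn
    obtain ⟨a, ha, han⟩ := Finset.exists_ne_zero_of_sum_ne_zero (right_ne_zero_of_mul hxn)
    rw [Finset.mem_Ico] at ha
    have h1 := hB.2 a n han
    have h2 : A s ≤ A a := hB.1.monotone ha.1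
    have h3 : A (a + 1) ≤ A (s + c) := hB.1.monotone (by omega)
    omega
  have hmem : x ∈ Submodule.span ℝ (Set.range z) := by
    rw [hx]
    exact Submodule.smul_mem _ _ (Submodule.sum_mem _ fun a _ => hR.mem a)
  have hn8 : 8 ≤ NN (pp k) := by
    have h8 := NN_pp' k
    have : 0 < 2 ^ k := by positivity
    omega
  have hnR : (8:ℝ) ≤ NN (pp k) := by exact_mod_cast hn8
  have E1 : ∀ κ' w h, Wt κ' w h → κ' < pp k → |ev h x| ≤ 3 / w := fun κ' w h hh hk =>
    hav.wt hh (NN_mono hk.le)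
  have E2 : ∀ κ' w h, Wt κ' w h → |ev h x| ≤ 3 * Lam (pp k) / w + 2 / NN (pp k) := by
    intro κ' w h hh
    have hw := hh.pos
    rw [hx, map_smul, smul_eq_mul, abs_mul, abs_of_pos hμ, map_sum]
    have h1 := (Finset.abs_sum_le_sum_abs (fun a => ev h (y a)) (Finset.Ico s (s + c))).trans
      (raw_est hR hh s c)
    calc μ * |∑ a ∈ Finset.Ico s (s + c), ev h (y a)| ≤ μ * (3 / w * c + 2) := by gcongr
      _ = 3 / w * (μ * c) + 2 * μ := by ring
      _ ≤ 3 / w * Lam (pp k) + 2 * (1 / NN (pp k)) := by gcongr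
      _ = _ := by ring
  obtain ⟨φ0, ⟨o, ho⟩, hφ⟩ := exists_of_lt_nrm (by norm_num) hnx
  have hix : ∃ κ, o = some κ ∧ pp k ≤ κ ∧ κ < pp (k + 1) := by
    rcases o with _ | κ
    · exfalso
      rcases W_none ho with rfl | ⟨n, rfl⟩
      · rw [ev_zero] at hφ; norm_num at hφ
      · rw [ev_basis] at hφ
        have h1 := hav.coord n
        have h2 : 1 / (NN (pp k) : ℝ) ≤ 1 / 8 := by gcongr
        linarith
    · refine ⟨κ, rfl, ?_⟩
      obtain ⟨w, hw⟩ := W_exists_wt ho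
      have hw0 := hw.pos
      constructor
      · by_contra hk
        have h1 := E1 κ w φ0 hw (by omega)
        have h2 : (4096:ℝ) ≤ w := by
          have := hw.1; have := ps_ge κ
          exact_mod_cast (by omega : 4096 ≤ w)
        have h3 : 3 / (w:ℝ) ≤ 3 / 4096 := by gcongr
        linarith
      · by_contra hk
        have h1 := E2 κ w φ0 hw
        have h2 : 6 * Lam (pp k) * 2 ^ (k + 1 + k) ≤ w :=
          (Lam_pp k (k + 1) (by omega)).trans ((ps_mono (by omega)).trans hw.1)
        have h3 : 12 * Lam (pp k) ≤ w := by
          refine le_trans ?_ h2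
          have : 2 ≤ 2 ^ (k + 1 + k) := by
            calc 2 = 2 ^ 1 := by norm_num
              _ ≤ _ := Nat.pow_le_pow_right (by norm_num) (by omega)
          calc 12 * Lam (pp k) = 6 * Lam (pp k) * 2 := by ring
            _ ≤ _ := Nat.mul_le_mul_left _ this
        have h3' : 12 * (Lam (pp k) : ℝ) ≤ w := by exact_mod_cast h3
        have h4 : 3 * (Lam (pp k) : ℝ) / w ≤ 1 / 4 := by
          rw [div_le_iff₀ hw0]; linarith
        have h5 : 2 / (NN (pp k) : ℝ) ≤ 2 / 8 := by gcongr
        linarith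
  obtain ⟨κ, rfl, hκ⟩ := hix
  have hne : ev φ0 x ≠ 0 := by
    intro h0; rw [h0] at hφ; norm_num at hφ
  have hinv : |(ev φ0 x)⁻¹| ≤ 2 := by
    rw [abs_inv]
    rw [inv_le_comm₀ (by linarith) (by norm_num)]
    linarith
  refine ⟨A (s + c), (ev φ0 x)⁻¹ • x, rs M (A (s + c)) φ0, κ, by omega, ?_, ?_,
    Submodule.smul_mem _ _ hmem, ?_, ho.rs _ _, hκ, ?_, ?_, ?_⟩
  · intro n hn
    rw [Finsupp.smul_apply] at hn
    exact hsupp n (right_ne_zero_of_mul hn)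
  · intro n hn
    rw [rs_apply] at hn
    by_contra h; rw [if_neg h] at hn; exact hn rfl
  · rw [nrm_smul]
    have := hav.nrm_le
    have h0 := nrm_nonneg x
    nlinarith
  · rw [ev_rs, rs_self, map_smul, smul_eq_mul, inv_mul_cancel₀ hne]
    intro n hn
    rw [Finsupp.smul_apply] at hn
    exact hsupp n (right_ne_zero_of_mul hn)
  · intro κ' w h hh hk
    rw [map_smul, smul_eq_mul, abs_mul]
    have := E1 κ' w h hh hk
    calc |(ev φ0 x)⁻¹| * |ev h x| ≤ 2 * (3 / w) := by gcongr
      _ = _ := by ring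
  · intro κ' w h hh
    rw [map_smul, smul_eq_mul, abs_mul]
    have := E2 κ' w h hh
    calc |(ev φ0 x)⁻¹| * |ev h x| ≤ 2 * (3 * Lam (pp k) / w + 2 / NN (pp k)) := by gcongr
      _ = _ := by ring

structure Branch (z : ℕ → V) (A : ℕ → ℕ) (t : ℕ → V) (f : ℕ → F) (ix : ℕ → ℕ) : Prop where
  good : ∀ i, Good z (cl f i) (A i) (A (i + 1)) (t i) (f i) (ix i)

lemma exists_branch {z : ℕ → V} {A : ℕ → ℕ} {y : ℕ → V} {J : ℕ → ℕ} (hR : Raw z A y J) :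
    ∃ A' t f ix, Branch z A' t f ix := by
  choose E Tt Ph K hG using exists_good hR
  let st : ℕ → List F × ℕ := fun a => Nat.rec ([], 0) (fun _ s =>
    (Ph (sg s.1) s.2 :: s.1, E (sg s.1) s.2)) a
  have hst : ∀ a, st (a + 1) = (Ph (sg (st a).1) (st a).2 :: (st a).1, E (sg (st a).1) (st a).2) :=
    fun a => rfl
  have hst0 : st 0 = ([], 0) := rfl
  clear_value st
  have hh : ∀ i, hist (fun i => Ph (sg (st i).1) (st i).2) i = (st i).1 := by
    intro i
    induction i with
    | zero => rw [hst0]; rfl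
    | succ i ih => rw [hst]; simp only [hist]; rw [ih]
  refine ⟨fun i => (st i).2, fun i => Tt (sg (st i).1) (st i).2, fun i => Ph (sg (st i).1) (st i).2,
    fun i => K (sg (st i).1) (st i).2, ⟨fun i => ?_⟩⟩
  unfold cl
  rw [hh]
  have := hG (sg (st i).1) (st i).2
  simp only [hst]
  exact this

/-! ### The upper estimate -/

lemma sum_half_le (B : Finset ℕ) : ∑ s ∈ B, ((1:ℝ) / 2) ^ s ≤ 2 := by
  have h := summable_geometric_two.sum_le_tsum B (fun i _ => by positivity)
  rwa [tsum_geometric_two] at h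

lemma half_anti {m n : ℕ} (h : m ≤ n) : ((1:ℝ) / 2) ^ n ≤ (1 / 2) ^ m :=
  pow_le_pow_of_le_one (by norm_num) (by norm_num) h

section branch

variable {z : ℕ → V} {A : ℕ → ℕ} {t : ℕ → V} {f : ℕ → F} {ix : ℕ → ℕ}

lemma Branch.mono (hb : Branch z A t f ix) : StrictMono A :=
  strictMono_nat_of_lt_succ fun i => (hb.good i).lt

lemma Branch.blk (hb : Branch z A t f ix) : Blk A t := ⟨hb.mono, fun i => (hb.good i).supp_t⟩

lemma Branch.ev_le (hb : Branch z A t f ix) {g : F} (hg : InW g) (i : ℕ) : |ev g (t i)| ≤ 2 :=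
  (ev_le_nrm hg _).trans (hb.good i).nle

lemma Branch.high (hb : Branch z A t f ix) {κ w : ℕ} {h : F} (hh : Wt κ w h) {i c : ℕ}
    (hc : κ < pp (c + 1)) (hi : c < cl f i) : |ev h (t i)| ≤ 6 / w := by
  refine (hb.good i).e1 κ w h hh (hc.trans_le ?_)
  exact pp_strictMono.monotone hi

lemma NN_pos (j : ℕ) : (0:ℝ) < NN j := by
  have h8 := NN_ge j
  have : 0 < 2 ^ j := by positivity
  exact_mod_cast (by omega : 0 < NN j)

lemma mm_pos (j : ℕ) : (4096:ℝ) ≤ mm j := by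
  have := ps_ge j; have := ps_le_mm j
  exact_mod_cast (by omega : 4096 ≤ mm j)

lemma Branch.mid (hb : Branch z A t f ix) {κ w : ℕ} {h : F} (hh : Wt κ w h) {i q : ℕ}
    (hq : pp q ≤ κ) (hi : cl f i < q) :
    |ev h (t i)| ≤ (1 / 2) ^ q * (1 / 2) ^ (cl f i) + 4 / NN (pp (cl f i)) := by
  have hw := hh.pos
  refine ((hb.good i).e2 κ w h hh).trans ?_
  gcongr
  have h1 : 6 * Lam (pp (cl f i)) * 2 ^ (q + cl f i) ≤ w :=
    (Lam_pp _ _ hi).trans ((ps_mono hq).trans hh.1)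
  have h2 : 6 * (Lam (pp (cl f i)) : ℝ) * 2 ^ (q + cl f i) ≤ w := by exact_mod_cast h1
  rw [← pow_add, div_le_iff₀ hw, one_div, inv_pow, ← div_eq_inv_mul, le_div_iff₀ (by positivity)]
  exact h2

lemma Branch.low (hb : Branch z A t f ix) {κ w : ℕ} {h : F} (hh : Wt κ w h) {i q : ℕ}
    (hq : pp q ≤ κ) (hi : cl f i < q) : |ev h (t i)| ≤ (1 / 2) ^ i := by
  refine (hb.mid hh hq hi).trans ?_
  have h1 : ((1:ℝ) / 2) ^ q ≤ 1 / 2 := by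
    have := half_anti (show 1 ≤ q by omega)
    simpa using this
  have h2 : 4 / (NN (pp (cl f i)) : ℝ) ≤ 1 / 2 * (1 / 2) ^ (cl f i) := by
    have h3 := NN_pp' (cl f i)
    have h4 : 8 * (2:ℝ) ^ (cl f i) ≤ NN (pp (cl f i)) := by exact_mod_cast h3
    rw [div_le_iff₀ (NN_pos _)]
    rw [one_div, inv_pow]
    have : (0:ℝ) < 2 ^ (cl f i) := by positivity
    calc (4:ℝ) = 2⁻¹ * (2 ^ cl f i)⁻¹ * (8 * 2 ^ cl f i) := by field_simp; norm_num
      _ ≤ _ := by gcongr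
  have h3 : ((1:ℝ) / 2) ^ (cl f i) ≤ (1 / 2) ^ i := half_anti (le_cl f i)
  have h4 : (0:ℝ) ≤ (1 / 2) ^ (cl f i) := by positivity
  nlinarith

noncomputable def dd (t : ℕ → V) (s : ℕ) : V := t (2 * s) - t (2 * s + 1)

lemma dd_ne {t : ℕ → V} {s n : ℕ} (h : dd t s n ≠ 0) : t (2 * s) n ≠ 0 ∨ t (2 * s + 1) n ≠ 0 := by
  by_contra H
  push Not at H
  apply h
  simp [dd, H.1, H.2]

lemma Branch.dd_scc (hb : Branch z A t f ix) : Scc (dd t) := by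
  intro i j hij m n hm hn
  have hs := hb.blk.scc
  rcases dd_ne hm with h1 | h1 <;> rcases dd_ne hn with h2 | h2
  · exact hs _ _ (by omega) m n h1 h2
  · exact hs _ _ (by omega) m n h1 h2
  · exact hs _ _ (by omega) m n h1 h2
  · exact hs _ _ (by omega) m n h1 h2

lemma ev_dd_le (g : F) (t : ℕ → V) (s : ℕ) :
    |ev g (dd t s)| ≤ |ev g (t (2 * s))| + |ev g (t (2 * s + 1))| := by
  rw [dd, map_sub]; exact abs_sub _ _

lemma Branch.dd_le (hb : Branch z A t f ix) {g : F} (hg : InW g) (s : ℕ) : |ev g (dd t s)| ≤ 4 := by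
  have := ev_dd_le g t s
  have := hb.ev_le hg (2 * s)
  have := hb.ev_le hg (2 * s + 1)
  linarith

lemma Branch.dd_low (hb : Branch z A t f ix) {κ w : ℕ} {h : F} (hh : Wt κ w h) {s q : ℕ}
    (hq : pp q ≤ κ) (hi : cl f (2 * s + 1) < q) : |ev h (dd t s)| ≤ 2 * (1 / 2) ^ s := by
  have h1 := ev_dd_le h t s
  have h2 := hb.low hh hq hi
  have h3 := hb.low hh hq ((cl_strictMono f (by omega : 2 * s < 2 * s + 1)).trans hi)
  have h4 : ((1:ℝ) / 2) ^ (2 * s) ≤ (1 / 2) ^ s := half_anti (by omega)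
  have h5 : ((1:ℝ) / 2) ^ (2 * s + 1) ≤ (1 / 2) ^ s := half_anti (by omega)
  linarith

lemma window_card (f : ℕ → F) (c : ℕ) (B : Finset ℕ) :
    (B.filter (fun s => cl f (2 * s) ≤ c ∧ c ≤ cl f (2 * s + 1))).card ≤ 1 := by
  rw [Finset.card_le_one]
  intro s hs s' hs'
  rw [Finset.mem_filter] at hs hs'
  by_contra hne
  rcases lt_or_gt_of_ne hne with h | h
  · have := cl_strictMono f (by omega : 2 * s + 1 < 2 * s'); omega
  · have := cl_strictMono f (by omega : 2 * s' + 1 < 2 * s); omega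

lemma cut_card (hb : Branch z A t f ix) (a : ℕ) (B : Finset ℕ) :
    (B.filter (fun s => A (2 * s) < a ∧ a < A (2 * s + 2))).card ≤ 1 := by
  rw [Finset.card_le_one]
  intro s hs s' hs'
  rw [Finset.mem_filter] at hs hs'
  by_contra hne
  rcases lt_or_gt_of_ne hne with h | h
  · have := hb.mono.monotone (by omega : 2 * s + 2 ≤ 2 * s'); omega
  · have := hb.mono.monotone (by omega : 2 * s' + 2 ≤ 2 * s); omega

/-- unconditional functionals of large index -/
lemma Branch.unc_est (hb : Branch z A t f ix) {κ J : ℕ} (hκ : J ≤ κ) {g : F}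
    (hg : Wt κ (mm κ) g) (B : Finset ℕ) :
    |ev g (∑ s ∈ B, dd t s)| ≤ 8 + 12 * B.card / mm J := by
  classical
  obtain ⟨c, hc1, hc2⟩ := exists_class κ
  have hJ := mm_pos J
  have hp : ∀ s ∈ B, |ev g (dd t s)| ≤ 2 * (1 / 2) ^ s +
      (if cl f (2 * s) ≤ c ∧ c ≤ cl f (2 * s + 1) then 4 else 0) + 12 / mm J := by
    intro s _
    have hpos : (0:ℝ) ≤ 2 * (1 / 2) ^ s := by positivity
    have hpos2 : (0:ℝ) ≤ 12 / mm J := by positivity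
    by_cases h1 : cl f (2 * s) ≤ c ∧ c ≤ cl f (2 * s + 1)
    · rw [if_pos h1]
      have := hb.dd_le hg.2.1 s
      linarith
    · rw [if_neg h1]
      by_cases h2 : c < cl f (2 * s)
      · have h3 := hb.high hg hc2 h2
        have h4 := hb.high hg hc2 (h2.trans (cl_strictMono f (by omega : 2 * s < 2 * s + 1)))
        have h5 := ev_dd_le g t s
        have h6 : 6 / (mm κ : ℝ) ≤ 6 / mm J := by
          have : (mm J : ℝ) ≤ mm κ := by exact_mod_cast mm_mono hκ
          gcongr
        have h7 : 12 / (mm J : ℝ) = 6 / mm J + 6 / mm J := by ring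
        linarith
      · have := hb.dd_low hg hc1 (show cl f (2 * s + 1) < c by
          by_contra h3; exact h1 ⟨by omega, by omega⟩)
        linarith
  rw [map_sum]
  refine (Finset.abs_sum_le_sum_abs _ _).trans ((Finset.sum_le_sum hp).trans ?_)
  rw [Finset.sum_add_distrib, Finset.sum_add_distrib, ← Finset.mul_sum, Finset.sum_const,
    nsmul_eq_mul, ← Finset.sum_filter, Finset.sum_const, nsmul_eq_mul]
  have h1 := sum_half_le B
  have h2 : ((B.filter (fun s => cl f (2 * s) ≤ c ∧ c ≤ cl f (2 * s + 1))).card : ℝ) ≤ 1 := by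
    exact_mod_cast window_card f c B
  have h3 : (B.card : ℝ) * (12 / mm J) = 12 * B.card / mm J := by ring
  linarith

lemma Branch.ev_f_ne (hb : Branch z A t f ix) (a b : ℕ) {i j : ℕ} (h : i ≠ j) :
    ev (rs a b (f i)) (t j) = 0 := by
  by_contra h0
  obtain ⟨n, h1, h2⟩ := hit_of_ev h0
  have h3 : f i n ≠ 0 := by
    intro h4; rw [rs_apply, h4] at h1; simp at h1
  have h4 := (hb.good i).supp_f n h3
  have h5 := (hb.good j).supp_t n h2
  rcases lt_or_gt_of_ne h with h6 | h6
  · have := hb.mono.monotone (by omega : i + 1 ≤ j); omega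
  · have := hb.mono.monotone (by omega : j + 1 ≤ i); omega

lemma Branch.cancel (hb : Branch z A t f ix) {a b s : ℕ}
    (ha : ¬ (A (2 * s) < a ∧ a < A (2 * s + 2))) (hbb : ¬ (A (2 * s) < b ∧ b < A (2 * s + 2))) :
    ev (rs a b (f (2 * s))) (t (2 * s)) = ev (rs a b (f (2 * s + 1))) (t (2 * s + 1)) := by
  have g1 := hb.good (2 * s)
  have g2 := hb.good (2 * s + 1)
  have l1 := g1.lt
  have l2 := g2.lt
  rw [show 2 * s + 1 + 1 = 2 * s + 2 by ring] at l2 g2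
  rw [ev_rs, ev_rs]
  by_cases h : a ≤ A (2 * s) ∧ A (2 * s + 2) ≤ b
  · rw [rs_self, rs_self, g1.one, g2.one]
    · intro n hn; have := g2.supp_t n hn; omega
    · intro n hn; have := g1.supp_t n hn; omega
  · rw [rs_disj, rs_disj, map_zero, map_zero]
    · intro n hn; have := g2.supp_t n hn; omega
    · intro n hn; have := g1.supp_t n hn; omega

lemma Branch.ev_even (hb : Branch z A t f ix) (a b s : ℕ) (B : Finset ℕ) :
    ev (rs a b (f (2 * s))) (∑ s ∈ B, dd t s) =
      if s ∈ B then ev (rs a b (f (2 * s))) (t (2 * s)) else 0 := by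
  rw [map_sum, ← Finset.sum_ite_eq B s (fun _ => ev (rs a b (f (2 * s))) (t (2 * s)))]
  refine Finset.sum_congr rfl fun r _ => ?_
  rw [dd, map_sub, hb.ev_f_ne a b (by omega : 2 * s ≠ 2 * r + 1), sub_zero]
  split_ifs with h
  · rw [h]
  · exact hb.ev_f_ne a b (by omega)

lemma Branch.ev_odd (hb : Branch z A t f ix) (a b s : ℕ) (B : Finset ℕ) :
    ev (rs a b (f (2 * s + 1))) (∑ s ∈ B, dd t s) =
      if s ∈ B then - ev (rs a b (f (2 * s + 1))) (t (2 * s + 1)) else 0 := by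
  rw [map_sum, ← Finset.sum_ite_eq B s (fun _ => - ev (rs a b (f (2 * s + 1))) (t (2 * s + 1)))]
  refine Finset.sum_congr rfl fun r _ => ?_
  rw [dd, map_sub, hb.ev_f_ne a b (by omega : 2 * s + 1 ≠ 2 * r), zero_sub]
  split_ifs with h
  · rw [h]
  · rw [hb.ev_f_ne a b (by omega), neg_zero]

/-- large terms of a special functional -/
lemma Branch.large (hb : Branch z A t f ix) {κ' q J : ℕ} {h : F} (hh : W (some κ') h)
    (hq : pp q ≤ κ' ∧ κ' < pp (q + 1)) (hJ : mm J * 2 ^ q ≤ ps (pp q)) {i j : ℕ} (hi : i ≤ q)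
    (hj : q ≠ cl f j) :
    |ev h (t j)| ≤ 6 / mm J * (1 / 2) ^ i + (1 / 2) ^ i * (1 / 2) ^ j + 4 / NN (pp (cl f j)) := by
  obtain ⟨w, hw⟩ := W_exists_wt hh
  have hw0 := hw.pos
  have hm := mm_pos J
  have hp := NN_pos (pp (cl f j))
  have hiq := half_anti hi
  have hjk := half_anti (le_cl f j)
  rcases lt_or_gt_of_ne hj with h1 | h1
  · have h2 := hb.high hw hq.2 h1
    have h3 : mm J * 2 ^ q ≤ w := hJ.trans ((ps_mono hq.1).trans hw.1)
    have h3' : (mm J : ℝ) * 2 ^ q ≤ w := by exact_mod_cast h3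
    have h4 : 6 / (w:ℝ) ≤ 6 / mm J * (1 / 2) ^ q := by
      rw [one_div, inv_pow, ← div_eq_mul_inv, div_div]
      gcongr
    have h5 : 6 / (mm J : ℝ) * (1 / 2) ^ q ≤ 6 / mm J * (1 / 2) ^ i := by gcongr
    have h6 : (0:ℝ) ≤ (1 / 2) ^ i * (1 / 2) ^ j + 4 / NN (pp (cl f j)) := by positivity
    linarith
  · have h2 := hb.mid hw hq.1 h1
    have h3 : ((1:ℝ) / 2) ^ q * (1 / 2) ^ (cl f j) ≤ (1 / 2) ^ i * (1 / 2) ^ j := by gcongr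
    have h6 : (0:ℝ) ≤ 6 / mm J * (1 / 2) ^ i := by positivity
    linarith

/-- the main part of a special functional -/
lemma Branch.spec_main (hb : Branch z A t f ix) {κ J c : ℕ} (hc : κ < pp (c + 1))
    {h : ℕ → F} {ixh : ℕ → ℕ} {S : Finset ℕ} {a b : ℕ} (hh : ∀ i, W (some (ixh i)) (h i))
    (hix : ∀ i, pp (cl h i) ≤ ixh i ∧ ixh i < pp (cl h i + 1)) (hS : S.card ≤ NN κ)
    {i0 : ℕ} (hi0 : ∀ i < i0, h i = f i)
    (hi1 : ∀ i, i0 ≤ i → i ∈ pairs S → ∀ j, j ≠ i0 → cl h i ≠ cl f j)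
    (B : Finset ℕ) (hB1 : ∀ s ∈ B, s ≠ i0 / 2) (hB2 : ∀ s ∈ B, c < cl f (2 * s))
    (hB3 : ∀ s ∈ B, ¬ (A (2 * s) < a ∧ a < A (2 * s + 2)))
    (hB4 : ∀ s ∈ B, ¬ (A (2 * s) < b ∧ b < A (2 * s + 2)))
    (X : ℝ) (hX : ∀ g, InW g → |ev g (∑ s ∈ B, dd t s)| ≤ X) :
    |∑ s ∈ S, ev (rs a b (h (2 * s) + h (2 * s + 1))) (∑ s ∈ B, dd t s)| ≤
      al J * X + 24 * B.card / mm J + 6 := by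
  classical
  set D := ∑ s ∈ B, dd t s with hD
  have hX0 : 0 ≤ X := le_trans (abs_nonneg _) (hX 0 ⟨_, W.zero⟩)
  have hm := mm_pos J
  have s1 : |∑ s ∈ S, ev (rs a b (h (2 * s) + h (2 * s + 1))) D| ≤
      ∑ i ∈ pairs S, (if i0 ≤ i then |ev (rs a b (h i)) D| else 0) := by
    rw [sum_pairs]
    refine (Finset.abs_sum_le_sum_abs _ _).trans (Finset.sum_le_sum fun s hs => ?_)
    rw [rs_add, ev_add]
    by_cases c1 : 2 * s + 1 < i0
    · rw [if_neg (by omega), if_neg (by omega), hi0 _ c1, hi0 (2 * s) (by omega),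
        hb.ev_even, hb.ev_odd]
      by_cases hsB : s ∈ B
      · rw [if_pos hsB, if_pos hsB, hb.cancel (hB3 s hsB) (hB4 s hsB)]; simp
      · rw [if_neg hsB, if_neg hsB]; simp
    · by_cases c2 : 2 * s < i0
      · have hsB : s ∉ B := by
          intro hsB
          exact hB1 s hsB (by omega)
        rw [if_neg (by omega), if_pos (by omega), hi0 (2 * s) c2, hb.ev_even, if_neg hsB,
          zero_add, zero_add]
      · rw [if_pos (by omega), if_pos (by omega)]
        exact abs_add_le _ _
  refine s1.trans ?_
  have s2 : ∀ i ∈ pairs S, (if i0 ≤ i then |ev (rs a b (h i)) D| else 0) ≤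
      (if i < al J then X else 0) + ∑ j ∈ pairs B, ((6 / mm J * (1 / 2) ^ i +
        (1 / 2) ^ i * (1 / 2) ^ j + 4 / NN (pp (cl f j))) : ℝ) := by
    intro i hi
    have hpos : (0:ℝ) ≤ ∑ j ∈ pairs B, ((6 / mm J * (1 / 2) ^ i +
        (1 / 2) ^ i * (1 / 2) ^ j + 4 / NN (pp (cl f j))) : ℝ) := by positivity
    have hpos2 : 0 ≤ (if i < al J then X else 0) := by
      split_ifs
      · exact hX0
      · exact le_rfl
    split_ifs with h1 h2 h2
    · have := hX (rs a b (h i)) ⟨_, (hh i).rs a b⟩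
      linarith
    · rw [zero_add]
      have hbig : mm J * 2 ^ (cl h i) ≤ ps (pp (cl h i)) := by
        by_contra hcon
        have h3 := small_class (cl h i) J (by omega)
        have h4 := le_cl h i
        omega
      rw [hD, map_sum]
      refine (Finset.abs_sum_le_sum_abs _ _).trans ?_
      rw [sum_pairs]
      refine Finset.sum_le_sum fun s hs => ?_
      refine (ev_dd_le _ t s).trans ?_
      have hs0 := hB1 s hs
      exact add_le_add
        (hb.large ((hh i).rs a b) (hix i) hbig (le_cl h i) (hi1 i h1 hi _ (by omega)))
        (hb.large ((hh i).rs a b) (hix i) hbig (le_cl h i) (hi1 i h1 hi _ (by omega)))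
    · linarith
    · linarith
  refine (Finset.sum_le_sum s2).trans ?_
  rw [Finset.sum_add_distrib]
  have s3 : ∑ i ∈ pairs S, (if i < al J then X else 0) ≤ al J * X := by
    rw [← Finset.sum_filter, Finset.sum_const, nsmul_eq_mul]
    gcongr
    have : (pairs S).filter (fun i => i < al J) ⊆ Finset.range (al J) := by
      intro i hi; rw [Finset.mem_filter] at hi; exact Finset.mem_range.2 hi.2
    simpa using Finset.card_le_card this
  have s4 : ∑ i ∈ pairs S, ∑ j ∈ pairs B, ((6 / mm J * (1 / 2) ^ i +
        (1 / 2) ^ i * (1 / 2) ^ j + 4 / NN (pp (cl f j))) : ℝ) ≤ 24 * B.card / mm J + 6 := by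
    simp only [Finset.sum_add_distrib, Finset.sum_const, nsmul_eq_mul, ← Finset.mul_sum,
      ← Finset.sum_mul]
    have g1 := sum_half_le (pairs S)
    have g2 := sum_half_le (pairs B)
    have g1' : (0:ℝ) ≤ ∑ s ∈ pairs S, (1 / 2) ^ s := by positivity
    have g2' : (0:ℝ) ≤ ∑ s ∈ pairs B, (1 / 2) ^ s := by positivity
    have g3 : ((pairs B).card : ℝ) ≤ 2 * B.card := by exact_mod_cast pairs_card B
    have g4 : ((pairs S).card : ℝ) ≤ 2 * NN κ := by
      have := pairs_card S
      exact_mod_cast (by omega : (pairs S).card ≤ 2 * NN κ)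
    have g5 : ((pairs S).card : ℝ) * ∑ j ∈ pairs B, 4 / (NN (pp (cl f j)) : ℝ) ≤ 2 := by
      calc ((pairs S).card : ℝ) * ∑ j ∈ pairs B, 4 / (NN (pp (cl f j)) : ℝ)
          ≤ (2 * NN κ) * ∑ j ∈ pairs B, 4 / (NN (pp (cl f j)) : ℝ) := by gcongr
        _ = ∑ j ∈ pairs B, (2 * NN κ) * (4 / (NN (pp (cl f j)) : ℝ)) := by rw [Finset.mul_sum]
        _ ≤ ∑ j ∈ pairs B, ((1:ℝ) / 2) ^ j := by
            refine Finset.sum_le_sum fun j hj => ?_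
            rw [mem_pairs] at hj
            have k1 := hB2 _ hj
            have k2 : c < cl f j := by
              refine k1.trans_le ((cl_strictMono f).monotone (by omega))
            have k3 : κ < pp (cl f j) := hc.trans_le (pp_strictMono.monotone k2)
            have k4 := NN_pp _ _ k3
            have k5 : 8 * (NN κ : ℝ) * 2 ^ (cl f j) ≤ NN (pp (cl f j)) := by exact_mod_cast k4
            refine le_trans ?_ (half_anti (le_cl f j))
            have k6 := NN_pos (pp (cl f j))
            rw [← mul_div_assoc, div_le_iff₀ k6, one_div, inv_pow, ← div_eq_inv_mul,
              le_div_iff₀ (by positivity)]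
            linarith
        _ ≤ 2 := g2
    have g6 : ((pairs B).card : ℝ) * (6 / mm J * ∑ s ∈ pairs S, (1 / 2) ^ s) ≤
        24 * B.card / mm J := by
      calc ((pairs B).card : ℝ) * (6 / mm J * ∑ s ∈ pairs S, (1 / 2) ^ s)
          ≤ (2 * B.card) * (6 / mm J * 2) := by gcongr
        _ = _ := by ring
    have g7 : (∑ s ∈ pairs S, ((1:ℝ) / 2) ^ s) * ∑ s ∈ pairs B, ((1:ℝ) / 2) ^ s ≤ 4 := by nlinarith
    linarith
  linarith

end branch

section branch2

variable {z : ℕ → V} {A : ℕ → ℕ} {t : ℕ → V} {f : ℕ → F} {ix : ℕ → ℕ}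

lemma Branch.spec_est (hb : Branch z A t f ix) {κ J : ℕ} {g : F} (hg : Wt κ (ps κ) g)
    {h : ℕ → F} {ixh : ℕ → ℕ} {S : Finset ℕ} {a b : ℕ} (hh : ∀ i, W (some (ixh i)) (h i))
    (hix : ∀ i, pp (cl h i) ≤ ixh i ∧ ixh i < pp (cl h i + 1)) (hS : S.card ≤ NN κ)
    (hge : g = (1 / (ps κ : ℚ)) • ∑ s ∈ S, rs a b (h (2 * s) + h (2 * s + 1)))
    (B : Finset ℕ) (X : ℝ)
    (hX : ∀ g, InW g → ∀ B', B' ⊆ B → |ev g (∑ s ∈ B', dd t s)| ≤ X) :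
    |ev g (∑ s ∈ B, dd t s)| ≤ 20 + 1 / ps κ * (al J * X + 24 * B.card / mm J + 6) := by
  classical
  obtain ⟨c, hc1, hc2⟩ := exists_class κ
  obtain ⟨i0, hi0, hi1⟩ := split_branch h f ((pairs S).sup id + 1)
  set bad : ℕ → Prop := fun s => (cl f (2 * s) ≤ c ∧ c ≤ cl f (2 * s + 1)) ∨ s = i0 / 2 ∨
    (A (2 * s) < a ∧ a < A (2 * s + 2)) ∨ (A (2 * s) < b ∧ b < A (2 * s + 2)) with hbad
  set B1 := B.filter bad with hB1
  set B2 := (B.filter (fun s => ¬ bad s)).filter (fun s => cl f (2 * s + 1) < c) with hB2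
  set B3 := (B.filter (fun s => ¬ bad s)).filter (fun s => ¬ cl f (2 * s + 1) < c) with hB3
  have hsum : ∑ s ∈ B, dd t s = ∑ s ∈ B1, dd t s + (∑ s ∈ B2, dd t s + ∑ s ∈ B3, dd t s) := by
    rw [hB2, hB3, Finset.sum_filter_add_sum_filter_not, hB1, Finset.sum_filter_add_sum_filter_not]
  have hm := mm_pos J
  have hps : (0:ℝ) < ps κ := hg.pos
  have e1 : |ev g (∑ s ∈ B1, dd t s)| ≤ 16 := by
    rw [map_sum]
    refine (Finset.abs_sum_le_sum_abs _ _).trans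
      ((Finset.sum_le_sum fun s _ => hb.dd_le hg.2.1 s).trans ?_)
    rw [Finset.sum_const, nsmul_eq_mul]
    have hcard : B1.card ≤ 4 := by
      have hsub : B1 ⊆ (B.filter (fun s => cl f (2 * s) ≤ c ∧ c ≤ cl f (2 * s + 1))) ∪
          ({i0 / 2} ∪ ((B.filter (fun s => A (2 * s) < a ∧ a < A (2 * s + 2))) ∪
          (B.filter (fun s => A (2 * s) < b ∧ b < A (2 * s + 2))))) := by
        intro s hs
        rw [hB1, Finset.mem_filter] at hs
        simp only [Finset.mem_union, Finset.mem_filter, Finset.mem_singleton]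
        rcases hs.2 with h1 | h1 | h1 | h1
        · exact Or.inl ⟨hs.1, h1⟩
        · exact Or.inr (Or.inl h1)
        · exact Or.inr (Or.inr (Or.inl ⟨hs.1, h1⟩))
        · exact Or.inr (Or.inr (Or.inr ⟨hs.1, h1⟩))
      have h1 := window_card f c B
      have h2 := cut_card hb a B
      have h3 := cut_card hb b B
      refine (Finset.card_le_card hsub).trans ?_
      refine (Finset.card_union_le _ _).trans ?_
      have h4 := Finset.card_union_le ({i0 / 2} : Finset ℕ)
        ((B.filter (fun s => A (2 * s) < a ∧ a < A (2 * s + 2))) ∪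
          (B.filter (fun s => A (2 * s) < b ∧ b < A (2 * s + 2))))
      have h5 := Finset.card_union_le (B.filter (fun s => A (2 * s) < a ∧ a < A (2 * s + 2)))
          (B.filter (fun s => A (2 * s) < b ∧ b < A (2 * s + 2)))
      rw [Finset.card_singleton] at h4
      omega
    have : (B1.card : ℝ) ≤ 4 := by exact_mod_cast hcard
    linarith
  have e2 : |ev g (∑ s ∈ B2, dd t s)| ≤ 4 := by
    rw [map_sum]
    refine (Finset.abs_sum_le_sum_abs _ _).trans
      ((Finset.sum_le_sum (g := fun s => 2 * ((1:ℝ) / 2) ^ s) fun s hs => ?_).trans ?_)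
    · rw [hB2, Finset.mem_filter] at hs
      exact hb.dd_low hg hc1 hs.2
    · rw [← Finset.mul_sum]
      have := sum_half_le B2
      linarith
  have hsub3 : B3 ⊆ B := (Finset.filter_subset _ _).trans (Finset.filter_subset _ _)
  have e3 : |ev g (∑ s ∈ B3, dd t s)| ≤ 1 / ps κ * (al J * X + 24 * B.card / mm J + 6) := by
    have hmem : ∀ s ∈ B3, ¬ bad s ∧ ¬ cl f (2 * s + 1) < c := by
      intro s hs
      rw [hB3, Finset.mem_filter, Finset.mem_filter] at hs
      exact ⟨hs.1.2, hs.2⟩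
    have h1 := hb.spec_main (J := J) hc2 hh hix hS hi0
      (fun i hi hiS => hi1 i hi (Nat.lt_succ_of_le (Finset.le_sup (f := id) hiS))) B3
      (fun s hs he => (hmem s hs).1 (Or.inr (Or.inl he)))
      (fun s hs => by
        by_contra hcon
        exact (hmem s hs).1 (Or.inl ⟨by omega, by have := (hmem s hs).2; omega⟩))
      (fun s hs he => (hmem s hs).1 (Or.inr (Or.inr (Or.inl he))))
      (fun s hs he => (hmem s hs).1 (Or.inr (Or.inr (Or.inr he))))
      X (fun g hg => hX g hg B3 hsub3)
    rw [hge, ev_smul, ev_sum, abs_mul]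
    push_cast
    rw [abs_of_pos (by positivity : (0:ℝ) < 1 / ps κ)]
    have hcard : (B3.card : ℝ) ≤ B.card := by exact_mod_cast Finset.card_le_card hsub3
    have h2 : 24 * (B3.card : ℝ) / mm J ≤ 24 * B.card / mm J := by gcongr
    apply mul_le_mul_of_nonneg_left _ (by positivity)
    linarith
  rw [hsum, map_add, map_add]
  have h1 := abs_add_le (ev g (∑ s ∈ B1, dd t s))
    (ev g (∑ s ∈ B2, dd t s) + ev g (∑ s ∈ B3, dd t s))
  have h2 := abs_add_le (ev g (∑ s ∈ B2, dd t s)) (ev g (∑ s ∈ B3, dd t s))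
  linarith

/-- functionals of small index -/
lemma Branch.small_est (hb : Branch z A t f ix) {κ w : ℕ} {g : F} (hg : Wt κ w g)
    (B : Finset ℕ) (ε Y : ℝ)
    (hX : ∀ g, InW g → ∀ B' : Finset ℕ, |ev g (∑ s ∈ B', dd t s)| ≤ B'.card * ε + Y)
    (hε : 0 ≤ ε) (hY : 0 ≤ Y) :
    |ev g (∑ s ∈ B, dd t s)| ≤ 1 / w * (B.card * ε + 2 * NN κ * (ε + Y)) := by
  classical
  have hw := hg.pos
  obtain ⟨_, _, G, S, hG, hGs, hc, rfl⟩ := hg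
  rw [ev_smul, ev_sum, abs_mul]
  push_cast
  rw [abs_of_pos (by positivity : (0:ℝ) < 1 / w)]
  apply mul_le_mul_of_nonneg_left _ (by positivity)
  refine (Finset.abs_sum_le_sum_abs _ _).trans ?_
  have h1 : ∀ b ∈ S, |ev (G b) (∑ s ∈ B, dd t s)| ≤
      ((B.filter (fun i => hit (G b) (dd t i))).card : ℝ) * ε + Y := by
    intro b _
    refine le_trans (le_of_eq ?_) (hX (G b) (hG b) _)
    rw [map_sum, map_sum]
    congr 1
    symm
    apply Finset.sum_subset (Finset.filter_subset _ _)
    intro i hi hni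
    by_contra h0
    exact hni (Finset.mem_filter.2 ⟨hi, hit_of_ev h0⟩)
  refine (Finset.sum_le_sum h1).trans ?_
  rw [Finset.sum_add_distrib, ← Finset.sum_mul, Finset.sum_const, nsmul_eq_mul]
  have h2 := hit_card hb.dd_scc hGs B S
  have h3 : (∑ b ∈ S, ((B.filter (fun i => hit (G b) (dd t i))).card : ℝ)) ≤ B.card + S.card := by
    exact_mod_cast h2
  have h4 : (S.card : ℝ) ≤ 2 * NN κ := by exact_mod_cast hc
  calc (∑ b ∈ S, ((B.filter (fun i => hit (G b) (dd t i))).card : ℝ)) * ε + S.card * Y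
      ≤ (B.card + S.card) * ε + S.card * Y := by gcongr
    _ = B.card * ε + S.card * (ε + Y) := by ring
    _ ≤ _ := by gcongr

lemma Branch.master (hb : Branch z A t f ix) (J r : ℕ) :
    ∀ g, InW g → ∀ B : Finset ℕ, |ev g (∑ s ∈ B, dd t s)| ≤
      B.card * (100 * ((1 / 2) ^ r + 1 / mm (J + 1))) + 100 * (3 * NN J) ^ r := by
  have hm := mm_pos (J + 1)
  have hN : (1:ℝ) ≤ NN J := by
    have h8 := NN_ge J
    have : 0 < 2 ^ J := by positivity
    exact_mod_cast (by omega : 1 ≤ NN J)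
  induction r with
  | zero =>
    intro g hg B
    rw [map_sum]
    refine (Finset.abs_sum_le_sum_abs _ _).trans
      ((Finset.sum_le_sum fun s _ => hb.dd_le hg s).trans ?_)
    rw [Finset.sum_const, nsmul_eq_mul]
    have h1 : (0:ℝ) ≤ 1 / mm (J + 1) := by positivity
    have h2 : (0:ℝ) ≤ B.card := by positivity
    simp only [pow_zero]
    nlinarith
  | succ r ih =>
    intro g hg B
    set M : ℝ := (3 * NN J) ^ r with hM
    set p : ℝ := (1 / 2) ^ r with hp
    set q : ℝ := 1 / mm (J + 1) with hq
    set l : ℝ := (B.card : ℝ) with hl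
    have hM1 : 1 ≤ M := one_le_pow₀ (by linarith)
    have hp0 : 0 ≤ p := by positivity
    have hp1 : p ≤ 1 := pow_le_one₀ (by norm_num) (by norm_num)
    have hq0 : 0 ≤ q := by positivity
    have hq1 : q ≤ 1 := by
      rw [hq, div_le_one (by linarith)]; linarith
    have hl0 : 0 ≤ l := by positivity
    have hlp : 0 ≤ l * p := by positivity
    have hlq : 0 ≤ l * q := by positivity
    have hgoal : l * (100 * ((1 / 2) ^ (r + 1) + q)) + 100 * (3 * (NN J : ℝ)) ^ (r + 1) =
        50 * (l * p) + 100 * (l * q) + 300 * (NN J * M) := by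
      rw [pow_succ, pow_succ, ← hM, ← hp]; ring
    rw [hgoal]
    have hNM : 1 ≤ NN J * M := one_le_mul_of_one_le_of_one_le hN hM1
    have hNM2 : M ≤ NN J * M := le_mul_of_one_le_left (by linarith) hN
    obtain ⟨o, ho⟩ := hg
    rcases o with _ | κ
    · rcases W_none ho with rfl | ⟨n, rfl⟩
      · rw [ev_zero, abs_zero]; linarith
      · have h1 : |ev (Finsupp.single n 1) (∑ s ∈ B, dd t s)| ≤ 4 := by
          rw [ev_basis, Finsupp.finsetSum_apply]
          by_cases H : ∃ b ∈ B, dd t b n ≠ 0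
          · obtain ⟨b, hbB, hbn⟩ := H
            rw [Finset.sum_eq_single_of_mem b hbB]
            · rw [← ev_basis]; exact hb.dd_le (InW_basis n) b
            · intro c _ hc
              by_contra hcn
              rcases lt_or_gt_of_ne hc with hlt | hlt
              · exact lt_irrefl _ (hb.dd_scc c b hlt n n hcn hbn)
              · exact lt_irrefl _ (hb.dd_scc b c hlt n n hbn hcn)
          · push Not at H
            rw [Finset.sum_eq_zero H]; simp
        linarith
    · by_cases hκ : κ ≤ J
      · obtain ⟨w, hw⟩ := W_exists_wt ho
        have h1 := hb.small_est hw B (100 * (p + q)) (100 * M) ih (by positivity) (by positivity)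
        have hw4 : (4096:ℝ) ≤ w := by
          have := hw.1; have := ps_ge κ
          exact_mod_cast (by omega : 4096 ≤ w)
        have hNκ : (NN κ : ℝ) ≤ NN J := by exact_mod_cast NN_mono hκ
        refine h1.trans ?_
        have h2 : 1 / (w:ℝ) ≤ 1 / 4096 := by gcongr
        have h3 : l * (100 * (p + q)) + 2 * NN κ * (100 * (p + q) + 100 * M) ≤
            100 * (l * p) + 100 * (l * q) + 600 * (NN J * M) := by
          have : 100 * (p + q) + 100 * M ≤ 300 * M := by linarith
          have h5 : 2 * (NN κ : ℝ) * (100 * (p + q) + 100 * M) ≤ 2 * NN J * (300 * M) := by gcongr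
          linarith
        have h6 : 0 ≤ l * (100 * (p + q)) + 2 * NN κ * (100 * (p + q) + 100 * M) := by positivity
        calc 1 / (w:ℝ) * (l * (100 * (p + q)) + 2 * NN κ * (100 * (p + q) + 100 * M))
            ≤ 1 / 4096 * (100 * (l * p) + 100 * (l * q) + 600 * (NN J * M)) := by gcongr
          _ ≤ _ := by linarith
      · have hJκ : J + 1 ≤ κ := by omega
        rcases W_cases ho with hu | ⟨hsp, h, ixh, S, a, b, hh, hix, _, hS, hge⟩
        · have h1 := hb.unc_est hJκ hu B
          have h2 : 12 * (B.card : ℝ) / mm (J + 1) = 12 * (l * q) := by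
            rw [hq, hl]; ring
          rw [h2] at h1
          linarith
        · have h1 := hb.spec_est (J := J + 1) hsp hh hix hS hge B
            (l * (100 * (p + q)) + 100 * M) (fun g hg B' hB' => by
              refine (ih g hg B').trans ?_
              have : (B'.card : ℝ) ≤ l := by
                rw [hl]; exact_mod_cast Finset.card_le_card hB'
              gcongr)
          refine h1.trans ?_
          have hps : (4096:ℝ) ≤ ps κ := by exact_mod_cast ps_ge κ
          have hal : 4 * (al (J + 1) : ℝ) ≤ ps κ := by exact_mod_cast four_al_le _ _ hJκ
          have h2 : 24 * (B.card : ℝ) / mm (J + 1) = 24 * (l * q) := by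
            rw [hq, hl]; ring
          rw [h2]
          set X := l * (100 * (p + q)) + 100 * M with hX
          have hX0 : 0 ≤ X := by positivity
          have h3 : 1 / (ps κ : ℝ) * (al (J + 1) * X + 24 * (l * q) + 6) ≤
              1 / 4 * X + (l * q) + 1 := by
            rw [one_div, inv_mul_le_iff₀ (by linarith)]
            have k1 : 4 * (al (J + 1) : ℝ) * X ≤ ps κ * X := by gcongr
            have k2 : 4096 * (l * q) ≤ ps κ * (l * q) := by gcongr
            linarith
          have h4 : X = 100 * (l * p) + 100 * (l * q) + 100 * M := by rw [hX]; ring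
          linarith

end branch2

/-! ### Final estimates -/

section branch3

variable {z : ℕ → V} {A : ℕ → ℕ} {t : ℕ → V} {f : ℕ → F} {ix : ℕ → ℕ}

lemma logb_le_of {l m : ℕ} (h : l + 1 ≤ 2 ^ m) : Real.logb 2 ((l:ℝ) + 1) ≤ m := by
  rw [Real.logb_le_iff_le_rpow (by norm_num) (by positivity), Real.rpow_natCast]
  exact_mod_cast h

lemma le_logb_of {l m : ℕ} (h : 2 ^ m ≤ l + 1) : (m:ℝ) ≤ Real.logb 2 ((l:ℝ) + 1) := by
  rw [Real.le_logb_iff_rpow_le (by norm_num) (by positivity), Real.rpow_natCast]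
  exact_mod_cast h

lemma Branch.upper (hb : Branch z A t f ix) (B : Finset ℕ) (hB : 1 ≤ B.card) :
    nrm (∑ s ∈ B, dd t s) ≤ (300 + 4 * mm 0) * B.card / Real.logb 2 ((B.card : ℝ) + 1) := by
  classical
  set l := B.card with hl
  have hl0 : (0:ℝ) ≤ l := by positivity
  have hlog : (1:ℝ) ≤ Real.logb 2 ((l:ℝ) + 1) := by
    have := le_logb_of (l := l) (m := 1) (by omega)
    simpa using this
  have hm0 := mm_pos 0
  have hex : ∃ J, l < (3 * NN J) ^ (al (J + 1)) * mm (J + 1) := by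
    refine ⟨l, ?_⟩
    have h1 := le_ps (l + 1)
    have h2 := ps_le_mm (l + 1)
    have h3 : 0 < (3 * NN l) ^ (al (l + 1)) := by
      have := NN_ge l
      have : 0 < 2 ^ l := by positivity
      apply Nat.pow_pos; omega
    calc l < mm (l + 1) := by omega
      _ ≤ _ := Nat.le_mul_of_pos_left _ h3
  have hspec := Nat.find_spec hex
  have hmin := fun m => Nat.find_min hex (m := m)
  generalize Nat.find hex = J at hspec hmin
  have hlJ : Real.logb 2 ((l:ℝ) + 1) ≤ mm J := logb_le_of (hspec.trans_le (big_le J))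
  apply nrm_le (by positivity)
  intro g hg
  rw [le_div_iff₀ (by linarith)]
  rcases J with _ | J
  · have h1 : |ev g (∑ s ∈ B, dd t s)| ≤ 4 * l := by
      rw [map_sum]
      refine (Finset.abs_sum_le_sum_abs _ _).trans
        ((Finset.sum_le_sum fun s _ => hb.dd_le hg s).trans ?_)
      rw [Finset.sum_const, nsmul_eq_mul]; linarith
    calc |ev g (∑ s ∈ B, dd t s)| * Real.logb 2 ((l:ℝ) + 1) ≤ (4 * l) * mm 0 := by gcongr
      _ ≤ _ := by nlinarith
  · have h1 := hb.master J (al (J + 1)) g hg B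
    have hJ := hmin J (by omega)
    push Not at hJ
    have hm := mm_pos (J + 1)
    have h2 : ((1:ℝ) / 2) ^ (al (J + 1)) = 1 / mm (J + 1) := by
      rw [← two_pow_al, one_div, inv_pow]; push_cast; rw [one_div]
    have h3 : (3 * (NN J : ℝ)) ^ (al (J + 1)) ≤ l / mm (J + 1) := by
      rw [le_div_iff₀ (by linarith)]
      exact_mod_cast hJ
    rw [h2, ← hl] at h1
    have h4 : |ev g (∑ s ∈ B, dd t s)| ≤ 300 * l / mm (J + 1) := by
      refine h1.trans ?_
      have : (300 * (l:ℝ) / mm (J + 1)) =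
        l * (100 * (1 / mm (J + 1) + 1 / mm (J + 1))) + 100 * (l / mm (J + 1)) := by ring
      rw [this]; linarith
    calc |ev g (∑ s ∈ B, dd t s)| * Real.logb 2 ((l:ℝ) + 1)
        ≤ (300 * l / mm (J + 1)) * mm (J + 1) := by gcongr
      _ = 300 * l := by field_simp
      _ ≤ _ := by nlinarith

lemma Branch.lower (hb : Branch z A t f ix) (B : Finset ℕ) (hB : 1 ≤ B.card) :
    1 / ps 0 * B.card / Real.sqrt (Real.logb 2 ((B.card : ℝ) + 1)) ≤
      nrm (∑ s ∈ B, (t (2 * s) + t (2 * s + 1))) := by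
  classical
  set l := B.card with hl
  have hl0 : (0:ℝ) ≤ l := by positivity
  have hlog : (1:ℝ) ≤ Real.logb 2 ((l:ℝ) + 1) := by
    have := le_logb_of (l := l) (m := 1) (by omega)
    simpa using this
  have hsq : (1:ℝ) ≤ Real.sqrt (Real.logb 2 ((l:ℝ) + 1)) := Real.one_le_sqrt.2 hlog
  have hex : ∃ κ, l ≤ NN κ := ⟨l, le_NN l⟩
  have hspec := Nat.find_spec hex
  have hmin := fun m => Nat.find_min hex (m := m)
  generalize Nat.find hex = κ at hspec hmin
  set b := A (2 * (B.sup id) + 2) with hbdef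
  have hfs : Scc f := by
    intro i j hij m n hm hn
    have h1 := (hb.good i).supp_f m hm
    have h2 := (hb.good j).supp_f n hn
    have h3 := hb.mono.monotone (by omega : i + 1 ≤ j)
    omega
  have hW : InW ((1 / (ps κ : ℚ)) • ∑ s ∈ B, rs 0 b (f (2 * s) + f (2 * s + 1))) :=
    ⟨some κ, W.spec κ f ix B 0 b (fun i => (hb.good i).inW) (fun i => (hb.good i).ix) hfs hspec⟩
  have hps : (0:ℝ) < ps κ := by
    have := ps_ge κ; exact_mod_cast (by omega : 0 < ps κ)
  have hps0 : (4096:ℝ) ≤ ps 0 := by exact_mod_cast ps_ge 0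
  have hval : ev ((1 / (ps κ : ℚ)) • ∑ s ∈ B, rs 0 b (f (2 * s) + f (2 * s + 1)))
      (∑ s ∈ B, (t (2 * s) + t (2 * s + 1))) = 2 * l / ps κ := by
    have key : ∀ i ∈ pairs B, ev (rs 0 b (f i)) (∑ j ∈ pairs B, t j) = 1 := by
      intro i hi
      rw [map_sum, Finset.sum_eq_single_of_mem i hi]
      · rw [ev_rs, rs_self]
        · exact (hb.good i).one
        · intro n hn
          have h1 := (hb.good i).supp_t n hn
          rw [mem_pairs] at hi
          have h2 : i / 2 ≤ B.sup id := Finset.le_sup (f := id) hi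
          have h3 := hb.mono.monotone (by omega : i + 1 ≤ 2 * (B.sup id) + 2)
          omega
      · intro j _ hj
        exact hb.ev_f_ne 0 b hj.symm
    rw [ev_smul, ev_sum, ← sum_pairs B t]
    have h1 : ∀ s ∈ B, ev (rs 0 b (f (2 * s) + f (2 * s + 1))) (∑ j ∈ pairs B, t j) = 2 := by
      intro s hs
      rw [rs_add, ev_add, key, key]
      · norm_num
      · rw [mem_pairs]; rwa [show (2 * s + 1) / 2 = s by omega]
      · rw [mem_pairs]; rwa [show (2 * s) / 2 = s by omega]
    rw [Finset.sum_congr rfl h1, Finset.sum_const, nsmul_eq_mul]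
    push_cast
    ring
  have h1 := (le_abs_self _).trans (ev_le_nrm hW (∑ s ∈ B, (t (2 * s) + t (2 * s + 1))))
  rw [hval] at h1
  refine le_trans ?_ h1
  rcases κ with _ | κ
  · calc 1 / (ps 0 : ℝ) * l / Real.sqrt (Real.logb 2 ((l:ℝ) + 1)) ≤ 1 / (ps 0 : ℝ) * l / 1 := by
          gcongr
      _ = 1 * l / ps 0 := by ring
      _ ≤ _ := by gcongr; norm_num
  · have h2 := hmin κ (by omega)
    have h3 : (bb κ : ℝ) ≤ Real.logb 2 ((l:ℝ) + 1) := by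
      apply le_logb_of
      rw [← NN_eq]; omega
    have h4 : (ps (κ + 1) : ℝ) ≤ Real.sqrt (Real.logb 2 ((l:ℝ) + 1)) := by
      apply Real.le_sqrt_of_sq_le
      refine le_trans ?_ h3
      exact_mod_cast ps_sq_le κ
    calc 1 / (ps 0 : ℝ) * l / Real.sqrt (Real.logb 2 ((l:ℝ) + 1))
        ≤ 1 / (ps 0 : ℝ) * l / ps (κ + 1) := by gcongr
      _ ≤ 2 * l / ps (κ + 1) := by
        gcongr
        rw [div_le_iff₀ (by linarith)]; linarith

lemma Branch.one_le (hb : Branch z A t f ix) (i : ℕ) : 1 ≤ nrm (t i) := by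
  have h := ev_le_nrm ⟨_, (hb.good i).inW⟩ (t i)
  rw [(hb.good i).one] at h
  simpa using h

end branch3

/-- normalization of a block sequence -/
lemma exists_normalized {ζ : ℕ → V} (hs : Scc ζ) (hne : ∀ n, ζ n ≠ 0) :
    ∃ (A : ℕ → ℕ) (z : ℕ → V), Blk A z ∧ (∀ a, z a ∈ Submodule.span ℝ (Set.range ζ)) ∧
      (∀ a, nrm (z a) ≤ 1) ∧ ∀ a, ∃ f, InW f ∧ 1 / 4 ≤ ev f (z a) := by
  classical
  have h1 : ∀ a, ∃ c : ℝ, nrm (c • ζ a) ≤ 1 ∧ ∃ f, InW f ∧ 1 / 4 ≤ ev f (c • ζ a) := by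
    intro a
    have hp := nrm_pos (hne a)
    obtain ⟨f, hf, hfx⟩ := exists_of_lt_nrm (x := ζ a) (C := nrm (ζ a) / 4) (by positivity)
      (by linarith)
    rcases le_total 0 (ev f (ζ a)) with h0 | h0
    · rw [abs_of_nonneg h0] at hfx
      refine ⟨(nrm (ζ a))⁻¹, ?_, f, hf, ?_⟩
      · rw [nrm_smul, abs_of_pos (by positivity), inv_mul_cancel₀ hp.ne']
      · rw [map_smul, smul_eq_mul, ← div_eq_inv_mul, le_div_iff₀ hp]; linarith
    · rw [abs_of_nonpos h0] at hfx
      refine ⟨-(nrm (ζ a))⁻¹, ?_, f, hf, ?_⟩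
      · rw [nrm_smul, abs_neg, abs_of_pos (by positivity), inv_mul_cancel₀ hp.ne']
      · rw [map_smul, smul_eq_mul, neg_mul, ← mul_neg, ← div_eq_inv_mul, le_div_iff₀ hp]; linarith
  choose c hc1 hc2 using h1
  let A : ℕ → ℕ := fun a => Nat.casesOn a 0 (fun b => (ζ b).support.sup id + 1)
  have hA : ∀ a, A (a + 1) = (ζ a).support.sup id + 1 := fun a => rfl
  have hA0 : A 0 = 0 := rfl
  clear_value A
  have hlow : ∀ a n, ζ a n ≠ 0 → A a ≤ n := by
    intro a n hn
    rcases a with _ | a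
    · omega
    · rw [hA, Nat.add_one_le_iff]
      obtain ⟨m, hm, hme⟩ := Finset.exists_mem_eq_sup (ζ a).support
        (Finsupp.support_nonempty_iff.2 (hne a)) id
      rw [hme]
      exact hs a (a + 1) (by omega) m n (Finsupp.mem_support_iff.1 hm) hn
  have hhigh : ∀ a n, ζ a n ≠ 0 → n < A (a + 1) := by
    intro a n hn
    rw [hA]
    exact Nat.lt_succ_of_le (Finset.le_sup (f := id) (Finsupp.mem_support_iff.2 hn))
  refine ⟨A, fun a => c a • ζ a, ⟨?_, ?_⟩, ?_, hc1, hc2⟩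
  · apply strictMono_nat_of_lt_succ
    intro a
    obtain ⟨n, hn⟩ := Finsupp.ne_iff.1 (hne a)
    have := hlow a n hn
    have := hhigh a n hn
    omega
  · intro a n hn
    rw [Finsupp.smul_apply] at hn
    have := right_ne_zero_of_mul hn
    exact ⟨hlow a n this, hhigh a n this⟩
  · intro a
    exact Submodule.smul_mem _ _ (Submodule.subset_span ⟨a, rfl⟩)

lemma core {ζ : ℕ → V} (hs : Scc ζ) (hne : ∀ n, ζ n ≠ 0) :
    ∃ t : ℕ → V, Scc t ∧ (∀ i, t i ∈ Submodule.span ℝ (Set.range ζ)) ∧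
      (∀ i, 1 ≤ nrm (t i) ∧ nrm (t i) ≤ 2) ∧ ∀ B : Finset ℕ, 1 ≤ B.card →
      1 / ps 0 * B.card / Real.sqrt (Real.logb 2 ((B.card : ℝ) + 1)) ≤
        nrm (∑ s ∈ B, (t (2 * s) + t (2 * s + 1))) ∧
      nrm (∑ s ∈ B, (t (2 * s) - t (2 * s + 1))) ≤
        (300 + 4 * mm 0) * B.card / Real.logb 2 ((B.card : ℝ) + 1) := by
  obtain ⟨A, z, hB, hmem, hn, hg⟩ := exists_normalized hs hne
  obtain ⟨A', y, J, hR⟩ := exists_raw hB hn hg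
  obtain ⟨A'', t, f, ix, hb⟩ := exists_branch hR
  refine ⟨t, hb.blk.scc, fun i => ?_, fun i => ⟨hb.one_le i, (hb.good i).nle⟩,
    fun B hB => ⟨hb.lower B hB, hb.upper B hB⟩⟩
  have : Submodule.span ℝ (Set.range z) ≤ Submodule.span ℝ (Set.range ζ) := by
    rw [Submodule.span_le]
    rintro _ ⟨a, rfl⟩
    exact hmem a
  exact this (hb.good i).mem

end IntSp

theorem exists_space_with_intertwined_estimates :
    ∃ (X : Type) (_ : NormedAddCommGroup X) (_ : NormedSpace ℝ X) (e : ℕ → X) (c C : ℝ),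
      CompleteSpace X ∧ ¬FiniteDimensional ℝ X ∧ IsSchauderBasis e ∧ 0 < c ∧ 0 < C ∧
      ∀ z : ℕ → X, IsBlockSeq e z →
        -- intertwined block sequences `u_n = w (2n)` and `v_n = w (2n+1)` in `[z_n]`
        ∃ w : ℕ → X, IsBlockSeq e w ∧
          (∀ n, w n ∈ Submodule.span ℝ (Set.range z)) ∧
          Seminormalized (fun n => w (2 * n)) ∧ Seminormalized (fun n => w (2 * n + 1)) ∧
          ∀ l : ℕ, 1 ≤ l → ∀ n : Fin l → ℕ, StrictMono n → (∀ i, l ≤ n i) →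
            c * l / Real.sqrt (flog l) ≤ ‖∑ i, (w (2 * n i) + w (2 * n i + 1))‖ ∧
            ‖∑ i, (w (2 * n i) - w (2 * n i + 1))‖ ≤ C * l / flog l := by
  refine ⟨IntSp.XS, inferInstance, inferInstance, IntSp.ee, 1 / (IntSp.ps 0 : ℝ),
    300 + 4 * (IntSp.mm 0 : ℝ), IntSp.XS_complete, IntSp.XS_infinite, IntSp.ee_basis, ?_, ?_, ?_⟩
  · have h : 4096 ≤ IntSp.ps 0 := IntSp.ps_ge 0
    have h2 : (0 : ℝ) < (IntSp.ps 0 : ℝ) := by exact_mod_cast (by omega : 0 < IntSp.ps 0)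
    positivity
  · positivity
  rintro z ⟨hz0, I, a, hza, hI⟩
  have hzT : ∀ n, z n = IntSp.TX (∑ i ∈ I n, Finsupp.single i (a n i)) := fun n => by
    rw [hza n, IntSp.TX_eq]
  obtain ⟨ζ, hζ⟩ : ∃ ζ : ℕ → IntSp.V, ∀ n, ζ n = ∑ i ∈ I n, Finsupp.single i (a n i) :=
    ⟨_, fun _ => rfl⟩
  have hzζ : ∀ n, z n = IntSp.TX (ζ n) := fun n => by rw [hzT n, hζ n]
  have hmem : ∀ n m, ζ n m ≠ 0 → m ∈ I n := by
    intro n m hm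
    by_contra hc
    apply hm
    rw [hζ n, Finsupp.finsetSum_apply]
    refine Finset.sum_eq_zero fun i hi => ?_
    rw [Finsupp.single_apply, if_neg]
    rintro rfl
    exact hc hi
  have hs : IntSp.Scc ζ := fun i j hij m n hm hn =>
    hI i j hij m (hmem i m hm) n (hmem j n hn)
  have hne : ∀ n, ζ n ≠ 0 := fun n h => hz0 n (by rw [hzζ n, h, map_zero])
  obtain ⟨t, hts, htm, htn, htB⟩ := IntSp.core hs hne
  have hn1 : ∀ n, 1 ≤ ‖IntSp.TX (t n)‖ ∧ ‖IntSp.TX (t n)‖ ≤ 2 := fun n => by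
    rw [IntSp.TX_norm]; exact htn n
  refine ⟨fun n => IntSp.TX (t n), ⟨fun n h => ?_, fun n => (t n).support, fun n i => t n i,
    fun n => IntSp.TX_eq' (t n), fun n m hnm i hi j hj => ?_⟩, fun n => ?_,
    ⟨1, 2, one_pos, fun n => hn1 _⟩, ⟨1, 2, one_pos, fun n => hn1 _⟩, ?_⟩
  · have := (hn1 n).1
    replace h : IntSp.TX (t n) = 0 := h
    rw [h, norm_zero] at this
    linarith
  · exact hts n m hnm i j (Finsupp.mem_support_iff.mp hi) (Finsupp.mem_support_iff.mp hj)
  · have h1 : IntSp.TX (t n) ∈ (Submodule.span ℝ (Set.range ζ)).map IntSp.TX :=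
      Submodule.mem_map_of_mem (htm n)
    rw [Submodule.map_span, ← Set.range_comp] at h1
    have h2 : (IntSp.TX ∘ ζ : ℕ → IntSp.XS) = z := funext fun k => (hzζ k).symm
    rw [h2] at h1
    exact h1
  · intro l hl n hn _
    have hcard : (Finset.univ.image n).card = l := by
      rw [Finset.card_image_of_injective _ hn.injective, Finset.card_univ, Fintype.card_fin]
    have hB := htB (Finset.univ.image n) (by rw [hcard]; exact hl)
    rw [hcard, Finset.sum_image (fun x _ y _ h => hn.injective h),
      Finset.sum_image (fun x _ y _ h => hn.injective h)] at hB
    have e1 : ∑ i, (IntSp.TX (t (2 * n i)) + IntSp.TX (t (2 * n i + 1)))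
        = IntSp.TX (∑ i, (t (2 * n i) + t (2 * n i + 1))) := by
      simp only [map_sum, map_add]
    have e2 : ∑ i, (IntSp.TX (t (2 * n i)) - IntSp.TX (t (2 * n i + 1)))
        = IntSp.TX (∑ i, (t (2 * n i) - t (2 * n i + 1))) := by
      simp only [map_sum, map_sub]
    show _ ≤ ‖∑ i, (IntSp.TX (t (2 * n i)) + IntSp.TX (t (2 * n i + 1)))‖ ∧
      ‖∑ i, (IntSp.TX (t (2 * n i)) - IntSp.TX (t (2 * n i + 1)))‖ ≤ _
    rw [e1, e2, IntSp.TX_norm, IntSp.TX_norm]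
    exact hB
end

section
/- Let (x_n) and (y_n) be seminormalized basic weakly null sequences in a Banach space X which admit spreading models (x̃_n) in a Banach space E and (ỹ_n) in a Banach space F, respectively. Assume that for some 0 < p < q and constants 0 < c, C < ∞ one has ‖Σ_n a_n x̃_n‖_E ≥ c·‖(a_n)‖_{f^p} and ‖Σ_n a_n ỹ_n‖_F ≤ C·|||(a_n)|||_{f^q} for all (a_n) ∈ c₀₀. Then there exist a subsequence (n_k) of ℕ and a constant M < ∞ such that ‖Σ_k a_k y_{n_k}‖ ≤ M·‖Σ_k a_k x_{n_k}‖ for all (a_k) ∈ c₀₀; that is, the map x_{n_k} ↦ y_{n_k} extends to a bounded linear operator from the closed span of (x_{n_k}) into X. -/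
/-- The `n`-th largest value (1-indexed) of the sequence `(|x i|)`, i.e. the decreasing
rearrangement of `(|x i|)`. -/
noncomputable def drear (x : ℕ →₀ ℝ) (n : ℕ) : ℝ :=
  sSup {t : ℝ | 0 ≤ t ∧ n ≤ (x.support.filter fun i => t ≤ |x i|).card}

/-- The norm `‖x‖_g = sup_{n₁ < … < n_l} (1/g(l)) ∑ |x_{n_i}|`. -/
noncomputable def gnorm (g : ℕ → ℝ) (x : ℕ →₀ ℝ) : ℝ :=
  sSup {r : ℝ | ∃ s : Finset ℕ, s.Nonempty ∧ r = (1 / g s.card) * ∑ i ∈ s, |x i|}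

/-- The norm `|||x|||_g = ∑_{i ≥ 1} x_i^# / g(i)`. -/
noncomputable def tnorm (g : ℕ → ℝ) (x : ℕ →₀ ℝ) : ℝ :=
  ∑ i ∈ Finset.range x.support.card, drear x (i + 1) / g (i + 1)

/-- `(xt_n)` (in `E`) is the spreading model of `(x_n)` (in `X`): for every `k` and scalars
`a₁, …, a_k`, `‖∑ a_i x_{n_i}‖ → ‖∑ a_i xt_i‖` as `n₁ → ∞` along `n₁ < … < n_k`. -/
def HasSpreadingModel {X E : Type*} [NormedAddCommGroup X] [NormedSpace ℝ X]
    [NormedAddCommGroup E] [NormedSpace ℝ E] (x : ℕ → X) (xt : ℕ → E) : Prop :=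
  ∀ (k : ℕ) (a : Fin k → ℝ) (ε : ℝ), 0 < ε → ∃ N : ℕ, ∀ n : Fin k → ℕ,
    StrictMono n → (∀ i, N ≤ n i) →
    |‖∑ i, a i • x (n i)‖ - ‖∑ i, a i • xt i‖| ≤ ε

open Filter Topology

theorem ram_aux {κ : Type*} (r : ℕ) : ∀ (c : Finset ℕ → κ), (Set.range c).Finite →
    ∀ N : Set ℕ, N.Infinite → ∃ N' ⊆ N, N'.Infinite ∧ ∃ col, ∀ s : Finset ℕ, (s : Set ℕ) ⊆ N' →
      s.card = r → c s = col := by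
  induction r with
  | zero =>
    intro c _ N hN
    refine ⟨N, subset_rfl, hN, c ∅, ?_⟩
    intro s _ hs
    rw [Finset.card_eq_zero.1 hs]
  | succ r ih =>
    intro c hc N hN
    have step : ∀ M : {M : Set ℕ // M.Infinite}, ∃ n ∈ M.1, ∃ M' : {M : Set ℕ // M.Infinite},
        M'.1 ⊆ M.1 ∧ (∀ i ∈ M'.1, n < i) ∧ ∃ col ∈ Set.range c, ∀ s : Finset ℕ, (s : Set ℕ) ⊆ M'.1 →
          s.card = r → c (insert n s) = col := by
      rintro ⟨M, hM⟩
      obtain ⟨n, hn⟩ := hM.nonempty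
      have h1 : (M ∩ Set.Ioi n).Infinite := by
        have : M \ Set.Iic n = M ∩ Set.Ioi n := by ext; simp
        rw [← this]
        exact hM.sdiff (Set.finite_Iic n)
      obtain ⟨M', hM', hinf, col, hcol⟩ := ih (fun s => c (insert n s))
        (hc.subset (by rintro _ ⟨s, rfl⟩; exact ⟨_, rfl⟩)) _ h1
      refine ⟨n, hn, ⟨M', hinf⟩, fun i hi => (hM' hi).1, fun i hi => (hM' hi).2, col, ?_, hcol⟩
      obtain ⟨s, hs, hsc⟩ := hinf.exists_subset_card_eq r
      exact ⟨_, hcol s hs hsc⟩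
    choose n hn M' hM' hlt col hcolr hcol using step
    let st : ℕ → {M : Set ℕ // M.Infinite} := fun j => Nat.rec ⟨N, hN⟩ (fun _ M => M' M) j
    have st1 : ∀ j, st (j+1) = M' (st j) := fun j => rfl
    have anti : Antitone (fun j => (st j).1) := antitone_nat_of_succ_le (fun j => hM' (st j))
    let φ : ℕ → ℕ := fun j => n (st j)
    have hφ : ∀ i j, i < j → φ j ∈ (st (i+1)).1 := fun i j hij => anti (Nat.succ_le_of_lt hij) (hn (st j))
    have hmono : StrictMono φ := fun i j hij => hlt (st i) _ (hφ i j hij)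
    -- pigeonhole
    obtain ⟨k0, hk0, hinf⟩ : ∃ k0 ∈ Set.range c, {j | col (st j) = k0}.Infinite := by
      by_contra hcon
      push Not at hcon
      have : (⋃ k0 ∈ Set.range c, {j | col (st j) = k0}).Finite :=
        hc.biUnion (fun k hk => by simpa using hcon k hk)
      apply Set.infinite_univ (α := ℕ)
      apply this.subset
      intro j _
      simp only [Set.mem_iUnion]
      exact ⟨_, hcolr (st j), rfl⟩
    refine ⟨Set.image φ {j | col (st j) = k0}, ?_, hinf.image hmono.injective.injOn, k0, ?_⟩
    · rintro _ ⟨j, _, rfl⟩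
      exact anti (Nat.zero_le j) (hn (st j))
    · intro s hs hcard
      have hne : s.Nonempty := by rw [← Finset.card_pos]; omega
      have hmin := Finset.min'_mem s hne
      obtain ⟨j, hj, hjm⟩ := hs hmin
      have hins : insert (φ j) (s.erase (φ j)) = s := by
        rw [hjm]; exact Finset.insert_erase hmin
      rw [← hins, ← (show col (st j) = k0 from hj)]
      apply hcol
      · intro i hi
        simp only [Finset.coe_erase, Set.mem_sdiff, Finset.mem_coe, Set.mem_singleton_iff] at hi
        obtain ⟨i', _, rfl⟩ := hs hi.1
        have h2 : φ j < φ i' := by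
          rw [hjm]
          rw [hjm] at hi
          exact lt_of_le_of_ne (Finset.min'_le s _ hi.1) (Ne.symm hi.2)
        exact hφ j i' (hmono.lt_iff_lt.1 h2)
      · rw [hjm, Finset.card_erase_of_mem hmin, hcard]; rfl

theorem sch_step (W : Set (ℕ → ℝ)) (B : ℝ) (hB : ∀ w ∈ W, ∀ n, |w n| ≤ B) (hW : IsCompact W)
    (hnull : ∀ w ∈ W, Tendsto w atTop (𝓝 0)) (T : Finset ℕ) (N : Set ℕ) (hN : N.Infinite)
    (k : ℕ) (ε : ℝ) (hε : 0 < ε) :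
    ∃ n ∈ N, ∃ N' ⊆ N, N'.Infinite ∧ (∀ i ∈ N', n < i) ∧ ∀ F : Finset ℕ, (F : Set ℕ) ⊆ N' →
      F.card ≤ k → ∀ w ∈ W, ∃ w' ∈ W, (∀ i ∈ T, |w' i - w i| ≤ ε) ∧ (∀ i ∈ F, |w' i - w i| ≤ ε) ∧
        |w' n| ≤ ε := by
  classical
  let idx : Finset ℕ → (T ⊕ Fin k) → ℕ := fun F => Sum.elim (fun t => t.1) (fun j => Nat.nth (· ∈ F) j)
  let pat : (ℕ → ℝ) → Finset ℕ → (T ⊕ Fin k) → ℤ := fun w F j => ⌊w (idx F j) / ε⌋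
  let P : Set ((T ⊕ Fin k) → ℤ) := Set.pi Set.univ (fun _ => Set.Icc ⌊-B / ε⌋ ⌊B / ε⌋)
  have hP : P.Finite := Set.Finite.pi' (fun _ => Set.finite_Icc _ _) |>.subset (by
    intro π hπ i; exact hπ i trivial)
  have hpatP : ∀ w ∈ W, ∀ F, pat w F ∈ P := by
    intro w hw F j _
    have := abs_le.1 (hB w hw (idx F j))
    exact ⟨Int.floor_le_floor (by gcongr; exact this.1), Int.floor_le_floor (by gcongr; exact this.2)⟩
  let c1 : Finset ℕ → Set ((T ⊕ Fin k) → ℤ) := fun s =>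
    {π | ∃ w ∈ W, pat w (s.erase (sInf (s : Set ℕ))) = π ∧ |w (sInf (s : Set ℕ))| ≤ ε}
  let c2 : Finset ℕ → Set ((T ⊕ Fin k) → ℤ) := fun s =>
    {π | ∃ w ∈ W, pat w (s.erase (sInf (s : Set ℕ))) = π}
  have hins : ∀ n (F : Finset ℕ), (∀ i ∈ F, n < i) →
      sInf ((insert n F : Finset ℕ) : Set ℕ) = n ∧ (insert n F).erase n = F := by
    intro n F h
    constructor
    · apply le_antisymm
      · exact Nat.sInf_le (by simp)
      · apply le_csInf ⟨n, by simp⟩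
        intro b hb
        simp at hb
        rcases hb with rfl | hb
        · exact le_rfl
        · exact (h b hb).le
    · apply Finset.erase_insert
      intro hn; exact lt_irrefl _ (h n hn)
  obtain ⟨M, hMN, hMinf, col, hcol⟩ := ram_aux (k+1) (fun s => (c1 s, c2 s))
    ((hP.finite_subsets.prod hP.finite_subsets).subset (by
      rintro _ ⟨s, rfl⟩
      constructor
      · rintro _ ⟨w, hw, rfl, _⟩; exact hpatP w hw _
      · rintro _ ⟨w, hw, rfl⟩; exact hpatP w hw _)) N hN
  have hnM : sInf M ∈ M := Nat.sInf_mem hMinf.nonempty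
  have hinfI : ∀ b, (M ∩ Set.Ioi b).Infinite := by
    intro b
    have : M \ Set.Iic b = M ∩ Set.Ioi b := by ext; simp
    rw [← this]
    exact hMinf.sdiff (Set.finite_Iic b)
  refine ⟨sInf M, hMN hnM, M ∩ Set.Ioi (sInf M), fun i hi => hMN hi.1, hinfI _, fun i hi => hi.2, ?_⟩
  intro F hF hFk w hw
  -- pad
  obtain ⟨F', hFF', hF'M, hF'k⟩ : ∃ F' : Finset ℕ, F ⊆ F' ∧ (F' : Set ℕ) ⊆ M ∩ Set.Ioi (sInf M) ∧
      F'.card = k := by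
    have h1 : ((M ∩ Set.Ioi (sInf M)) \ (F : Set ℕ)).Infinite := (hinfI _).sdiff F.finite_toSet
    obtain ⟨E, hE, hEc⟩ := h1.exists_subset_card_eq (k - F.card)
    refine ⟨F ∪ E, Finset.subset_union_left, ?_, ?_⟩
    · rw [Finset.coe_union]
      exact Set.union_subset hF (fun i hi => (hE hi).1)
    · rw [Finset.card_union_of_disjoint, hEc]
      · omega
      · rw [Finset.disjoint_right]
        intro i hi; exact (hE hi).2
  have e1 := hins (sInf M) F' (fun i hi => (hF'M hi).2)
  have key : ∀ n ∈ M, ∀ G : Finset ℕ, (G : Set ℕ) ⊆ M → (∀ i ∈ G, n < i) → G.card = k →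
      (c1 (insert n G), c2 (insert n G)) = col := by
    intro n hn G hG hlt hGk
    apply hcol
    · rw [Finset.coe_insert]
      exact Set.insert_subset hn hG
    · rw [Finset.card_insert_of_notMem, hGk]
      intro h; exact lt_irrefl _ (hlt n h)
  have k1 := key (sInf M) hnM F' (fun i hi => (hF'M hi).1) (fun i hi => (hF'M hi).2) hF'k
  have hp2 : pat w F' ∈ c2 (insert (sInf M) F') := ⟨w, hw, by rw [e1.1, e1.2]⟩
  have hp1 : pat w F' ∈ c1 (insert (sInf M) F') := by
    by_contra hnot
    let Cs : ℕ → Set (ℕ → ℝ) := fun b => W ∩ {v | ∀ n ∈ M, n < b → ε ≤ |v n|}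
    have hne : ∀ b, (Cs b).Nonempty := by
      intro b
      obtain ⟨G, hG, hGk⟩ := (hinfI (b + sInf M)).exists_subset_card_eq k
      have hGlt : ∀ i ∈ G, b + sInf M < i := fun i hi => (hG hi).2
      have k2 := key (sInf M) hnM G (fun i hi => (hG hi).1) (fun i hi => by have := hGlt i hi; omega) hGk
      have : pat w F' ∈ c2 (insert (sInf M) G) := by
        have := congrArg Prod.snd (k1.trans k2.symm)
        simp only at this
        rw [← this]; exact hp2
      obtain ⟨v, hv, hvp⟩ := this
      have e2 := hins (sInf M) G (fun i hi => by have := hGlt i hi; omega)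
      rw [e2.1, e2.2] at hvp
      refine ⟨v, hv, ?_⟩
      intro n hn hnb
      by_contra hlt
      apply hnot
      have hnG : ∀ i ∈ G, n < i := fun i hi => by have := hGlt i hi; omega
      have k3 := key n hn G (fun i hi => (hG hi).1) hnG hGk
      have := congrArg Prod.fst (k1.trans k3.symm)
      simp only at this
      rw [this]
      have e3 := hins n G hnG
      refine ⟨v, hv, ?_, ?_⟩
      · rw [e3.1, e3.2, hvp]
      · rw [e3.1]; exact (not_le.1 hlt).le
    have hcl : ∀ b, IsClosed {v : ℕ → ℝ | ∀ n ∈ M, n < b → ε ≤ |v n|} := by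
      intro b
      simp only [Set.ofPred_forall]
      refine isClosed_iInter fun n => isClosed_iInter fun _ => isClosed_iInter fun _ => ?_
      exact isClosed_le continuous_const (continuous_apply n).abs
    have hinter : (⋂ b, Cs b).Nonempty := by
      apply IsCompact.nonempty_iInter_of_sequence_nonempty_isCompact_isClosed Cs
      · intro b v hv
        exact ⟨hv.1, fun n hn hb => hv.2 n hn (by omega)⟩
      · exact hne
      · exact hW.inter_right (hcl 0)
      · intro b; exact (hW.isClosed).inter (hcl b)
    obtain ⟨v, hv⟩ := hinter
    rw [Set.mem_iInter] at hv
    have hvW := (hv 0).1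
    have := (hnull v hvW).abs
    rw [abs_zero] at this
    obtain ⟨n0, hn0⟩ := eventually_atTop.1 (this.eventually (gt_mem_nhds hε))
    obtain ⟨n, hnM', hnn⟩ := (hinfI n0).nonempty
    have h1 := hn0 n (le_of_lt hnn)
    have h2 := (hv (n+1)).2 n hnM' (by omega)
    linarith
  obtain ⟨w', hw', hpat, hsm⟩ := hp1
  rw [e1.1, e1.2] at hpat
  rw [e1.1] at hsm
  have hclose : ∀ j, |w' (idx F' j) - w (idx F' j)| ≤ ε := by
    intro j
    have h1 : ⌊w' (idx F' j) / ε⌋ = ⌊w (idx F' j) / ε⌋ := congrFun hpat j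
    have h2 := Int.abs_sub_lt_one_of_floor_eq_floor h1
    rw [← sub_div, abs_div, abs_of_pos hε, div_lt_one hε] at h2
    exact h2.le
  refine ⟨w', hw', ?_, ?_, hsm⟩
  · intro i hi
    exact hclose (Sum.inl ⟨i, hi⟩)
  · intro i hi
    have hfin : {x | x ∈ F'}.Finite := F'.finite_toSet
    obtain ⟨j, hj, hji⟩ := Nat.exists_lt_card_finite_nth_eq hfin (hFF' hi)
    have hjk : j < k := by
      have : hfin.toFinset = F' := by ext; simp
      rw [this, hF'k] at hj; exact hj
    have := hclose (Sum.inr ⟨j, hjk⟩)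
    simp only [idx, Sum.elim_inr] at this
    rw [hji] at this
    exact this

theorem sch_seq (W : Set (ℕ → ℝ)) (B : ℝ) (hB : ∀ w ∈ W, ∀ n, |w n| ≤ B) (hW : IsCompact W)
    (hnull : ∀ w ∈ W, Tendsto w atTop (𝓝 0)) (K : ℕ → ℕ) (hK : Monotone K) (Q : ℕ → ℕ)
    (ε : ℕ → ℝ) (hε : ∀ j, 0 < ε j) :
    ∃ φ : ℕ → ℕ, StrictMono φ ∧ (∀ j, Q j ≤ φ j) ∧ ∀ m (F : Finset ℕ), (∀ i ∈ F, m ≤ i) →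
      F.card ≤ K m → ∀ w ∈ W, ∀ d, ∃ w' ∈ W,
        (∀ i ∈ F, |w' (φ i) - w (φ i)| ≤ ∑ j ∈ Finset.Ico m d, ε j) ∧
        (∀ i, m ≤ i → i < d → i ∉ F → |w' (φ i)| ≤ ∑ j ∈ Finset.Ico i d, ε j) := by
  classical
  have step : ∀ (j : ℕ) (T : Finset ℕ) (M : {M : Set ℕ // M.Infinite}),
      ∃ n ∈ M.1, ∃ M' : {M : Set ℕ // M.Infinite}, Q j ≤ n ∧ M'.1 ⊆ M.1 ∧ (∀ i ∈ M'.1, n < i) ∧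
      ∀ F : Finset ℕ, (F : Set ℕ) ⊆ M'.1 →
      F.card ≤ K j → ∀ w ∈ W, ∃ w' ∈ W, (∀ i ∈ T, |w' i - w i| ≤ ε j) ∧
        (∀ i ∈ F, |w' i - w i| ≤ ε j) ∧ |w' n| ≤ ε j := by
    rintro j T ⟨M, hM⟩
    have h1 : (M ∩ Set.Ioi (Q j)).Infinite := by
      have : M \ Set.Iic (Q j) = M ∩ Set.Ioi (Q j) := by ext; simp
      rw [← this]
      exact hM.sdiff (Set.finite_Iic _)
    obtain ⟨n, hn, M', hM', hinf, hlt, hF⟩ := sch_step W B hB hW hnull T _ h1 (K j) (ε j) (hε j)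
    exact ⟨n, hn.1, ⟨M', hinf⟩, le_of_lt hn.2, fun i hi => (hM' hi).1, hlt, hF⟩
  choose n hn M' hQ hM' hlt hF using step
  let st : ℕ → Finset ℕ × {M : Set ℕ // M.Infinite} := fun j =>
    Nat.rec (∅, ⟨Set.univ, Set.infinite_univ⟩)
      (fun j p => (insert (n j p.1 p.2) p.1, M' j p.1 p.2)) j
  let φ : ℕ → ℕ := fun j => n j (st j).1 (st j).2
  have st1 : ∀ j, st (j+1) = (insert (φ j) (st j).1, M' j (st j).1 (st j).2) := fun j => rfl
  have anti : Antitone (fun j => (st j).2.1) :=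
    antitone_nat_of_succ_le (fun j => hM' j (st j).1 (st j).2)
  have hφ : ∀ i j, i < j → φ j ∈ (st (i+1)).2.1 :=
    fun i j hij => anti (Nat.succ_le_of_lt hij) (hn j (st j).1 (st j).2)
  have hmono : StrictMono φ := fun i j hij => hlt i (st i).1 (st i).2 _ (hφ i j hij)
  have hT : ∀ j i, i < j → φ i ∈ (st j).1 := by
    intro j
    induction j with
    | zero => intro i hi; omega
    | succ j ih =>
      intro i hi
      rw [st1]
      rcases Nat.lt_succ_iff_lt_or_eq.1 hi with h | rfl
      · exact Finset.mem_insert_of_mem (ih i h)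
      · exact Finset.mem_insert_self _ _
  refine ⟨φ, hmono, fun j => hQ j (st j).1 (st j).2, ?_⟩
  intro m F hFm hFc w hw d
  induction d with
  | zero =>
    refine ⟨w, hw, ?_, ?_⟩
    · intro i hi; simp
    · intro i _ hi; omega
  | succ d ih =>
    obtain ⟨w1, hw1, h1, h2⟩ := ih
    by_cases hd : d < m ∨ d ∈ F
    · refine ⟨w1, hw1, ?_, ?_⟩
      · intro i hi
        refine (h1 i hi).trans ?_
        exact Finset.sum_le_sum_of_subset_of_nonneg
          (Finset.Ico_subset_Ico le_rfl (by omega)) (fun j _ _ => (hε j).le)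
      · intro i hmi hid hiF
        have : i ≠ d := by
          rintro rfl
          rcases hd with h | h
          · omega
          · exact hiF h
        refine (h2 i hmi (by omega) hiF).trans ?_
        exact Finset.sum_le_sum_of_subset_of_nonneg
          (Finset.Ico_subset_Ico le_rfl (by omega)) (fun j _ _ => (hε j).le)
    · push Not at hd
      obtain ⟨w2, hw2, h3, h4, h5⟩ := hF d (st d).1 (st d).2 ((F.filter (fun i => d < i)).image φ)
        (by
          intro i hi
          simp only [Finset.coe_image, Set.mem_image, Finset.mem_coe, Finset.mem_filter] at hi
          obtain ⟨i', ⟨_, hi'⟩, rfl⟩ := hi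
          exact hφ d i' hi')
        (Finset.card_image_le.trans ((Finset.card_filter_le _ _).trans (hFc.trans (hK hd.1)))) w1 hw1
      refine ⟨w2, hw2, ?_, ?_⟩
      · intro i hi
        rw [Finset.sum_Ico_succ_top hd.1]
        have h6 : |w2 (φ i) - w1 (φ i)| ≤ ε d := by
          rcases lt_trichotomy i d with h | h | h
          · exact h3 _ (hT d i h)
          · exact absurd (h ▸ hi) hd.2
          · exact h4 _ (Finset.mem_image_of_mem _ (Finset.mem_filter.2 ⟨hi, h⟩))
        have h7 := h1 i hi
        have := abs_sub_le (w2 (φ i)) (w1 (φ i)) (w (φ i))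
        linarith
      · intro i hmi hid hiF
        rw [Finset.sum_Ico_succ_top (by omega)]
        rcases Nat.lt_succ_iff_lt_or_eq.1 hid with h | rfl
        · have h6 := h3 _ (hT d i h)
          have h7 := h2 i hmi h hiF
          have := abs_sub_abs_le_abs_sub (w2 (φ i)) (w1 (φ i))
          linarith
        · simpa using h5

theorem basic_sub {X : Type*} [NormedAddCommGroup X] [NormedSpace ℝ X] (x : ℕ → X) (K : ℝ)
    (hK : ∀ (a : ℕ → ℝ) (m n : ℕ), m ≤ n →
      ‖∑ i ∈ Finset.range m, a i • x i‖ ≤ K * ‖∑ i ∈ Finset.range n, a i • x i‖)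
    (φ : ℕ → ℕ) (hφ : StrictMono φ) (a : ℕ → ℝ) (s : Finset ℕ) (m : ℕ) :
    ‖∑ i ∈ s.filter (fun i => i < m), a i • x (φ i)‖ ≤ K * ‖∑ i ∈ s, a i • x (φ i)‖ := by
  classical
  have key : ∀ m, ∑ j ∈ Finset.range (φ m), (∑ i ∈ s, if φ i = j then a i else 0) • x j
      = ∑ i ∈ s.filter (fun i => i < m), a i • x (φ i) := by
    intro m
    simp_rw [Finset.sum_smul]
    rw [Finset.sum_comm, Finset.sum_filter]
    apply Finset.sum_congr rfl
    intro i _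
    simp only [ite_smul, zero_smul]
    rw [Finset.sum_ite_eq]
    simp [hφ.lt_iff_lt]
  obtain ⟨n, hn⟩ : ∃ n, m ≤ n ∧ ∀ i ∈ s, i < n := by
    refine ⟨m + s.sup id + 1, by omega, fun i hi => ?_⟩
    have : i ≤ s.sup id := Finset.le_sup (f := id) hi
    omega
  have h := hK (fun j => ∑ i ∈ s, if φ i = j then a i else 0) (φ m) (φ n) (hφ.monotone hn.1)
  rw [key, key, Finset.filter_true_of_mem hn.2] at h
  exact h

theorem basic_coef {X : Type*} [NormedAddCommGroup X] [NormedSpace ℝ X] (x : ℕ → X) (K : ℝ)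
    (hK : ∀ (a : ℕ → ℝ) (m n : ℕ), m ≤ n →
      ‖∑ i ∈ Finset.range m, a i • x i‖ ≤ K * ‖∑ i ∈ Finset.range n, a i • x i‖)
    (c0 : ℝ) (hc0 : 0 < c0) (hx : ∀ n, c0 ≤ ‖x n‖)
    (φ : ℕ → ℕ) (hφ : StrictMono φ) (a : ℕ → ℝ) (s : Finset ℕ) (i : ℕ) (hi : i ∈ s) :
    |a i| ≤ 2 * K / c0 * ‖∑ i ∈ s, a i • x (φ i)‖ := by
  have h1 := basic_sub x K hK φ hφ a s i
  have h2 := basic_sub x K hK φ hφ a s (i+1)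
  have e : s.filter (fun j => j < i + 1) = insert i (s.filter (fun j => j < i)) := by
    ext j
    simp only [Finset.mem_filter, Finset.mem_insert]
    constructor
    · rintro ⟨h, h'⟩
      rcases Nat.lt_succ_iff_lt_or_eq.1 h' with hh2 | hh2
      · exact Or.inr ⟨h, hh2⟩
      · exact Or.inl hh2
    · rintro (rfl | h)
      · exact ⟨hi, by omega⟩
      · exact ⟨h.1, by omega⟩
  rw [e, Finset.sum_insert (by simp)] at h2
  have h3 : ‖a i • x (φ i)‖ ≤ 2 * K * ‖∑ i ∈ s, a i • x (φ i)‖ := by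
    have := norm_sub_le (a i • x (φ i) + ∑ j ∈ s.filter (fun j => j < i), a j • x (φ j))
      (∑ j ∈ s.filter (fun j => j < i), a j • x (φ j))
    rw [add_sub_cancel_right] at this
    linarith
  rw [norm_smul, Real.norm_eq_abs] at h3
  have h4 : |a i| * c0 ≤ |a i| * ‖x (φ i)‖ := by gcongr; exact hx _
  rw [div_mul_eq_mul_div, le_div_iff₀ hc0]
  linarith

theorem geo_Ico (m n : ℕ) : ∑ j ∈ Finset.Ico m n, ((1:ℝ)/2)^j ≤ 2 * (1/2)^m := by
  have := geom_sum_Ico_le_of_lt_one (x := (1:ℝ)/2) (by norm_num) (by norm_num) (m := m) (n := n)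
  refine this.trans (le_of_eq ?_)
  ring

theorem schreier {X : Type*} [NormedAddCommGroup X] [NormedSpace ℝ X] (x : ℕ → X) (Kb : ℝ)
    (hKb : ∀ (a : ℕ → ℝ) (m n : ℕ), m ≤ n →
      ‖∑ i ∈ Finset.range m, a i • x i‖ ≤ Kb * ‖∑ i ∈ Finset.range n, a i • x i‖)
    (hKb0 : 0 ≤ Kb)
    (c0 B : ℝ) (hc0 : 0 < c0) (hx : ∀ n, c0 ≤ ‖x n‖) (hxB : ∀ n, ‖x n‖ ≤ B)
    (hxw : ∀ φ : X →L[ℝ] ℝ, Tendsto (fun n => φ (x n)) atTop (𝓝 0))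
    (K : ℕ → ℕ) (hK : Monotone K) (Q : ℕ → ℕ) :
    ∃ φ : ℕ → ℕ, StrictMono φ ∧ (∀ j, Q j ≤ φ j) ∧ ∀ m (F : Finset ℕ), (∀ i ∈ F, m ≤ i) →
      F.card ≤ K m → ∀ (a : ℕ → ℝ) (s : Finset ℕ), F ⊆ s →
      ‖∑ i ∈ F, a i • x (φ i)‖ ≤ (1 + Kb + 6 * (2 * Kb / c0)) * ‖∑ i ∈ s, a i • x (φ i)‖ := by
  classical
  let ev : WeakDual ℝ X → (ℕ → ℝ) := fun f n => f (x n)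
  have hev : Continuous ev := continuous_pi fun n => WeakDual.eval_continuous (x n)
  let S : Set (WeakDual ℝ X) := Set.preimage WeakDual.toStrongDual (Metric.closedBall 0 1)
  have hS : IsCompact S := WeakDual.isCompact_closedBall 0 1
  have hSmem : ∀ f : X →L[ℝ] ℝ, ‖f‖ ≤ 1 → (fun n => f (x n)) ∈ Set.image ev S := by
    intro f hf
    refine ⟨StrongDual.toWeakDual f, ?_, rfl⟩
    simp only [S, Set.mem_preimage, Metric.mem_closedBall, dist_zero_right]
    exact hf
  have hSout : ∀ w ∈ Set.image ev S, ∃ f : X →L[ℝ] ℝ, ‖f‖ ≤ 1 ∧ ∀ n, w n = f (x n) := by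
    rintro _ ⟨f, hf, rfl⟩
    simp only [S, Set.mem_preimage, Metric.mem_closedBall, dist_zero_right] at hf
    exact ⟨WeakDual.toStrongDual f, hf, fun n => rfl⟩
  let ε : ℕ → ℝ := fun j => (1/2)^j / (K j + 1)
  have hε : ∀ j, 0 < ε j := fun j => by positivity
  have hεle : ∀ j, ε j ≤ (1/2)^j := fun j =>
    div_le_self (by positivity) (by have : (0:ℝ) ≤ K j := by positivity
                                    linarith)
  obtain ⟨φ, hφ, hQ, hmain⟩ := sch_seq (Set.image ev S) B
    (by
      intro w hw n
      obtain ⟨f, hf, h⟩ := hSout w hw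
      rw [h, ← Real.norm_eq_abs]
      exact (f.le_of_opNorm_le hf _).trans (by rw [one_mul]; exact hxB n))
    (hS.image hev)
    (by
      intro w hw
      obtain ⟨f, hf, h⟩ := hSout w hw
      have : w = fun n => f (x n) := funext h
      rw [this]; exact hxw f) K hK Q ε hε
  refine ⟨φ, hφ, hQ, ?_⟩
  intro m F hFm hFc a s hFs
  set α := 2 * Kb / c0 * ‖∑ i ∈ s, a i • x (φ i)‖ with hα
  have hα0 : 0 ≤ α := by positivity
  have hcoef : ∀ i ∈ s, |a i| ≤ α := fun i hi => basic_coef x Kb hKb c0 hc0 hx φ hφ a s i hi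
  obtain ⟨f, hf1, hf2⟩ := exists_dual_vector'' ℝ (∑ i ∈ F, a i • x (φ i))
  obtain ⟨d, hd⟩ : ∃ d, ∀ i ∈ s, i < d := by
    refine ⟨s.sup id + 1, fun i hi => ?_⟩
    have : i ≤ s.sup id := Finset.le_sup (f := id) hi
    omega
  obtain ⟨w', hw', h1, h2⟩ := hmain m F hFm hFc _ (hSmem f hf1) d
  obtain ⟨g, hg, hgw⟩ := hSout w' hw'
  set s2 := s.filter (fun i => ¬ i < m) with hs2
  have hsplit := Finset.sum_filter_add_sum_filter_not s (fun i => i < m) (fun i => a i • x (φ i))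
  have htail : ‖∑ i ∈ s2, a i • x (φ i)‖ ≤ (1 + Kb) * ‖∑ i ∈ s, a i • x (φ i)‖ := by
    have h3 := basic_sub x Kb hKb φ hφ a s m
    have h4 := norm_sub_le (∑ i ∈ s, a i • x (φ i)) (∑ i ∈ s.filter (fun i => i < m), a i • x (φ i))
    rw [← hsplit, add_sub_cancel_left, hsplit] at h4
    linarith
  have hFs2 : F ⊆ s2 := fun i hi => Finset.mem_filter.2 ⟨hFs hi, by have := hFm i hi; omega⟩
  have hgs2 : g (∑ i ∈ s2, a i • x (φ i)) ≤ ‖∑ i ∈ s2, a i • x (φ i)‖ := by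
    have := g.le_of_opNorm_le hg (∑ i ∈ s2, a i • x (φ i))
    rw [one_mul] at this
    exact (le_abs_self _).trans this
  have hsum : g (∑ i ∈ s2, a i • x (φ i)) = ∑ i ∈ s2 \ F, a i * w' (φ i) + ∑ i ∈ F, a i * w' (φ i) := by
    rw [Finset.sum_sdiff hFs2, map_sum]
    simp [hgw]
  have hfsum : ‖∑ i ∈ F, a i • x (φ i)‖ = ∑ i ∈ F, a i * f (x (φ i)) := by
    have : f (∑ i ∈ F, a i • x (φ i)) = ∑ i ∈ F, a i * f (x (φ i)) := by
      rw [map_sum]; simp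
    rw [← this, hf2]; rfl
  have hE1 : ∑ i ∈ F, a i * f (x (φ i)) - ∑ i ∈ F, a i * w' (φ i) ≤ 2 * α := by
    rw [← Finset.sum_sub_distrib]
    have hδ : ∑ j ∈ Finset.Ico m d, ε j ≤ 2 / (K m + 1) := by
      calc ∑ j ∈ Finset.Ico m d, ε j ≤ ∑ j ∈ Finset.Ico m d, (1/2)^j * (1 / ((K m : ℝ) + 1)) := by
            apply Finset.sum_le_sum
            intro j hj
            have : (K m : ℝ) ≤ K j := by exact_mod_cast hK (Finset.mem_Ico.1 hj).1
            rw [mul_one_div]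
            simp only [ε]
            gcongr
        _ = (∑ j ∈ Finset.Ico m d, ((1:ℝ)/2)^j) * (1 / ((K m : ℝ) + 1)) := by rw [Finset.sum_mul]
        _ ≤ 2 * (1 / ((K m : ℝ) + 1)) := by
            gcongr
            refine (geo_Ico m d).trans ?_
            have : ((1:ℝ)/2)^m ≤ 1 := pow_le_one₀ (by norm_num) (by norm_num)
            linarith
        _ = _ := by ring
    calc ∑ i ∈ F, (a i * f (x (φ i)) - a i * w' (φ i)) ≤ ∑ i ∈ F, α * (2 / (K m + 1)) := by
          apply Finset.sum_le_sum
          intro i hi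
          have h3 := (h1 i hi).trans hδ
          rw [abs_sub_comm] at h3
          rw [← mul_sub]
          refine (le_abs_self _).trans ?_
          rw [abs_mul]
          exact mul_le_mul (hcoef i (hFs hi)) h3 (abs_nonneg _) hα0
      _ = F.card * (α * (2 / (K m + 1))) := by rw [Finset.sum_const, nsmul_eq_mul]
      _ ≤ (K m + 1) * (α * (2 / (K m + 1))) := by
          have : (F.card : ℝ) ≤ K m + 1 := by
            have : (F.card : ℝ) ≤ K m := by exact_mod_cast hFc
            linarith
          gcongr
      _ = 2 * α := by field_simp
  have hE2 : - ∑ i ∈ s2 \ F, a i * w' (φ i) ≤ 4 * α := by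
    rw [← Finset.sum_neg_distrib]
    calc ∑ i ∈ s2 \ F, -(a i * w' (φ i)) ≤ ∑ i ∈ s2 \ F, α * (2 * (1/2)^i) := by
          apply Finset.sum_le_sum
          intro i hi
          rw [Finset.mem_sdiff, Finset.mem_filter] at hi
          have h3 : |w' (φ i)| ≤ 2 * (1/2)^i := by
            refine (h2 i (by omega) (hd i hi.1.1) hi.2).trans ?_
            refine le_trans (Finset.sum_le_sum (fun j _ => hεle j)) (geo_Ico i d)
          refine (neg_le_abs _).trans ?_
          rw [abs_mul]
          exact mul_le_mul (hcoef i hi.1.1) h3 (abs_nonneg _) hα0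
      _ ≤ ∑ i ∈ Finset.Ico 0 d, α * (2 * (1/2)^i) := by
          apply Finset.sum_le_sum_of_subset_of_nonneg
          · intro i hi
            rw [Finset.mem_sdiff, Finset.mem_filter] at hi
            simpa using hd i hi.1.1
          · intro i _ _; positivity
      _ = α * (2 * ∑ i ∈ Finset.Ico 0 d, ((1:ℝ)/2)^i) := by
          rw [Finset.mul_sum, Finset.mul_sum]
      _ ≤ α * (2 * (2 * (1/2)^0)) := by
          gcongr; exact geo_Ico 0 d
      _ = 4 * α := by ring
  have : (1 + Kb + 6 * (2 * Kb / c0)) * ‖∑ i ∈ s, a i • x (φ i)‖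
      = (1 + Kb) * ‖∑ i ∈ s, a i • x (φ i)‖ + 6 * α := by rw [hα]; ring
  rw [this]
  linarith

theorem unif_spread {X E : Type*} [NormedAddCommGroup X] [NormedSpace ℝ X]
    [NormedAddCommGroup E] [NormedSpace ℝ E] (x : ℕ → X) (xt : ℕ → E)
    (h : HasSpreadingModel x xt) (B : ℝ) (hB0 : 0 ≤ B) (hB : ∀ n, ‖x n‖ ≤ B) (D : ℝ) (k : ℕ)
    (ε : ℝ) (hε : 0 < ε) :
    ∃ N : ℕ, ∀ a : Fin k → ℝ, (∀ i, |a i| ≤ D) → ∀ n : Fin k → ℕ, StrictMono n → (∀ i, N ≤ n i) →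
      |‖∑ i, a i • x (n i)‖ - ‖∑ i, a i • xt i‖| ≤ ε := by
  classical
  set B' : ℝ := B + ∑ i : Fin k, ‖xt i‖ with hB'
  have hs0 : 0 ≤ ∑ i : Fin k, ‖xt i‖ := Finset.sum_nonneg fun _ _ => norm_nonneg _
  have hB'0 : 0 ≤ B' := by positivity
  have hxB' : ∀ n, ‖x n‖ ≤ B' := fun n => (hB n).trans (by linarith)
  have hxtB' : ∀ i : Fin k, ‖xt i‖ ≤ B' := fun i => by
    have := Finset.single_le_sum (f := fun i : Fin k => ‖xt i‖) (fun _ _ => norm_nonneg _)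
      (Finset.mem_univ i)
    linarith
  have lip : ∀ {Z : Type _} [NormedAddCommGroup Z] [NormedSpace ℝ Z] (z : Fin k → Z),
      (∀ i, ‖z i‖ ≤ B') → ∀ a b : Fin k → ℝ, ∀ η : ℝ, (∀ i, |a i - b i| ≤ η) →
      |‖∑ i, a i • z i‖ - ‖∑ i, b i • z i‖| ≤ k * (η * B') := by
    intro Z _ _ z hz a b η hab
    refine (abs_norm_sub_norm_le _ _).trans ?_
    rw [← Finset.sum_sub_distrib]
    refine (norm_sum_le _ _).trans ?_
    calc ∑ i, ‖a i • z i - b i • z i‖ ≤ ∑ i : Fin k, η * B' := by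
          apply Finset.sum_le_sum
          intro i _
          rw [← sub_smul, norm_smul, Real.norm_eq_abs]
          exact mul_le_mul (hab i) (hz i) (norm_nonneg _) ((abs_nonneg _).trans (hab i))
      _ = _ := by simp
  have lipX : ∀ (z : Fin k → X),
      (∀ i, ‖z i‖ ≤ B') → ∀ a b : Fin k → ℝ, ∀ η : ℝ, (∀ i, |a i - b i| ≤ η) →
      |‖∑ i, a i • z i‖ - ‖∑ i, b i • z i‖| ≤ k * (η * B') := by
    intro z hz a b η hab
    refine (abs_norm_sub_norm_le _ _).trans ?_
    rw [← Finset.sum_sub_distrib]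
    refine (norm_sum_le _ _).trans ?_
    calc ∑ i, ‖a i • z i - b i • z i‖ ≤ ∑ i : Fin k, η * B' := by
          apply Finset.sum_le_sum
          intro i _
          rw [← sub_smul, norm_smul, Real.norm_eq_abs]
          exact mul_le_mul (hab i) (hz i) (norm_nonneg _) ((abs_nonneg _).trans (hab i))
      _ = _ := by simp
  set η : ℝ := ε / (3 * (k * B' + 1)) with hη
  have hη0 : 0 < η := by positivity
  have hηk : k * (η * B') ≤ ε / 3 := by
    rw [hη, show (k:ℝ) * (ε / (3 * (k * B' + 1)) * B') = (ε / 3) * ((k * B') / (k * B' + 1)) by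
      field_simp]
    have : (k * B') / (k * B' + 1) ≤ 1 := by
      rw [div_le_one (by positivity)]; linarith
    nlinarith
  have hQ : IsCompact (Set.pi Set.univ (fun _ : Fin k => Set.Icc (-D) D)) :=
    isCompact_univ_pi fun _ => isCompact_Icc
  obtain ⟨t, htQ, htf, hcov⟩ := finite_cover_balls_of_compact hQ hη0
  choose Nb hNb using fun b : Fin k → ℝ => h k b (ε/3) (by positivity)
  refine ⟨htf.toFinset.sup Nb, ?_⟩
  intro a ha n hn hNn
  have haQ : a ∈ Set.pi Set.univ (fun _ : Fin k => Set.Icc (-D) D) := fun i _ => abs_le.1 (ha i)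
  obtain ⟨b, hb, hab⟩ := Set.mem_iUnion₂.1 (hcov haQ)
  have hab' : ∀ i, |a i - b i| ≤ η := fun i => by
    have := (dist_le_pi_dist a b i).trans (Metric.mem_ball.1 hab).le
    rwa [Real.dist_eq] at this
  have h1 := hNb b n hn (fun i => (Finset.le_sup (htf.mem_toFinset.2 hb)).trans (hNn i))
  have h2 := lipX (fun i => x (n i)) (fun i => hxB' _) a b η hab'
  have h3 := lip (fun i : Fin k => xt i) hxtB' a b η hab'
  rw [abs_le] at *
  constructor <;> linarith [h1.1, h1.2, h2.1, h2.2, h3.1, h3.2]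

/-- relabeling of `a` restricted to `A` as a finitely supported sequence. -/
noncomputable def restr (A : Finset ℕ) (a : ℕ → ℝ) : ℕ →₀ ℝ :=
  Finsupp.onFinset (Finset.range A.card)
    (fun j => if h : j < A.card then a (A.orderEmbOfFin rfl ⟨j, h⟩) else 0)
    (by intro j hj; by_contra h; simp at h; simp [not_lt.2 h] at hj)

theorem restr_apply (A : Finset ℕ) (a : ℕ → ℝ) (j : Fin A.card) :
    restr A a j = a (A.orderEmbOfFin rfl j) := by
  simp [restr]

theorem restr_abs (A : Finset ℕ) (a : ℕ → ℝ) (τ : ℝ) (hτ : 0 ≤ τ) (h : ∀ i ∈ A, |a i| ≤ τ) (j : ℕ) :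
    |restr A a j| ≤ τ := by
  by_cases hj : j < A.card
  · have := restr_apply A a ⟨j, hj⟩
    simp only at this
    rw [this]
    exact h _ (Finset.orderEmbOfFin_mem _ _ _)
  · simp [restr, hj, hτ]

theorem restr_sum {E : Type*} [NormedAddCommGroup E] [NormedSpace ℝ E] (A : Finset ℕ) (a : ℕ → ℝ)
    (xt : ℕ → E) : ∑ n ∈ (restr A a).support, restr A a n • xt n
      = ∑ i : Fin A.card, a (A.orderEmbOfFin rfl i) • xt i := by
  have hsub : (restr A a).support ⊆ Finset.range A.card := Finsupp.support_onFinset_subset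
  rw [Finset.sum_subset hsub, Finset.sum_range]
  · simp_rw [restr_apply]
  · intro j _ hj
    rw [Finsupp.notMem_support_iff.1 hj, zero_smul]

theorem sum_enum {E : Type*} [AddCommMonoid E] (A : Finset ℕ) (F : ℕ → E) :
    ∑ i : Fin A.card, F (A.orderEmbOfFin rfl i) = ∑ i ∈ A, F i := by
  rw [← Finset.sum_coe_sort A]
  exact Fintype.sum_equiv (A.orderIsoOfFin rfl).toEquiv _ _ (fun i => rfl)

theorem unif_spread' {X E : Type*} [NormedAddCommGroup X] [NormedSpace ℝ X]
    [NormedAddCommGroup E] [NormedSpace ℝ E] (x : ℕ → X) (xt : ℕ → E)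
    (h : HasSpreadingModel x xt) (B : ℝ) (hB0 : 0 ≤ B) (hB : ∀ n, ‖x n‖ ≤ B) (D : ℝ) (k : ℕ)
    (ε : ℝ) (hε : 0 < ε) :
    ∃ N : ℕ, ∀ (A : Finset ℕ) (a : ℕ → ℝ) (φ : ℕ → ℕ), A.card ≤ k → (∀ i ∈ A, |a i| ≤ D) →
      StrictMono φ → (∀ i ∈ A, N ≤ φ i) →
      |‖∑ i ∈ A, a i • x (φ i)‖ - ‖∑ n ∈ (restr A a).support, restr A a n • xt n‖| ≤ ε := by
  choose N hN using fun k => unif_spread x xt h B hB0 hB D k ε hε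
  refine ⟨(Finset.range (k+1)).sup N, ?_⟩
  intro A a φ hA ha hφ hNφ
  rw [restr_sum, ← sum_enum A (fun i => a i • x (φ i))]
  apply hN A.card (fun i => a (A.orderEmbOfFin rfl i)) (fun i => ha _ (Finset.orderEmbOfFin_mem _ _ _))
    (fun i => φ (A.orderEmbOfFin rfl i))
  · exact hφ.comp (A.orderEmbOfFin rfl).strictMono
  · intro i
    exact (Finset.le_sup (Finset.mem_range.2 (by omega))).trans
      (hNφ _ (Finset.orderEmbOfFin_mem _ _ _))

theorem flog_nat_one_le (l : ℕ) (hl : 1 ≤ l) : 1 ≤ flog (l : ℝ) := by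
  unfold flog
  rw [Real.le_logb_iff_rpow_le (by norm_num) (by positivity), Real.rpow_one]
  have : (1:ℝ) ≤ l := by exact_mod_cast hl
  linarith

theorem flog_nat_nonneg (l : ℕ) : 0 ≤ flog (l : ℝ) :=
  Real.logb_nonneg (by norm_num) (by have : (0:ℝ) ≤ l := by positivity
                                     linarith)

theorem sum_le_gnorm (p : ℝ) (hp : 0 < p) (b : ℕ →₀ ℝ) (s : Finset ℕ) :
    ∑ i ∈ s, |b i| ≤ flog (s.card : ℝ) ^ p * gnorm (fun l => flog l ^ p) b := by
  classical
  rcases s.eq_empty_or_nonempty with rfl | hs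
  · have : flog ((0:ℕ):ℝ) = 0 := by simp [flog]
    simp only [Finset.sum_empty, Finset.card_empty]
    rw [this, Real.zero_rpow hp.ne', zero_mul]
  · have h1 : 1 ≤ flog (s.card : ℝ) ^ p :=
      Real.one_le_rpow (flog_nat_one_le _ (Finset.card_pos.2 hs)) hp.le
    have hbdd : BddAbove {r : ℝ | ∃ s : Finset ℕ, s.Nonempty ∧
        r = (1 / (fun l : ℕ => flog l ^ p) s.card) * ∑ i ∈ s, |b i|} := by
      refine ⟨∑ i ∈ b.support, |b i|, ?_⟩
      rintro _ ⟨u, hu, rfl⟩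
      have h2 : 1 ≤ flog (u.card : ℝ) ^ p :=
        Real.one_le_rpow (flog_nat_one_le _ (Finset.card_pos.2 hu)) hp.le
      have h3 : ∑ i ∈ u, |b i| ≤ ∑ i ∈ b.support, |b i| := by
        rw [← Finset.sum_filter_add_sum_filter_not u (fun i => i ∈ b.support)]
        have : ∑ i ∈ u.filter (fun i => ¬ i ∈ b.support), |b i| = 0 := by
          apply Finset.sum_eq_zero
          intro i hi
          rw [Finsupp.notMem_support_iff.1 (Finset.mem_filter.1 hi).2, abs_zero]
        rw [this, add_zero]
        apply Finset.sum_le_sum_of_subset_of_nonneg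
        · intro i hi; exact (Finset.mem_filter.1 hi).2
        · intro i _ _; exact abs_nonneg _
      simp only
      have h4 : 0 ≤ ∑ i ∈ u, |b i| := Finset.sum_nonneg fun _ _ => abs_nonneg _
      have h5 : 1 / flog (u.card : ℝ) ^ p ≤ 1 := by
        rw [div_le_one (by linarith)]; exact h2
      calc 1 / flog (u.card : ℝ) ^ p * ∑ i ∈ u, |b i| ≤ 1 * ∑ i ∈ u, |b i| := by gcongr
        _ ≤ _ := by rw [one_mul]; exact h3
    have h6 := le_csSup hbdd ⟨s, hs, rfl⟩
    simp only at h6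
    change _ ≤ gnorm (fun l => flog l ^ p) b at h6
    rw [one_div_mul_eq_div, div_le_iff₀ (by linarith)] at h6
    linarith

theorem sort_exists (b : ℕ →₀ ℝ) : ∃ σ : Fin b.support.card → ℕ, Function.Injective σ ∧
    (∀ i ∈ b.support, ∃ j, σ j = i) ∧ ∀ i j, i ≤ j → |b (σ j)| ≤ |b (σ i)| := by
  let e : Fin b.support.card ≃ b.support := b.support.equivFin.symm
  let f : Fin b.support.card → ℝ := fun i => - |b (e i)|
  refine ⟨fun i => e (Tuple.sort f i), ?_, ?_, ?_⟩
  · intro i j hij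
    exact (Tuple.sort f).injective (e.injective (Subtype.ext hij))
  · intro i hi
    exact ⟨(Tuple.sort f).symm (e.symm ⟨i, hi⟩), by simp⟩
  · intro i j hij
    have := Tuple.monotone_sort f hij
    simp only [f, Function.comp] at this
    linarith

theorem drear_le (b : ℕ →₀ ℝ) (σ : Fin b.support.card → ℕ)
    (h2 : ∀ i ∈ b.support, ∃ j, σ j = i) (h3 : ∀ i j, i ≤ j → |b (σ j)| ≤ |b (σ i)|)
    (j : Fin b.support.card) : drear b (j + 1) ≤ |b (σ j)| := by
  classical
  apply Real.sSup_le _ (abs_nonneg _)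
  rintro t ⟨_, ht⟩
  by_contra hlt
  push Not at hlt
  have hsub : (b.support.filter fun i => t ≤ |b i|) ⊆ (Finset.Iio j).image σ := by
    intro i hi
    rw [Finset.mem_filter] at hi
    obtain ⟨k, rfl⟩ := h2 i hi.1
    apply Finset.mem_image_of_mem
    rw [Finset.mem_Iio]
    by_contra hk
    have := h3 j k (not_lt.1 hk)
    linarith [hi.2]
  have := (Finset.card_le_card hsub).trans Finset.card_image_le
  rw [Fin.card_Iio] at this
  omega

theorem tnorm_le (p q : ℝ) (hp : 0 < p) (hpq : p < q) (b : ℕ →₀ ℝ) (τ G : ℝ) (hτ0 : 0 ≤ τ) (hG0 : 0 ≤ G)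
    (hτ : ∀ j, |b j| ≤ τ) (hG : gnorm (fun l => flog l ^ p) b ≤ G) (I : ℕ) :
    tnorm (fun l => flog l ^ q) b ≤
      (2:ℝ)^(2^I) * τ + G * 2^p * (((2:ℝ)^(p-q))^I / (1 - (2:ℝ)^(p-q))) := by
  classical
  have hq : 0 < q := hp.trans hpq
  set n := b.support.card with hn
  obtain ⟨σ, hσ, h2, h3⟩ : ∃ σ : Fin n → ℕ, Function.Injective σ ∧
    (∀ i ∈ b.support, ∃ j, σ j = i) ∧ ∀ i j, i ≤ j → |b (σ j)| ≤ |b (σ i)| := sort_exists b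
  let u : Fin n → ℝ := fun j => |b (σ j)| / flog (((j:ℕ)+1 : ℕ) : ℝ) ^ q
  have hone : ∀ j : ℕ, 1 ≤ flog ((j + 1 : ℕ) : ℝ) ^ q := fun j =>
    Real.one_le_rpow (flog_nat_one_le _ (by omega)) hq.le
  have hu0 : ∀ j, 0 ≤ u j := fun j => div_nonneg (abs_nonneg _) (by linarith [hone j])
  have ht : tnorm (fun l => flog l ^ q) b ≤ ∑ j : Fin n, u j := by
    unfold tnorm
    rw [Finset.sum_range]
    apply Finset.sum_le_sum
    intro j _
    have := drear_le b σ h2 h3 j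
    have h1 := hone j
    simp only [u]
    gcongr
  let lev : Fin n → ℕ := fun j => Nat.log 2 (Nat.log 2 (j + 2))
  have hlog1 : ∀ j : ℕ, Nat.log 2 (j + 2) ≠ 0 := fun j =>
    (Nat.log_pos (by norm_num) (by omega)).ne'
  have hlow : ∀ j : Fin n, (2:ℝ)^(lev j) ≤ flog (((j:ℕ)+1 : ℕ) : ℝ) := by
    intro j
    have h4 : 2 ^ lev j ≤ Nat.log 2 (j + 2) := Nat.pow_log_le_self 2 (hlog1 j)
    have h5 := Real.natLog_le_logb (j + 2) 2
    have h6 : (2:ℝ)^(lev j) ≤ (Nat.log 2 (j + 2) : ℝ) := by exact_mod_cast h4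
    unfold flog
    refine h6.trans (h5.trans (le_of_eq ?_))
    push_cast
    congr 1
    ring
  have hhigh : ∀ j : Fin n, (j:ℕ) + 2 < 2^(2^(lev j + 1)) := by
    intro j
    have h4 : Nat.log 2 (j + 2) < 2^(lev j + 1) := Nat.lt_pow_succ_log_self (by norm_num) _
    have h5 : (j:ℕ) + 2 < 2^(Nat.log 2 (j + 2) + 1) := Nat.lt_pow_succ_log_self (by norm_num) _
    exact h5.trans_le (Nat.pow_le_pow_right (by norm_num) h4)
  have hcardle : ∀ (J : Finset (Fin n)) (m : ℕ), (∀ j ∈ J, (j:ℕ) + 2 < 2^(2^m)) → J.card + 1 ≤ 2^(2^m) := by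
    intro J m hJ
    have : (J.map Fin.valEmbedding) ⊆ Finset.range (2^(2^m) - 1) := by
      intro i hi
      rw [Finset.mem_map] at hi
      obtain ⟨j, hj, rfl⟩ := hi
      have := hJ j hj
      simp only [Fin.valEmbedding_apply, Finset.mem_range]
      omega
    have h4 := Finset.card_le_card this
    rw [Finset.card_map, Finset.card_range] at h4
    have : 0 < 2^(2^m) := by positivity
    omega
  have hblock : ∀ i, ∑ j ∈ Finset.univ.filter (fun j => lev j = i), u j ≤
      G * 2^p * ((2:ℝ)^(p-q))^i := by
    intro i
    set J := Finset.univ.filter (fun j => lev j = i) with hJ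
    have hJc := hcardle J (i+1) (fun j hj => by
      have h4 := hhigh j
      rw [hJ, Finset.mem_filter] at hj
      rwa [hj.2] at h4)
    have hS : ∑ j ∈ J, |b (σ j)| ≤ ((2:ℝ)^(i+1))^p * G := by
      have h4 := sum_le_gnorm p hp b (J.map ⟨σ, hσ⟩)
      rw [Finset.sum_map, Finset.card_map] at h4
      simp only [Function.Embedding.coeFn_mk] at h4
      refine h4.trans ?_
      have h5 : flog (J.card : ℝ) ≤ (2:ℝ)^(i+1) := by
        unfold flog
        rw [Real.logb_le_iff_le_rpow (by norm_num) (by positivity)]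
        have : ((J.card + 1 : ℕ) : ℝ) ≤ ((2^(2^(i+1)) : ℕ) : ℝ) := by exact_mod_cast hJc
        push_cast at this
        refine this.trans (le_of_eq ?_)
        rw [← Real.rpow_natCast]
        push_cast
        rfl
      have h6 := flog_nat_nonneg J.card
      have h7 : flog (J.card : ℝ) ^ p ≤ ((2:ℝ)^(i+1))^p := Real.rpow_le_rpow h6 h5 hp.le
      have h8 : 0 ≤ flog (J.card : ℝ) ^ p := Real.rpow_nonneg h6 p
      exact mul_le_mul h7 hG (by
        by_contra hneg
        push Not at hneg
        have := sum_le_gnorm p hp b {0}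
        have h9 : flog (((1:ℕ)):ℝ) = 1 := by
          unfold flog; norm_num
        rw [Finset.card_singleton, Finset.sum_singleton, h9, Real.one_rpow, one_mul] at this
        linarith [abs_nonneg (b 0)]) (by positivity)
    calc ∑ j ∈ J, u j ≤ ∑ j ∈ J, |b (σ j)| / ((2:ℝ)^i)^q := by
          apply Finset.sum_le_sum
          intro j hj
          rw [hJ, Finset.mem_filter] at hj
          have h4 := hlow j
          rw [hj.2] at h4
          simp only [u]
          gcongr
      _ = (∑ j ∈ J, |b (σ j)|) / ((2:ℝ)^i)^q := by rw [Finset.sum_div]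
      _ ≤ (((2:ℝ)^(i+1))^p * G) / ((2:ℝ)^i)^q := by gcongr
      _ = G * 2^p * ((2:ℝ)^(p-q))^i := by
          rw [← Real.rpow_natCast, ← Real.rpow_natCast, ← Real.rpow_natCast, ← Real.rpow_mul (by norm_num),
            ← Real.rpow_mul (by norm_num), ← Real.rpow_mul (by norm_num), mul_comm _ G, mul_div_assoc, mul_assoc,
            ← Real.rpow_sub (by norm_num), ← Real.rpow_add (by norm_num)]
          congr 2
          push_cast
          ring
  have hr0 : 0 ≤ (2:ℝ)^(p-q) := by positivity
  have hr1 : (2:ℝ)^(p-q) < 1 := Real.rpow_lt_one_of_one_lt_of_neg (by norm_num) (by linarith)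
  refine ht.trans ?_
  rw [← Finset.sum_filter_add_sum_filter_not Finset.univ (fun j => lev j < I)]
  apply add_le_add
  · set J := Finset.univ.filter (fun j => lev j < I) with hJ
    have hJc := hcardle J I (fun j hj => by
      rw [hJ, Finset.mem_filter] at hj
      refine (hhigh j).trans_le ?_
      exact Nat.pow_le_pow_right (by norm_num) (Nat.pow_le_pow_right (by norm_num) hj.2))
    calc ∑ j ∈ J, u j ≤ ∑ j ∈ J, τ := by
          apply Finset.sum_le_sum
          intro j _
          exact (div_le_self (abs_nonneg _) (hone j)).trans (hτ _)
      _ = J.card * τ := by simp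
      _ ≤ _ := by
          have : (J.card : ℝ) ≤ (2:ℝ)^(2^I) := by
            have : J.card ≤ 2^(2^I) := by omega
            exact_mod_cast this
          gcongr
  · rw [← Finset.sum_fiberwise_of_maps_to (t := Finset.Ico I (n+3)) (g := lev)]
    · calc _ ≤ ∑ i ∈ Finset.Ico I (n+3), G * 2^p * ((2:ℝ)^(p-q))^i := by
            apply Finset.sum_le_sum
            intro i _
            refine le_trans ?_ (hblock i)
            apply Finset.sum_le_sum_of_subset_of_nonneg
            · intro j hj
              simp only [Finset.mem_filter] at hj ⊢
              exact ⟨Finset.mem_univ _, hj.2⟩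
            · intro j _ _; exact hu0 j
        _ = G * 2^p * ∑ i ∈ Finset.Ico I (n+3), ((2:ℝ)^(p-q))^i := by rw [Finset.mul_sum]
        _ ≤ _ := by
            have := geom_sum_Ico_le_of_lt_one hr0 hr1 (m := I) (n := n + 3)
            gcongr
    · intro j hj
      simp only [Finset.mem_filter, Finset.mem_univ, true_and, not_lt] at hj
      rw [Finset.mem_Ico]
      refine ⟨hj, ?_⟩
      have h4 : lev j ≤ Nat.log 2 (j + 2) := Nat.log_le_self _ _
      have h5 : Nat.log 2 (j + 2) ≤ j + 2 := Nat.log_le_self _ _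
      have := j.2
      omega

theorem exists_big (p : ℝ) (t G : ℝ) (ht : 0 < t) (hG : 0 ≤ G) :
    ∃ K : ℕ, 0 < K ∧ flog (K : ℝ) ^ p * G < K * t := by
  have h := isLittleO_log_rpow_rpow_atTop p (s := 1) one_pos
  have hl2 : 0 < Real.log 2 := Real.log_pos (by norm_num)
  have hδ : 0 < t * (Real.log 2)^p / (2 * (G + 1)) := by positivity
  have h1 := h.def hδ
  have h2 : Tendsto (fun K : ℕ => (K : ℝ) + 1) atTop atTop :=
    tendsto_atTop_add_const_right _ _ tendsto_natCast_atTop_atTop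
  obtain ⟨K, hK, hK1⟩ := ((h2.eventually h1).and (eventually_ge_atTop 1)).exists
  refine ⟨K, hK1, ?_⟩
  have hKr : (1:ℝ) ≤ K := by exact_mod_cast hK1
  have hlog0 : 0 ≤ Real.log ((K:ℝ) + 1) := Real.log_nonneg (by linarith)
  rw [Real.rpow_one, Real.norm_of_nonneg (Real.rpow_nonneg hlog0 p),
    Real.norm_of_nonneg (by positivity)] at hK
  have h3 : flog (K:ℝ) ^ p ≤ t / (2 * (G+1)) * (K + 1) := by
    unfold flog Real.logb
    rw [Real.div_rpow hlog0 hl2.le, div_le_iff₀ (by positivity)]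
    refine hK.trans (le_of_eq ?_)
    ring
  calc flog (K:ℝ) ^ p * G ≤ t / (2 * (G+1)) * (K + 1) * G := by gcongr
    _ = (t * (K+1) / 2) * (G / (G+1)) := by field_simp
    _ < (t * (K+1) / 2) * 1 := by
        apply mul_lt_mul_of_pos_left _ (by positivity)
        rw [div_lt_one (by positivity)]; linarith
    _ ≤ K * t := by nlinarith

theorem exists_subseq_bounded_map {X E F : Type*}
    [NormedAddCommGroup X] [NormedSpace ℝ X] [CompleteSpace X]
    [NormedAddCommGroup E] [NormedSpace ℝ E]
    [NormedAddCommGroup F] [NormedSpace ℝ F]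
    (x y : ℕ → X) (xt : ℕ → E) (yt : ℕ → F)
    (hxsn : Seminormalized x) (hysn : Seminormalized y)
    (hxb : IsBasicSeq x) (hyb : IsBasicSeq y)
    (hxw : WeaklyNull x) (hyw : WeaklyNull y)
    (hxs : HasSpreadingModel x xt) (hys : HasSpreadingModel y yt)
    (p q : ℝ) (hp : 0 < p) (hpq : p < q)
    (c C : ℝ) (hc : 0 < c) (hC : 0 < C)
    (hlow : ∀ a : ℕ →₀ ℝ,
      c * gnorm (fun l => flog l ^ p) a ≤ ‖∑ n ∈ a.support, a n • xt n‖)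
    (hup : ∀ a : ℕ →₀ ℝ,
      ‖∑ n ∈ a.support, a n • yt n‖ ≤ C * tnorm (fun l => flog l ^ q) a) :
    ∃ φ : ℕ → ℕ, StrictMono φ ∧ ∃ M : ℝ, ∀ (a : ℕ → ℝ) (s : Finset ℕ),
      ‖∑ k ∈ s, a k • y (φ k)‖ ≤ M * ‖∑ k ∈ s, a k • x (φ k)‖ := by

  classical
  obtain ⟨cx, Bx, hcx, hxn⟩ := hxsn
  obtain ⟨cy, By, hcy, hyn⟩ := hysn
  obtain ⟨-, Kb, hKb1, hKb⟩ := hxb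
  have hKb0 : 0 ≤ Kb := by linarith
  have hBx0 : 0 ≤ Bx := (norm_nonneg _).trans (hxn 0).2
  have hBy0 : 0 ≤ By := (norm_nonneg _).trans (hyn 0).2
  set D : ℝ := 2 * Kb / cx with hD
  have hD0 : 0 < D := by
    have : 0 < Kb := by linarith
    positivity
  set D' : ℝ := 1 + Kb + 6 * (2 * Kb / cx) with hD'
  have hD'0 : 0 ≤ D' := by positivity
  set G : ℝ := (D' + 1) / c with hG
  have hG0 : 0 ≤ G := by positivity
  have hr0 : 0 ≤ (2:ℝ)^(p-q) := by positivity
  have hr1 : (2:ℝ)^(p-q) < 1 := Real.rpow_lt_one_of_one_lt_of_neg (by norm_num) (by linarith)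
  -- choice of `I m`
  have hI : ∀ m : ℕ, ∃ I : ℕ, G * 2^p * (((2:ℝ)^(p-q))^I / (1 - (2:ℝ)^(p-q))) ≤ (1/2)^m := by
    intro m
    have h1 : Tendsto (fun I : ℕ => G * 2^p * (((2:ℝ)^(p-q))^I / (1 - (2:ℝ)^(p-q)))) atTop (𝓝 0) := by
      have := ((tendsto_pow_atTop_nhds_zero_of_lt_one hr0 hr1).div_const
        (1 - (2:ℝ)^(p-q))).const_mul (G * 2^p)
      simpa using this
    exact (h1.eventually (ge_mem_nhds (show (0:ℝ) < (1/2)^m by positivity))).exists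
  choose I hI using hI
  set D1 : ℝ := D * 2^(2^(I 0)) with hD1
  have hD10 : 0 < D1 := by positivity
  let t : ℕ → ℝ := fun m => D1 * (1/2)^m / (2^(2^(I m)) + m)
  have ht0 : ∀ m, 0 < t m := fun m => by positivity
  have htD : t 0 = D := by simp [t, hD1]
  have htm1 : ∀ m, 2^(2^(I m)) * t m ≤ D1 * (1/2)^m := by
    intro m
    simp only [t]
    rw [mul_div_assoc', div_le_iff₀ (by positivity), mul_comm]
    have : (0:ℝ) ≤ m := by positivity
    gcongr
    linarith
  have htm2 : ∀ m : ℕ, m * t m ≤ D1 * (1/2)^m := by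
    intro m
    simp only [t]
    rw [mul_div_assoc', div_le_iff₀ (by positivity), mul_comm]
    gcongr
    have : (0:ℝ) ≤ 2^(2^(I m)) := by positivity
    linarith
  have htle : ∀ m, t m ≤ D1 * (1/2)^m := by
    intro m
    refine le_trans ?_ (htm1 m)
    have : (1:ℝ) ≤ 2^(2^(I m)) := one_le_pow₀ (by norm_num)
    nlinarith [ht0 m]
  -- choice of `K m`
  choose K0 hK0pos hK0 using fun m => exists_big p (t (m+1)) G (ht0 (m+1)) hG0
  let K : ℕ → ℕ := fun m => ∑ i ∈ Finset.range (m+1), K0 i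
  have hKmono : Monotone K := by
    intro a b hab
    exact Finset.sum_le_sum_of_subset (Finset.range_subset_range.2 (by omega))
  have hK0K : ∀ m, K0 m ≤ K m := fun m =>
    Finset.single_le_sum (f := K0) (fun _ _ => Nat.zero_le _) (Finset.mem_range.2 (by omega))
  choose Nx hNx using fun m => unif_spread' x xt hxs Bx hBx0 (fun n => (hxn n).2) D (K m) 1 one_pos
  choose Ny hNy using fun m : ℕ => unif_spread' y yt hys By hBy0 (fun n => (hyn n).2) D (K m)
    ((1/2)^m) (by positivity)
  obtain ⟨φ, hφ, hQ, hsch⟩ := schreier x Kb hKb hKb0 cx Bx hcx (fun n => (hxn n).1)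
    (fun n => (hxn n).2) hxw K hKmono (fun m => max (Nx m) (Ny m))
  refine ⟨φ, hφ, 2 * (D1 * By + C * (D1 + 1) + 1), ?_⟩
  -- normalized version
  have main : ∀ (a : ℕ → ℝ) (s : Finset ℕ), ‖∑ k ∈ s, a k • x (φ k)‖ = 1 →
      ‖∑ k ∈ s, a k • y (φ k)‖ ≤ 2 * (D1 * By + C * (D1 + 1) + 1) := by
    intro a s hS
    have hcoef : ∀ i ∈ s, |a i| ≤ D := fun i hi => by
      have := basic_coef x Kb hKb cx hcx (fun n => (hxn n).1) φ hφ a s i hi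
      rwa [hS, mul_one] at this
    -- lower estimate on small sets
    have hgn : ∀ m (F : Finset ℕ), (∀ i ∈ F, m ≤ i) → F.card ≤ K m → F ⊆ s →
        gnorm (fun l => flog l ^ p) (restr F a) ≤ G := by
      intro m F hFm hFc hFs
      have h1 := hsch m F hFm hFc a s hFs
      rw [hS, mul_one] at h1
      have h2 := hNx m F a φ hFc (fun i hi => hcoef i (hFs hi)) hφ
        (fun i hi => (le_max_left _ _).trans ((hQ m).trans (hφ.monotone (hFm i hi))))
      have h3 := hlow (restr F a)
      rw [hG, le_div_iff₀ hc]
      have h4 := (abs_le.1 h2).1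
      linarith
    -- levels
    have hex : ∀ i, a i ≠ 0 → ∃ m, t (m+1) < |a i| := by
      intro i hi
      have h1 : Tendsto (fun m : ℕ => D1 * ((1:ℝ)/2)^m) atTop (𝓝 0) := by
        have := (tendsto_pow_atTop_nhds_zero_of_lt_one (r := (1:ℝ)/2) (by norm_num) (by norm_num)).const_mul D1
        simpa using this
      obtain ⟨m, hm⟩ := (((tendsto_add_atTop_iff_nat 1).2 h1).eventually
        (gt_mem_nhds (abs_pos.2 hi))).exists
      exact ⟨m, (htle _).trans_lt hm⟩
    let lev : ℕ → ℕ := fun i => if h : a i ≠ 0 then Nat.find (hex i h) else 0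
    have hlev1 : ∀ i, a i ≠ 0 → t (lev i + 1) < |a i| := by
      intro i hi
      simp only [lev, dif_pos hi]
      exact Nat.find_spec (hex i hi)
    have hlev2 : ∀ i ∈ s, a i ≠ 0 → |a i| ≤ t (lev i) := by
      intro i his hi
      rcases hl : lev i with _ | m
      · rw [htD]; exact hcoef i his
      · have : m < Nat.find (hex i hi) := by
          simp only [lev, dif_pos hi] at hl
          omega
        exact not_lt.1 (Nat.find_min (hex i hi) this)
    set s' := s.filter (fun i => a i ≠ 0) with hs'
    have hss' : ∑ k ∈ s, a k • y (φ k) = ∑ k ∈ s', a k • y (φ k) := by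
      rw [hs', Finset.sum_filter]
      apply Finset.sum_congr rfl
      intro i _
      by_cases h : a i = 0 <;> simp [h]
    set n := s'.sup lev + 1 with hn
    have hlevel : ∀ m, ‖∑ k ∈ s'.filter (fun k => lev k = m), a k • y (φ k)‖ ≤
        (D1 * By + C * (D1 + 1) + 1) * (1/2)^m := by
      intro m
      set A := s'.filter (fun k => lev k = m) with hA
      have hAs : ∀ i ∈ A, i ∈ s := fun i hi =>
        (Finset.mem_filter.1 (Finset.mem_filter.1 hi).1).1
      have hAne : ∀ i ∈ A, a i ≠ 0 := fun i hi =>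
        (Finset.mem_filter.1 (Finset.mem_filter.1 hi).1).2
      have hAl : ∀ i ∈ A, lev i = m := fun i hi => (Finset.mem_filter.1 hi).2
      have hA1 : ∀ i ∈ A, t (m+1) < |a i| := fun i hi => by
        have := hlev1 i (hAne i hi); rwa [hAl i hi] at this
      have hA2 : ∀ i ∈ A, |a i| ≤ t m := fun i hi => by
        have := hlev2 i (hAs i hi) (hAne i hi); rwa [hAl i hi] at this
      rw [← Finset.sum_filter_add_sum_filter_not A (fun i => i < m)]
      -- head
      have hhead : ‖∑ k ∈ A.filter (fun i => i < m), a k • y (φ k)‖ ≤ D1 * By * (1/2)^m := by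
        have hcard : (A.filter (fun i => i < m)).card ≤ m := by
          have : A.filter (fun i => i < m) ⊆ Finset.range m := by
            intro i hi; exact Finset.mem_range.2 (Finset.mem_filter.1 hi).2
          simpa using Finset.card_le_card this
        calc _ ≤ ∑ k ∈ A.filter (fun i => i < m), ‖a k • y (φ k)‖ := norm_sum_le _ _
          _ ≤ ∑ k ∈ A.filter (fun i => i < m), t m * By := by
              apply Finset.sum_le_sum
              intro i hi
              rw [norm_smul, Real.norm_eq_abs]
              exact mul_le_mul (hA2 i (Finset.mem_filter.1 hi).1) (hyn _).2 (norm_nonneg _) (ht0 m).le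
          _ = (A.filter (fun i => i < m)).card * (t m * By) := by rw [Finset.sum_const, nsmul_eq_mul]
          _ ≤ m * (t m * By) := by
              have := (ht0 m).le
              gcongr
          _ = (m * t m) * By := by ring
          _ ≤ (D1 * (1/2)^m) * By := mul_le_mul_of_nonneg_right (htm2 m) hBy0
          _ = _ := by ring
      -- tail
      set A' := A.filter (fun i => ¬ i < m) with hA'
      have hA'm : ∀ i ∈ A', m ≤ i := fun i hi => not_lt.1 (Finset.mem_filter.1 hi).2
      have hA'A : A' ⊆ A := Finset.filter_subset _ _
      have hcardA' : A'.card ≤ K m := by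
        by_contra hcon
        push Not at hcon
        obtain ⟨F, hFA', hFc⟩ := Finset.exists_subset_card_eq ((hK0K m).trans hcon.le)
        have hgF := hgn m F (fun i hi => hA'm i (hFA' hi)) (hFc ▸ hK0K m)
          (fun i hi => hAs i (hA'A (hFA' hi)))
        have h1 := sum_le_gnorm p hp (restr F a) (Finset.range F.card)
        rw [Finset.card_range] at h1
        have h2 : (K0 m : ℝ) * t (m+1) ≤ ∑ i ∈ Finset.range F.card, |restr F a i| := by
          rw [Finset.sum_range]
          simp_rw [restr_apply]
          rw [sum_enum F (fun i => |a i|), ← hFc, ← nsmul_eq_mul]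
          exact Finset.card_nsmul_le_sum _ _ _ (fun i hi => (hA1 i (hA'A (hFA' hi))).le)
        have h3 : flog (F.card : ℝ) ^ p * gnorm (fun l => flog l ^ p) (restr F a) ≤
            flog (K0 m : ℝ) ^ p * G := by
          rw [hFc]
          exact mul_le_mul_of_nonneg_left hgF (Real.rpow_nonneg (flog_nat_nonneg _) _)
        linarith [hK0 m]
      have hgA := hgn m A' hA'm hcardA' (fun i hi => hAs i (hA'A hi))
      have hyA := hNy m A' a φ hcardA' (fun i hi => hcoef i (hAs i (hA'A hi))) hφ
        (fun i hi => (le_max_right _ _).trans ((hQ m).trans (hφ.monotone (hA'm i hi))))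
      have htn := tnorm_le p q hp hpq (restr A' a) (t m) G (ht0 m).le hG0
        (restr_abs A' a (t m) (ht0 m).le (fun i hi => hA2 i (hA'A hi))) hgA (I m)
      have hu := hup (restr A' a)
      have htn2 : tnorm (fun l => flog l ^ q) (restr A' a) ≤ (D1 + 1) * (1/2)^m := by
        linarith [htm1 m, hI m]
      have htail : ‖∑ k ∈ A', a k • y (φ k)‖ ≤ C * ((D1 + 1) * (1/2)^m) + (1/2)^m := by
        have h1 := mul_le_mul_of_nonneg_left htn2 hC.le
        linarith [(abs_le.1 hyA).2]
      refine (norm_add_le _ _).trans ?_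
      linarith
    rw [hss', ← Finset.sum_fiberwise_of_maps_to (t := Finset.range n) (g := lev)
      (fun i hi => Finset.mem_range.2 (Nat.lt_succ_of_le (Finset.le_sup hi)))]
    refine (norm_sum_le _ _).trans ((Finset.sum_le_sum (fun m _ => hlevel m)).trans ?_)
    rw [← Finset.mul_sum]
    have hg := geo_Ico 0 n
    rw [← Finset.range_eq_Ico, pow_zero, mul_one] at hg
    have : 0 ≤ D1 * By + C * (D1 + 1) + 1 := by positivity
    nlinarith
  intro a s
  rcases eq_or_ne (‖∑ k ∈ s, a k • x (φ k)‖) 0 with h0 | h0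
  · have hz : ∀ i ∈ s, a i = 0 := by
      intro i hi
      have := basic_coef x Kb hKb cx hcx (fun n => (hxn n).1) φ hφ a s i hi
      rw [h0, mul_zero] at this
      exact abs_nonpos_iff.1 this
    rw [h0, mul_zero, Finset.sum_eq_zero (fun i hi => by rw [hz i hi, zero_smul]), norm_zero]
  · set r := ‖∑ k ∈ s, a k • x (φ k)‖ with hr
    have hrpos : 0 < r := lt_of_le_of_ne (norm_nonneg _) (Ne.symm h0)
    have hsc : ∀ z : ℕ → X, ‖∑ k ∈ s, (r⁻¹ * a k) • z k‖ = r⁻¹ * ‖∑ k ∈ s, a k • z k‖ := by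
      intro z
      simp_rw [mul_smul]
      rw [← Finset.smul_sum, norm_smul, Real.norm_of_nonneg (by positivity)]
    have h1 := main (fun k => r⁻¹ * a k) s (by
      rw [hsc (fun k => x (φ k)), ← hr, inv_mul_cancel₀ h0])
    rw [hsc (fun k => y (φ k)), inv_mul_le_iff₀ hrpos] at h1
    linarith
end
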